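/- If X → S is a morphism of schemes locally of finite type and S is Jacobson, universally catenary, locally Noetherian, with all local rings G-rings, and with every irreducible component finite-dimensional and equicodimensional, then X has all of these same properties. -/

import Mathlib

open AlgebraicGeometry TopologicalSpace Order
/-- A chain of irreducible closed subsets is saturated (maximal with given endpoints)
if each step is a covering relation. -/
def IsSaturatedChain {X : Type*} [TopologicalSpace X]
    (p : LTSeries (IrreducibleCloseds X)) : Prop :=
  ∀ i : Fin p.length, p.toFun i.castSucc ⋖ p.toFun i.succ

/-- A topological space is catenary if any two saturated chains of irreducible closed
subsets with the same endpoints have the same length. -/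
def IsCatenarySpace (X : Type*) [TopologicalSpace X] : Prop :=
  ∀ p q : LTSeries (IrreducibleCloseds X), p.head = q.head → p.last = q.last →
    IsSaturatedChain p → IsSaturatedChain q → p.length = q.length

/-- A maximal chain of irreducible closed subsets: saturated, starting at a minimal
irreducible closed subset and ending at a maximal one. -/
def IsMaximalChain {X : Type*} [TopologicalSpace X]
    (p : LTSeries (IrreducibleCloseds X)) : Prop :=
  IsSaturatedChain p ∧ IsMin p.head ∧ IsMax p.last

/-- The codimension `codim(Y, Z)`: the supremum of lengths of chains of irreducible
closed subsets from `Y` to `Z`. -/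
noncomputable def relCodim {X : Type*} [TopologicalSpace X]
    (Y Z : IrreducibleCloseds X) : ℕ∞ :=
  ⨆ p : {p : LTSeries (IrreducibleCloseds X) // p.head = Y ∧ p.last = Z},
    (p.1.length : ℕ∞)

/-- The dimension of the irreducible closed subset `Y`: the supremum of lengths of
chains of irreducible closed subsets contained in `Y`. -/
noncomputable def chainDim {X : Type*} [TopologicalSpace X]
    (Y : IrreducibleCloseds X) : ℕ∞ :=
  ⨆ p : {p : LTSeries (IrreducibleCloseds X) // p.last ≤ Y}, (p.1.length : ℕ∞)

/-- The dimension of `X`: the supremum of lengths of chains of irreducible closed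
subsets of `X`. -/
noncomputable def spaceDim (X : Type*) [TopologicalSpace X] : ℕ∞ :=
  ⨆ p : LTSeries (IrreducibleCloseds X), (p.length : ℕ∞)

/-- The codimension of `Y` in the ambient space: the supremum of lengths of chains of
irreducible closed subsets starting at `Y`. -/
noncomputable def codimAbove {X : Type*} [TopologicalSpace X]
    (Y : IrreducibleCloseds X) : ℕ∞ :=
  ⨆ p : {p : LTSeries (IrreducibleCloseds X) // p.head = Y}, (p.1.length : ℕ∞)

/-- A topological space is equicodimensional if all minimal irreducible closed subsets
have the same codimension. -/
def IsEquicodim (X : Type*) [TopologicalSpace X] : Prop :=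
  ∀ Y Y' : IrreducibleCloseds X, IsMin Y → IsMin Y' → codimAbove Y = codimAbove Y'
open IsLocalRing TensorProduct in
/-- A (Noetherian) local ring is regular if its Krull dimension equals the dimension of
its cotangent space (embedding dimension). -/
def IsRegularLocal (A : Type u) [CommRing A] [IsLocalRing A] : Prop :=
  ringKrullDim A =
    (Module.finrank (IsLocalRing.ResidueField A) (IsLocalRing.CotangentSpace A) :
      WithBot ℕ∞)

/-- A commutative ring is regular if all of its localizations at primes are regular
local rings. -/
def IsRegularCommRing (B : Type u) [CommRing B] : Prop :=
  ∀ (P : Ideal B) [P.IsPrime], IsRegularLocal (Localization.AtPrime P)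

/-- A `k`-algebra `B` over a field `k` is geometrically regular if `K ⊗[k] B` is
regular for every finite field extension `K` of `k`. -/
def IsGeometricallyRegular (k B : Type u) [Field k] [CommRing B] [Algebra k B] : Prop :=
  ∀ (K : Type u) [Field K] [Algebra k K], Module.Finite k K →
    IsRegularCommRing (TensorProduct k K B)

/-- The residue field of a commutative ring at a prime ideal. -/
noncomputable abbrev primeResidueField (A : Type u) [CommRing A] (p : Ideal A)
    [p.IsPrime] : Type u :=
  IsLocalRing.ResidueField (Localization.AtPrime p)

/-- A Noetherian local ring is a G-ring if for every prime `p`, the formal fibre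
`Â ⊗_A κ(p)` of the completion `Â` over `p` is geometrically regular over `κ(p)`. -/
def IsGRing (A : Type u) [CommRing A] [IsLocalRing A] : Prop :=
  ∀ (p : Ideal A) [p.IsPrime],
    IsGeometricallyRegular (primeResidueField A p)
      (TensorProduct A (primeResidueField A p)
        (AdicCompletion (IsLocalRing.maximalIdeal A) A))

/-- A scheme is universally catenary if every scheme locally of finite type over it is
catenary. -/
def UniversallyCatenary (S : Scheme.{u}) : Prop :=
  ∀ (X : Scheme.{u}) (f : X ⟶ S), LocallyOfFiniteType f → IsCatenarySpace X

namespace GTransfer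

set_option autoImplicit false
set_option linter.overlappingInstances false

universe u

section PD
open CategoryTheory

/-- `M` has projective dimension at most `n` over `R`. -/
def PDLE (R : Type u) [CommRing R] (n : ℕ) (M : Type u) [AddCommGroup M] [Module R M] : Prop :=
  HasProjectiveDimensionLE (ModuleCat.of R M) n

variable {R : Type u} [CommRing R] {M N F : Type u} [AddCommGroup M] [Module R M]
  [AddCommGroup N] [Module R N] [AddCommGroup F] [Module R F]

theorem PDLE.zero_iff : PDLE R 0 M ↔ Module.Projective R M := by
  rw [PDLE, ← projective_iff_hasProjectiveDimensionLE_zero, ← IsProjective.iff_projective]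

theorem PDLE.of_projective [Module.Projective R M] (n : ℕ) : PDLE R n M := by
  have h : PDLE R 0 M := PDLE.zero_iff.2 inferInstance
  unfold PDLE at *
  exact hasProjectiveDimensionLT_of_ge _ _ _ (by omega : 0 + 1 ≤ n + 1)

theorem PDLE.mono {n m : ℕ} (h : n ≤ m) (hM : PDLE R n M) : PDLE R m M := by
  unfold PDLE at *
  exact hasProjectiveDimensionLT_of_ge _ (n + 1) _ (by omega)

theorem PDLE.retract {n : ℕ} (hM : PDLE R n M) (i : N →ₗ[R] M) (r : M →ₗ[R] N)
    (h : r ∘ₗ i = LinearMap.id) : PDLE R n N := by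
  unfold PDLE at *
  exact Retract.hasProjectiveDimensionLT (Y := ModuleCat.of R M)
    ⟨ModuleCat.ofHom i, ModuleCat.ofHom r, by rw [← ModuleCat.ofHom_comp, h]; rfl⟩ _

theorem PDLE.equiv {n : ℕ} (hM : PDLE R n M) (e : M ≃ₗ[R] N) : PDLE R n N :=
  hM.retract e.symm.toLinearMap e.toLinearMap (by ext; simp)

theorem PDLE.succ_iff [Module.Projective R F] {n : ℕ} (f : F →ₗ[R] M)
    (hf : Function.Surjective f) : PDLE R (n + 1) M ↔ PDLE R n (LinearMap.ker f) := by
  have hp : Projective (ModuleCat.of R F) := by rw [← IsProjective.iff_projective]; infer_instance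
  let S := f.shortComplexKer
  have hS : S.ShortExact := LinearMap.shortExact_shortComplexKer hf
  unfold PDLE
  exact hS.hasProjectiveDimensionLT_X₃_iff (n := n) (h₂ := hp)

end PD

section BaseChange
open TensorProduct

variable {R : Type u} [CommRing R] {M F : Type u} [AddCommGroup M] [Module R M]
  [AddCommGroup F] [Module R F] (B : Type u) [CommRing B] [Algebra R B]

theorem PDLE.baseChange_succ_iff [Module.Projective R F] {n : ℕ} (f : F →ₗ[R] M)
    (hf : Function.Surjective f)
    (hi : Function.Injective ((LinearMap.ker f).subtype.baseChange B)) :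
    PDLE B (n + 1) (B ⊗[R] M) ↔ PDLE B n (B ⊗[R] LinearMap.ker f) := by
  have hs : Function.Surjective (f.baseChange B) := LinearMap.lTensor_surjective B hf
  rw [PDLE.succ_iff (f.baseChange B) hs]
  have hex : Function.Exact ((LinearMap.ker f).subtype.baseChange B) (f.baseChange B) :=
    lTensor_exact B (LinearMap.exact_subtype_ker_map f) hf
  let e : (B ⊗[R] LinearMap.ker f) ≃ₗ[B] LinearMap.ker (f.baseChange B) :=
    (LinearEquiv.ofInjective _ hi).trans
      (LinearEquiv.ofEq _ _ (LinearMap.exact_iff.1 hex).symm)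
  exact ⟨fun h => h.equiv e.symm, fun h => h.equiv e⟩

theorem PDLE.baseChange_of_flat [IsNoetherianRing R] [Module.Flat R B] (n : ℕ) :
    ∀ (M : Type u) [AddCommGroup M] [Module R M] [Module.Finite R M],
      PDLE R n M → PDLE B n (B ⊗[R] M) := by
  induction n with
  | zero =>
    intro M _ _ _ h
    rw [PDLE.zero_iff] at h ⊢
    infer_instance
  | succ n ih =>
    intro M _ _ _ h
    obtain ⟨k, f, hf⟩ := Module.Finite.exists_fin' R M
    rw [PDLE.baseChange_succ_iff B f hf
      (Module.Flat.lTensor_preserves_injective_linearMap _ (Submodule.subtype_injective _))]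
    exact ih _ ((PDLE.succ_iff f hf).1 h)

theorem PDLE.of_baseChange [IsNoetherianRing R] [IsLocalRing R] [Module.FaithfullyFlat R B]
    (n : ℕ) : ∀ (M : Type u) [AddCommGroup M] [Module R M] [Module.Finite R M],
      PDLE B n (B ⊗[R] M) → PDLE R n M := by
  induction n with
  | zero =>
    intro M _ _ _ h
    rw [PDLE.zero_iff] at h ⊢
    have : Module.Flat R M := by
      have : Module.Flat B (B ⊗[R] M) := inferInstance
      exact Module.Flat.of_flat_tensorProduct R M B
    have := Module.finitePresentation_of_finite R M
    have : Module.Free R M := Module.free_of_flat_of_isLocalRing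
    infer_instance
  | succ n ih =>
    intro M _ _ _ h
    obtain ⟨k, f, hf⟩ := Module.Finite.exists_fin' R M
    rw [PDLE.baseChange_succ_iff B f hf
      (Module.Flat.lTensor_preserves_injective_linearMap _ (Submodule.subtype_injective _))] at h
    exact (PDLE.succ_iff f hf).2 (ih _ h)

end BaseChange

section Quot
open TensorProduct IsLocalRing

variable {R : Type u} [CommRing R] {M F : Type u} [AddCommGroup M] [Module R M]
  [AddCommGroup F] [Module R F]

theorem one_tmul_eq_zero_iff (I : Ideal R) (m : M) :
    (1 : R ⧸ I) ⊗ₜ[R] m = 0 ↔ m ∈ I • (⊤ : Submodule R M) := by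
  rw [← (quotTensorEquivQuotSMul M I).map_eq_zero_iff, ← map_one (Ideal.Quotient.mk I),
    quotTensorEquivQuotSMul_mk_tmul, one_smul, Submodule.Quotient.mk_eq_zero]

theorem exists_eq_one_tmul (I : Ideal R) (z : (R ⧸ I) ⊗[R] M) : ∃ m : M, z = 1 ⊗ₜ m :=
  let ⟨m, hm⟩ := TensorProduct.mk_surjective R M (R ⧸ I) Ideal.Quotient.mk_surjective z
  ⟨m, hm.symm⟩

theorem injective_baseChange_ker_subtype (x : R) (hx : IsSMulRegular M x) (f : F →ₗ[R] M) :
    Function.Injective ((LinearMap.ker f).subtype.baseChange (R ⧸ Ideal.span {x})) := by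
  rw [injective_iff_map_eq_zero]
  intro z hz
  obtain ⟨⟨n, hn⟩, rfl⟩ := exists_eq_one_tmul _ z
  rw [LinearMap.baseChange_tmul, Submodule.subtype_apply, one_tmul_eq_zero_iff] at hz
  rw [one_tmul_eq_zero_iff]
  rw [Submodule.ideal_span_singleton_smul, Submodule.mem_smul_pointwise_iff_exists] at hz ⊢
  obtain ⟨g, -, rfl⟩ := hz
  refine ⟨⟨g, ?_⟩, trivial, rfl⟩
  rw [LinearMap.mem_ker] at hn ⊢
  rw [map_smul] at hn
  exact hx (by simpa using hn)

theorem isSMulRegular_fin {x : R} (hx : IsSMulRegular R x) (k : ℕ) :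
    IsSMulRegular (Fin k → R) x := fun a b h => by
  ext i; exact hx (congrFun h i)

theorem isSMulRegular_submodule {x : R} (hx : IsSMulRegular F x) (N : Submodule R F) :
    IsSMulRegular N x := fun a b h => by
  ext; exact hx (congrArg Subtype.val h)

theorem PDLE.quot [IsNoetherianRing R] {x : R} (hx : IsSMulRegular R x) (n : ℕ) :
    ∀ (M : Type u) [AddCommGroup M] [Module R M] [Module.Finite R M], IsSMulRegular M x →
      PDLE R n M → PDLE (R ⧸ Ideal.span {x}) n ((R ⧸ Ideal.span {x}) ⊗[R] M) := by
  induction n with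
  | zero =>
    intro M _ _ _ _ h
    rw [PDLE.zero_iff] at h ⊢
    infer_instance
  | succ n ih =>
    intro M _ _ _ hM h
    obtain ⟨k, f, hf⟩ := Module.Finite.exists_fin' R M
    rw [PDLE.baseChange_succ_iff _ f hf (injective_baseChange_ker_subtype x hM f)]
    exact ih _ (isSMulRegular_submodule (isSMulRegular_fin hx k) _) ((PDLE.succ_iff f hf).1 h)

/-- A free quotient lifts to a surjection from a free module. -/
theorem exists_free_cover [IsLocalRing R] [Module.Finite R M] (I : Ideal R)
    (hI : I ≤ maximalIdeal R) [Module.Free (R ⧸ I) ((R ⧸ I) ⊗[R] M)] :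
    ∃ (k : ℕ) (f : (Fin k → R) →ₗ[R] M), Function.Surjective f ∧
      Function.Injective (f.baseChange (R ⧸ I)) := by
  have : Nontrivial (R ⧸ I) := Ideal.Quotient.nontrivial_iff.2
    (fun h => (maximalIdeal.isMaximal R).ne_top (top_le_iff.1 (h ▸ hI)))
  let b := Module.finBasis (R ⧸ I) ((R ⧸ I) ⊗[R] M)
  choose m hm using fun i => exists_eq_one_tmul I (b i)
  let f : (Fin _ → R) →ₗ[R] M := Fintype.linearCombination R m
  refine ⟨_, f, ?_, ?_⟩
  · rw [← LinearMap.range_eq_top, ← top_le_iff]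
    refine Submodule.le_of_le_smul_of_le_jacobson_bot (I := I) Module.Finite.fg_top
      (hI.trans (IsLocalRing.maximalIdeal_le_jacobson _)) ?_
    intro y _
    have h1 := b.sum_repr (1 ⊗ₜ y)
    choose c hc using fun i => Ideal.Quotient.mk_surjective (b.repr (1 ⊗ₜ y) i)
    have h2 : (1 : R ⧸ I) ⊗ₜ[R] (y - f c) = 0 := by
      rw [tmul_sub, sub_eq_zero, ← h1, Fintype.linearCombination_apply, tmul_sum]
      refine Finset.sum_congr rfl fun i _ => ?_
      rw [← hc, hm, tmul_smul]
      rfl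
    rw [one_tmul_eq_zero_iff] at h2
    rw [← sub_add_cancel y (f c)]
    exact add_comm (f c) _ ▸ Submodule.add_mem_sup ⟨c, rfl⟩ h2
  · rw [injective_iff_map_eq_zero]
    intro z hz
    obtain ⟨v, rfl⟩ := exists_eq_one_tmul _ z
    rw [LinearMap.baseChange_tmul, Fintype.linearCombination_apply, tmul_sum] at hz
    have : ∀ i, Ideal.Quotient.mk I (v i) = 0 := by
      refine Fintype.linearIndependent_iff.1 b.linearIndependent (fun i => Ideal.Quotient.mk I (v i)) ?_
      rw [← hz]
      refine Finset.sum_congr rfl fun i _ => ?_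
      rw [hm, tmul_smul]
      rfl
    rw [one_tmul_eq_zero_iff]
    have h3 : v = ∑ i, v i • Pi.single i (1 : R) := by
      ext j; simp [Finset.sum_apply, Pi.single_apply]
    rw [h3]
    exact Submodule.sum_mem _ fun i _ => Submodule.smul_mem_smul
      (Ideal.Quotient.eq_zero_iff_mem.1 (this i)) trivial

theorem subsingleton_of_quot_tensor [IsLocalRing R] [Module.Finite R M] (I : Ideal R)
    (hI : I ≤ maximalIdeal R) (h : ∀ z : (R ⧸ I) ⊗[R] M, z = 0) (m : M) : m = 0 := by
  have : (⊤ : Submodule R M) ≤ ⊥ := by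
    refine Submodule.le_of_le_smul_of_le_jacobson_bot (I := I) Module.Finite.fg_top
      (hI.trans (IsLocalRing.maximalIdeal_le_jacobson _)) fun y _ => ?_
    rw [bot_sup_eq]
    exact (one_tmul_eq_zero_iff I y).1 (h _)
  exact this trivial

theorem PDLE.of_quot [IsNoetherianRing R] [IsLocalRing R] {x : R} (hx : IsSMulRegular R x)
    (hxm : x ∈ maximalIdeal R) (n : ℕ) :
    ∀ (M : Type u) [AddCommGroup M] [Module R M] [Module.Finite R M], IsSMulRegular M x →
      PDLE (R ⧸ Ideal.span {x}) n ((R ⧸ Ideal.span {x}) ⊗[R] M) → PDLE R n M := by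
  have hI : Ideal.span {x} ≤ maximalIdeal R := by simpa [Ideal.span_le]
  induction n with
  | zero =>
    intro M _ _ _ hM h
    rw [PDLE.zero_iff] at h ⊢
    have : Nontrivial (R ⧸ Ideal.span {x}) := Ideal.Quotient.nontrivial_iff.2
      (fun h => (maximalIdeal.isMaximal R).ne_top (top_le_iff.1 (h ▸ hI)))
    have : IsLocalRing (R ⧸ Ideal.span {x}) :=
      .of_surjective' (Ideal.Quotient.mk _) Ideal.Quotient.mk_surjective
    have : Module.Free (R ⧸ Ideal.span {x}) ((R ⧸ Ideal.span {x}) ⊗[R] M) :=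
      have := Module.finitePresentation_of_finite (R ⧸ Ideal.span {x})
        ((R ⧸ Ideal.span {x}) ⊗[R] M)
      Module.free_of_flat_of_isLocalRing
    obtain ⟨k, f, hf, hfi⟩ := exists_free_cover (M := M) (Ideal.span {x}) hI
    have hinj : Function.Injective f := by
      rw [← LinearMap.ker_eq_bot, eq_bot_iff]
      intro y hy
      have := subsingleton_of_quot_tensor (M := LinearMap.ker f) (Ideal.span {x}) hI (fun z => by
        apply injective_baseChange_ker_subtype x hM f
        apply hfi
        rw [map_zero, map_zero]
        obtain ⟨n, rfl⟩ := exists_eq_one_tmul _ z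
        simp [LinearMap.baseChange_tmul]) ⟨y, hy⟩
      simpa using this
    exact Module.Projective.of_equiv (LinearEquiv.ofBijective f ⟨hinj, hf⟩)
  | succ n ih =>
    intro M _ _ _ hM h
    obtain ⟨k, f, hf⟩ := Module.Finite.exists_fin' R M
    rw [PDLE.baseChange_succ_iff _ f hf (injective_baseChange_ker_subtype x hM f)] at h
    exact (PDLE.succ_iff f hf).2 (ih _ (isSMulRegular_submodule (isSMulRegular_fin hx k) _) h)

end Quot

section Regular
open TensorProduct IsLocalRing

variable {R : Type u} [CommRing R] [IsLocalRing R] [IsNoetherianRing R]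

theorem exists_ringKrullDim_eq_nat (R : Type*) [CommRing R] [IsLocalRing R] [IsNoetherianRing R] :
    ∃ n : ℕ, ringKrullDim R = n := by
  have h1 := ringKrullDim_ne_top (R := R)
  have h2 := ringKrullDim_ne_bot (R := R)
  lift ringKrullDim R to ℕ∞ using h2 with m
  lift m to ℕ using (by rintro rfl; exact h1 rfl)
  exact ⟨m, rfl⟩

theorem isRegularLocalRing_of_span (s : Finset R) (hs : Ideal.span (s : Set R) = maximalIdeal R)
    (h : (s.card : WithBot ℕ∞) ≤ ringKrullDim R) : IsRegularLocalRing R := by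
  apply IsRegularLocalRing.of_spanFinrank_maximalIdeal_le
  refine le_trans ?_ h
  rw [← hs]
  have := Submodule.spanFinrank_span_le_ncard_of_finite (R := R) s.finite_toSet
  rw [Set.ncard_coe_finset] at this
  exact_mod_cast this

theorem exists_span_card_eq (R : Type u) [CommRing R] [IsLocalRing R] [IsNoetherianRing R] :
    ∃ s : Finset R, Ideal.span (s : Set R) = maximalIdeal R ∧
      s.card = (maximalIdeal R).spanFinrank := by
  have hf : (maximalIdeal R).generators.Finite :=
    Submodule.FG.finite_generators (IsNoetherian.noetherian _)
  refine ⟨hf.toFinset, ?_, ?_⟩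
  · rw [Set.Finite.coe_toFinset]
    exact Submodule.span_generators _
  · rw [← Set.ncard_eq_toFinset_card _ hf]
    exact Submodule.FG.generators_ncard (IsNoetherian.noetherian _)

theorem IsRegularLocalRing.exists_span_card_eq_dim [IsRegularLocalRing R] :
    ∃ s : Finset R, Ideal.span (s : Set R) = maximalIdeal R ∧
      (s.card : WithBot ℕ∞) = ringKrullDim R := by
  obtain ⟨s, hs, hc⟩ := exists_span_card_eq R
  exact ⟨s, hs, by rw [hc, IsRegularLocalRing.spanFinrank_maximalIdeal]⟩

theorem isLocalRing_quotient {A : Type*} [CommRing A] [IsLocalRing A] {I : Ideal A}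
    (hI : I ≤ maximalIdeal A) : IsLocalRing (A ⧸ I) := by
  have : Nontrivial (A ⧸ I) := Ideal.Quotient.nontrivial_iff.2
      (fun h => (maximalIdeal.isMaximal A).ne_top (top_le_iff.1 (h ▸ hI)))
  exact .of_surjective' (Ideal.Quotient.mk _) Ideal.Quotient.mk_surjective

theorem map_maximalIdeal_quotient {A : Type*} [CommRing A] [IsLocalRing A] (I : Ideal A)
    [IsLocalRing (A ⧸ I)] :
    (maximalIdeal A).map (Ideal.Quotient.mk I) = maximalIdeal (A ⧸ I) :=
  IsLocalRing.map_maximalIdeal_of_surjective _ Ideal.Quotient.mk_surjective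

omit [IsNoetherianRing R] in
/-- Dividing by an element outside the square of the maximal ideal saves a generator. -/
theorem exists_span_quotient {x : R} (hx : x ∈ maximalIdeal R) (hx2 : x ∉ maximalIdeal R ^ 2)
    [IsLocalRing (R ⧸ Ideal.span {x})]
    (s : Finset R) (hs : Ideal.span (s : Set R) = maximalIdeal R) :
    ∃ t : Finset (R ⧸ Ideal.span {x}), Ideal.span (t : Set (R ⧸ Ideal.span {x})) =
      maximalIdeal (R ⧸ Ideal.span {x}) ∧ t.card + 1 ≤ s.card := by
  classical
  rw [← hs] at hx
  obtain ⟨c, hc⟩ := (Submodule.mem_span_finset' ).1 hx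
  obtain ⟨i, hi⟩ : ∃ i : s, IsUnit (c i) := by
    by_contra! h
    apply hx2
    rw [← hc]
    refine Ideal.sum_mem _ fun i _ => ?_
    rw [pow_two]
    exact Ideal.mul_mem_mul ((mem_maximalIdeal _).2 (h i)) (hs ▸ Ideal.subset_span i.2)
  let π := Ideal.Quotient.mk (Ideal.span {x})
  refine ⟨(s.erase i.1).image π, ?_, ?_⟩
  · rw [← map_maximalIdeal_quotient, ← hs, Ideal.map_span]
    apply le_antisymm
    · apply Ideal.span_mono
      rw [Finset.coe_image]
      exact Set.image_mono (Finset.coe_subset.2 (Finset.erase_subset _ _))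
    · rw [Ideal.span_le]
      have hmem : ∀ j : s, j ≠ i → π j ∈ Ideal.span (((s.erase i.1).image π : Finset _) : Set _) := by
        intro j hj
        apply Ideal.subset_span
        rw [Finset.coe_image]
        exact ⟨j, Finset.mem_coe.2 (Finset.mem_erase.2 ⟨fun h => hj (Subtype.ext h), j.2⟩), rfl⟩
      rintro _ ⟨j, hj, rfl⟩
      by_cases hji : (⟨j, hj⟩ : s) = i
      · have hc' : π (∑ a, c a • (a : R)) = π x := congrArg π hc
        have h0 : π x = 0 := Ideal.Quotient.eq_zero_iff_mem.2 (Ideal.mem_span_singleton_self x)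
        rw [← hc', map_sum, ← Finset.add_sum_erase _ _ (Finset.mem_univ i)] at h0
        have h1 : π (c i) * π i = - ∑ j ∈ Finset.univ.erase i, π (c j • (j : R)) := by
          rw [← map_mul]; exact eq_neg_of_add_eq_zero_left h0
        have h2 : π (c i) * π i ∈ Ideal.span (((s.erase i.1).image π : Finset _) : Set _) := by
          rw [h1]
          refine neg_mem (Ideal.sum_mem _ fun j hj => ?_)
          rw [smul_eq_mul, map_mul]
          exact Ideal.mul_mem_left _ _ (hmem j (Finset.ne_of_mem_erase hj))
        obtain rfl : j = i.1 := congrArg Subtype.val hji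
        exact (Ideal.unit_mul_mem_iff_mem _ (hi.map π)).1 h2
      · exact hmem ⟨j, hj⟩ hji
  · have := Finset.card_image_le (s := s.erase i.1) (f := π)
    have h2 := Finset.card_erase_add_one i.2
    omega

theorem isRegularLocalRing_quotient [IsRegularLocalRing R] {x : R} (hx : x ∈ maximalIdeal R)
    (hx2 : x ∉ maximalIdeal R ^ 2) : IsRegularLocalRing (R ⧸ Ideal.span {x}) ∧
      ringKrullDim (R ⧸ Ideal.span {x}) + 1 = ringKrullDim R := by
  have : IsLocalRing (R ⧸ Ideal.span {x}) := isLocalRing_quotient (by simpa [Ideal.span_le])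
  obtain ⟨s, hs, hsc⟩ := IsRegularLocalRing.exists_span_card_eq_dim (R := R)
  obtain ⟨t, ht, htc⟩ := exists_span_quotient hx hx2 s hs
  have h1 : ringKrullDim R ≤ ringKrullDim (R ⧸ Ideal.span {x}) + 1 := by
    refine (ringKrullDim_le_ringKrullDim_quotSMulTop_succ hx).trans_eq ?_
    congr 1
    refine ringKrullDim_eq_of_ringEquiv (Ideal.quotEquivOfEq ?_)
    ext y
    simp [Submodule.mem_smul_pointwise_iff_exists, Ideal.mem_span_singleton', mul_comm]
  have h2 : ringKrullDim (R ⧸ Ideal.span {x}) ≤ t.card := by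
    refine (ringKrullDim_le_spanFinrank_maximalIdeal _).trans ?_
    rw [← ht]
    have := Submodule.spanFinrank_span_le_ncard_of_finite (R := R ⧸ Ideal.span {x}) t.finite_toSet
    rw [Set.ncard_coe_finset] at this
    exact_mod_cast this
  rw [← hsc] at h1
  have h3 : ((t.card : WithBot ℕ∞)) + 1 ≤ s.card := by exact_mod_cast htc
  obtain ⟨n, hn⟩ := exists_ringKrullDim_eq_nat (R ⧸ Ideal.span {x})
  rw [hn] at h1 h2
  have h1' : s.card ≤ n + 1 := by exact_mod_cast h1
  have h2' : n ≤ t.card := by exact_mod_cast h2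
  refine ⟨isRegularLocalRing_of_span t ht ?_, ?_⟩
  · rw [hn]; exact_mod_cast (by omega : t.card ≤ n)
  · rw [hn, ← hsc]; exact_mod_cast (by omega : n + 1 = s.card)

end Regular

section Regular
open TensorProduct IsLocalRing

theorem maximalIdeal_not_le_sq {R : Type*} [CommRing R] [IsLocalRing R] [IsNoetherianRing R]
    (h : maximalIdeal R ≠ ⊥) : ¬ maximalIdeal R ≤ maximalIdeal R ^ 2 := by
  intro hle
  apply h
  rw [← le_bot_iff]
  refine Submodule.le_of_le_smul_of_le_jacobson_bot (I := maximalIdeal R)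
    (IsNoetherian.noetherian _) (IsLocalRing.maximalIdeal_le_jacobson _) ?_
  rw [bot_sup_eq, smul_eq_mul, ← pow_two]
  exact hle

theorem exists_mem_avoid {R : Type*} [CommRing R] [IsLocalRing R] [IsNoetherianRing R]
    {S : Set (Ideal R)} (hS : S.Finite) (hp : ∀ p ∈ S, p.IsPrime)
    (hm : ∀ p ∈ S, p ≠ maximalIdeal R) (h : maximalIdeal R ≠ ⊥) :
    ∃ x ∈ maximalIdeal R, x ∉ maximalIdeal R ^ 2 ∧ ∀ p ∈ S, x ∉ p := by
  classical
  by_contra! hcon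
  have hsub : (maximalIdeal R : Set R) ⊆ ⋃ i ∈ (↑(insert (maximalIdeal R ^ 2) hS.toFinset) : Set (Ideal R)), (i : Set R) := by
    intro x hx
    by_cases hx2 : x ∈ maximalIdeal R ^ 2
    · exact Set.mem_biUnion (by simp) hx2
    · obtain ⟨p, hpS, hxp⟩ := hcon x hx hx2
      exact Set.mem_biUnion (x := p) (by simp [hpS]) hxp
  rw [Ideal.subset_union_prime (f := fun i : Ideal R => i) (maximalIdeal R ^ 2) (maximalIdeal R ^ 2)] at hsub
  · obtain ⟨i, hi, hle⟩ := hsub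
    rcases Finset.mem_insert.1 hi with rfl | hi
    · exact maximalIdeal_not_le_sq h hle
    · have hi' := hS.mem_toFinset.1 hi
      exact hm i hi' ((maximalIdeal.isMaximal R).eq_of_le (hp i hi').ne_top hle).symm
  · intro i hi h1 _
    rcases Finset.mem_insert.1 hi with rfl | hi
    · exact absurd rfl h1
    · exact hp i (hS.mem_toFinset.1 hi)

theorem isDomain_of_isRegularLocalRing_aux (n : ℕ) : ∀ (R : Type u) [CommRing R]
    [IsRegularLocalRing R], ringKrullDim R = n → IsDomain R := by
  induction n with
  | zero =>
    intro R _ _ h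
    obtain ⟨s, hs, hc⟩ := IsRegularLocalRing.exists_span_card_eq_dim (R := R)
    rw [h] at hc
    have : s = ∅ := by rw [← Finset.card_eq_zero]; exact_mod_cast hc
    rw [this, Finset.coe_empty, Ideal.span_empty] at hs
    exact (IsLocalRing.isField_iff_maximalIdeal_eq.2 hs.symm).isDomain
  | succ n ih =>
    intro R _ _ h
    have hmin : ∀ p ∈ minimalPrimes R, p ≠ maximalIdeal R := by
      rintro p hp rfl
      have : Ring.KrullDimLE 0 R := by
        refine Ring.krullDimLE_zero_iff.2 fun q hq => ?_
        have : q = maximalIdeal R :=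
          le_antisymm (IsLocalRing.le_maximalIdeal hq.ne_top)
            (hp.2 ⟨hq, bot_le⟩ (IsLocalRing.le_maximalIdeal hq.ne_top))
        rw [this]; exact maximalIdeal.isMaximal R
      have h0 := ringKrullDimZero_iff_ringKrullDim_eq_zero.1 this
      rw [h0] at h
      exact absurd h (by exact_mod_cast (Nat.succ_ne_zero n).symm)
    have hbot : maximalIdeal R ≠ ⊥ := by
      intro hb
      have hf := IsLocalRing.isField_iff_maximalIdeal_eq.2 hb
      rw [ringKrullDim_eq_zero_of_isField hf] at h
      exact absurd h (by exact_mod_cast (Nat.succ_ne_zero n).symm)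
    obtain ⟨x, hx, hx2, hxp⟩ := exists_mem_avoid (minimalPrimes.finite_of_isNoetherianRing R)
      (fun p hp => hp.1.1) hmin hbot
    obtain ⟨h1, h2⟩ := isRegularLocalRing_quotient hx hx2
    have h3 : ringKrullDim (R ⧸ Ideal.span {x}) = n := by
      obtain ⟨k, hk⟩ := exists_ringKrullDim_eq_nat (R ⧸ Ideal.span {x})
      rw [hk, h] at h2
      rw [hk]
      have : k + 1 = n + 1 := by exact_mod_cast h2
      exact_mod_cast (by omega : k = n)
    have h4 := ih _ h3
    have h5 : (Ideal.span {x}).IsPrime := (Ideal.Quotient.isDomain_iff_prime _).1 h4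
    obtain ⟨p, hp, hpx⟩ := Ideal.exists_minimalPrimes_le (I := (⊥ : Ideal R)) (J := Ideal.span {x}) bot_le
    have h6 : p ≤ ⊥ := by
      refine Submodule.le_of_le_smul_of_le_jacobson_bot (I := Ideal.span {x})
        (IsNoetherian.noetherian _) ((by simpa [Ideal.span_le] : Ideal.span {x} ≤ maximalIdeal R).trans
          (IsLocalRing.maximalIdeal_le_jacobson _)) ?_
      rw [bot_sup_eq]
      intro y hy
      obtain ⟨z, rfl⟩ := Ideal.mem_span_singleton.1 (hpx hy)
      exact Submodule.smul_mem_smul (Ideal.mem_span_singleton_self x)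
        ((hp.1.1.mem_or_mem hy).resolve_left (hxp p hp))
    have h7 : (⊥ : Ideal R).IsPrime := (le_bot_iff.1 h6) ▸ hp.1.1
    exact IsDomain.of_bot_isPrime R

theorem isDomain_of_isRegularLocalRing (R : Type u) [CommRing R] [IsRegularLocalRing R] :
    IsDomain R :=
  let ⟨n, hn⟩ := exists_ringKrullDim_eq_nat R
  isDomain_of_isRegularLocalRing_aux n R hn

end Regular

section Regular
open TensorProduct IsLocalRing

theorem smul_eq_zero_of_mem_smul_top {R F : Type*} [CommRing R] [AddCommGroup F] [Module R F]
    {I : Ideal R} {s : R} (hs : ∀ x ∈ I, x * s = 0) {z : F} (hz : z ∈ I • (⊤ : Submodule R F)) :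
    s • z = 0 := by
  induction hz using Submodule.smul_induction_on' with
  | smul r hr n _ => rw [← mul_smul, mul_comm, hs r hr, zero_smul]
  | add x _ y _ hx hy => rw [smul_add, hx, hy, add_zero]

theorem free_of_pdle_of_mul_eq_zero {R : Type u} [CommRing R] [IsLocalRing R] [IsNoetherianRing R]
    {s : R} (hs0 : s ≠ 0) (hs : ∀ x ∈ maximalIdeal R, x * s = 0) (n : ℕ) :
    ∀ (M : Type u) [AddCommGroup M] [Module R M] [Module.Finite R M],
      PDLE R n M → Module.Free R M := by
  induction n with
  | zero =>
    intro M _ _ _ h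
    have := PDLE.zero_iff.1 h
    exact Module.free_of_flat_of_isLocalRing
  | succ n ih =>
    intro M _ _ _ h
    let _ : Field (R ⧸ maximalIdeal R) := Ideal.Quotient.field _
    have : Module.Free (R ⧸ maximalIdeal R) ((R ⧸ maximalIdeal R) ⊗[R] M) :=
      Module.Free.of_divisionRing _ _
    obtain ⟨k, f, hf, hi⟩ := exists_free_cover (M := M) (maximalIdeal R) le_rfl
    have h1 := ih _ ((PDLE.succ_iff f hf).1 h)
    have h2 : ∀ z : LinearMap.ker f, s • z = 0 := by
      rintro ⟨z, hz⟩
      have : (1 : R ⧸ maximalIdeal R) ⊗ₜ[R] z = 0 := by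
        apply hi
        rw [map_zero, LinearMap.baseChange_tmul, LinearMap.mem_ker.1 hz, tmul_zero]
      ext1
      exact smul_eq_zero_of_mem_smul_top hs ((one_tmul_eq_zero_iff _ _).1 this)
    have h3 : LinearMap.ker f = ⊥ := by
      rw [← Submodule.subsingleton_iff_eq_bot]
      by_contra hn
      rw [not_subsingleton_iff_nontrivial] at hn
      have : FaithfulSMul R (LinearMap.ker f) := inferInstance
      exact hs0 (eq_of_smul_eq_smul fun z : LinearMap.ker f => by rw [h2, zero_smul])
    exact Module.Free.of_equiv (LinearEquiv.ofBijective f ⟨LinearMap.ker_eq_bot.1 h3, hf⟩)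

theorem maximalIdeal_eq_bot_of_free {R : Type u} [CommRing R] [IsLocalRing R]
    (h : Module.Free R (R ⧸ maximalIdeal R)) : maximalIdeal R = ⊥ := by
  have : FaithfulSMul R (R ⧸ maximalIdeal R) := inferInstance
  rw [eq_bot_iff]
  intro x hx
  refine eq_of_smul_eq_smul fun z : R ⧸ maximalIdeal R => ?_
  obtain ⟨z, rfl⟩ := Ideal.Quotient.mk_surjective z
  rw [zero_smul, Algebra.smul_def, Ideal.Quotient.algebraMap_eq, ← map_mul]
  exact Ideal.Quotient.eq_zero_iff_mem.2 (Ideal.mul_mem_right _ _ hx)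

theorem isRegularLocalRing_of_maximalIdeal_eq_bot {R : Type u} [CommRing R] [IsLocalRing R]
    [IsNoetherianRing R] (h : maximalIdeal R = ⊥) : IsRegularLocalRing R := by
  refine isRegularLocalRing_of_span ∅ (by simp [h]) ?_
  rw [ringKrullDim_eq_zero_of_isField (IsLocalRing.isField_iff_maximalIdeal_eq.2 h)]; simp

theorem PDLE.residue_of_notMem {R : Type u} [CommRing R] [IsLocalRing R] {N : Type u}
    [AddCommGroup N] [Module R N] {e : N} (he : e ∉ maximalIdeal R • (⊤ : Submodule R N))
    (hann : ∀ r ∈ maximalIdeal R, r • e = 0) {n : ℕ} (h : PDLE R n N) :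
    PDLE R n (R ⧸ maximalIdeal R) := by
  let _ : Field (R ⧸ maximalIdeal R) := Ideal.Quotient.field _
  have he' : (1 : R ⧸ maximalIdeal R) ⊗ₜ[R] e ≠ 0 := fun h0 => he ((one_tmul_eq_zero_iff _ _).1 h0)
  obtain ⟨ψ, hψ⟩ := (LinearMap.toSpanSingleton (R ⧸ maximalIdeal R) ((R ⧸ maximalIdeal R) ⊗[R] N)
    (1 ⊗ₜ e)).exists_leftInverse_of_injective
      (LinearMap.ker_eq_bot.2 fun a b hab => smul_left_injective _ he' hab)
  have hψ1 : ψ ((1 : R ⧸ maximalIdeal R) ⊗ₜ[R] e) = 1 := by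
    have := LinearMap.congr_fun hψ 1
    simpa using this
  refine h.retract (Submodule.liftQ (maximalIdeal R) (LinearMap.toSpanSingleton R N e)
    fun r hr => hann r hr) (ψ.restrictScalars R ∘ₗ TensorProduct.mk R (R ⧸ maximalIdeal R) N 1) ?_
  ext
  change ψ (1 ⊗ₜ[R] ((1 : R) • e)) = 1
  rw [one_smul, hψ1]

theorem one_tmul_notMem {R : Type u} [CommRing R] [IsLocalRing R]
    {x : R} (hx : x ∈ maximalIdeal R) (hx2 : x ∉ maximalIdeal R ^ 2)
    [IsLocalRing (R ⧸ Ideal.span {x})] :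
    (1 : R ⧸ Ideal.span {x}) ⊗ₜ[R] (⟨x, hx⟩ : maximalIdeal R) ∉
      maximalIdeal (R ⧸ Ideal.span {x}) •
        (⊤ : Submodule (R ⧸ Ideal.span {x}) ((R ⧸ Ideal.span {x}) ⊗[R] maximalIdeal R)) := by
  intro he
  apply hx2
  let J : Submodule R (maximalIdeal R) := maximalIdeal R • ⊤
  have key : ∃ y : maximalIdeal R, (1 : R ⧸ Ideal.span {x}) ⊗ₜ[R] (⟨x, hx⟩ : maximalIdeal R)
      = (1 : R ⧸ Ideal.span {x}) ⊗ₜ[R] y ∧ y ∈ J := by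
    generalize (1 : R ⧸ Ideal.span {x}) ⊗ₜ[R] (⟨x, hx⟩ : maximalIdeal R) = z at he
    induction he using Submodule.smul_induction_on' with
    | smul r hr n _ =>
      obtain ⟨r, rfl⟩ := Ideal.Quotient.mk_surjective r
      obtain ⟨w, rfl⟩ := exists_eq_one_tmul _ n
      refine ⟨r • w, ?_, Submodule.smul_mem_smul ?_ trivial⟩
      · rw [tmul_smul, ← algebraMap_smul (R ⧸ Ideal.span {x}) r]; rfl
      · rw [← map_maximalIdeal_quotient] at hr
        have h1 := Ideal.mem_quotient_iff_mem_sup.1 hr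
        rwa [sup_eq_left.2 (by simpa [Ideal.span_le])] at h1
    | add a _ b _ ha hb =>
      obtain ⟨a', rfl, ha⟩ := ha
      obtain ⟨b', rfl, hb⟩ := hb
      exact ⟨a' + b', (tmul_add _ _ _).symm, J.add_mem ha hb⟩
  obtain ⟨y, hw, hy⟩ := key
  have h0 : (1 : R ⧸ Ideal.span {x}) ⊗ₜ[R] ((⟨x, hx⟩ : maximalIdeal R) - y) = 0 := by
    rw [tmul_sub, hw, sub_self]
  rw [one_tmul_eq_zero_iff] at h0
  have h2 : (⟨x, hx⟩ : maximalIdeal R) - y ∈ J :=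
    Submodule.smul_mono_left (by simpa [Ideal.span_le]) h0
  have h3 : (⟨x, hx⟩ : maximalIdeal R) ∈ J := by simpa using J.add_mem h2 hy
  have h4 := Submodule.mem_map_of_mem (f := (maximalIdeal R).subtype) h3
  rw [Submodule.map_smul'', Submodule.map_top, Submodule.range_subtype] at h4
  rw [pow_two]; exact h4

/-- If `x` lies in the maximal ideal but not in its square, the residue field of `R ⧸ x` is
a direct summand of `𝔪 / x𝔪`. -/
theorem PDLE.residue_of_maximalIdeal {R : Type u} [CommRing R] [IsLocalRing R]
    {x : R} (hx : x ∈ maximalIdeal R) (hx2 : x ∉ maximalIdeal R ^ 2)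
    [IsLocalRing (R ⧸ Ideal.span {x})] {n : ℕ}
    (h : PDLE (R ⧸ Ideal.span {x}) n ((R ⧸ Ideal.span {x}) ⊗[R] maximalIdeal R)) :
    PDLE (R ⧸ Ideal.span {x}) n
      ((R ⧸ Ideal.span {x}) ⧸ maximalIdeal (R ⧸ Ideal.span {x})) := by
  refine PDLE.residue_of_notMem (one_tmul_notMem hx hx2) (fun r hr => ?_) h
  obtain ⟨r, rfl⟩ := Ideal.Quotient.mk_surjective r
  rw [← map_maximalIdeal_quotient] at hr
  have h1 := Ideal.mem_quotient_iff_mem_sup.1 hr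
  rw [sup_eq_left.2 (by simpa [Ideal.span_le])] at h1
  rw [← Ideal.Quotient.algebraMap_eq, algebraMap_smul, ← tmul_smul,
    show r • (⟨x, hx⟩ : maximalIdeal R) = x • ⟨r, h1⟩ from Subtype.ext (mul_comm r x),
    one_tmul_eq_zero_iff]
  exact Submodule.smul_mem_smul (Ideal.mem_span_singleton_self x) trivial

theorem isRegularLocalRing_of_quotient {R : Type u} [CommRing R] [IsLocalRing R]
    [IsNoetherianRing R] {x : R} (hx : x ∈ maximalIdeal R)
    (h : IsRegularLocalRing (R ⧸ Ideal.span {x}))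
    (hd : ringKrullDim (R ⧸ Ideal.span {x}) + 1 ≤ ringKrullDim R) : IsRegularLocalRing R := by
  classical
  obtain ⟨t, ht, htc⟩ := IsRegularLocalRing.exists_span_card_eq_dim (R := R ⧸ Ideal.span {x})
  obtain ⟨t', ht', rfl⟩ : ∃ t' : Finset R, t'.card = t.card ∧
      t'.image (Ideal.Quotient.mk (Ideal.span {x})) = t :=
    ⟨t.image (Function.surjInv Ideal.Quotient.mk_surjective),
      Finset.card_image_of_injective _ (Function.injective_surjInv _), by
        rw [Finset.image_image]
        rw [show (Ideal.Quotient.mk (Ideal.span {x})) ∘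
          (Function.surjInv Ideal.Quotient.mk_surjective) = id from
            funext fun y => Function.surjInv_eq _ y, Finset.image_id]⟩
  refine isRegularLocalRing_of_span (insert x t') ?_ ?_
  · have h1 : (Ideal.span (t' : Set R)).map (Ideal.Quotient.mk (Ideal.span {x})) =
        (maximalIdeal R).map (Ideal.Quotient.mk (Ideal.span {x})) := by
      rw [map_maximalIdeal_quotient, ← ht, Ideal.map_span, Finset.coe_image]
    have h2 := congrArg (Ideal.comap (Ideal.Quotient.mk (Ideal.span {x}))) h1
    rw [Ideal.comap_map_of_surjective' _ Ideal.Quotient.mk_surjective,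
      Ideal.comap_map_of_surjective' _ Ideal.Quotient.mk_surjective, Ideal.mk_ker,
      sup_eq_left.2 (by simpa [Ideal.span_le] : Ideal.span {x} ≤ maximalIdeal R)] at h2
    rw [← h2, Finset.coe_insert, Ideal.span_insert, sup_comm]
  · refine le_trans ?_ hd
    rw [← htc, ← ht']
    exact_mod_cast Finset.card_insert_le x t'

theorem isRegularLocalRing_of_pdle_aux (N : ℕ) : ∀ (R : Type u) [CommRing R] [IsLocalRing R]
    [IsNoetherianRing R] (n : ℕ) (s : Finset R), s.card ≤ N →
    Ideal.span (s : Set R) = maximalIdeal R → PDLE R n (R ⧸ maximalIdeal R) →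
    IsRegularLocalRing R := by
  induction N with
  | zero =>
    intro R _ _ _ n s hs hsm _
    obtain rfl : s = ∅ := Finset.card_eq_zero.1 (by omega)
    exact isRegularLocalRing_of_maximalIdeal_eq_bot (by simpa using hsm.symm)
  | succ N ih =>
    intro R _ _ _ n s hs hsm h
    by_cases hbot : maximalIdeal R = ⊥
    · exact isRegularLocalRing_of_maximalIdeal_eq_bot hbot
    by_cases hass : maximalIdeal R ∈ associatedPrimes R R
    · obtain ⟨z, hz⟩ := ((isAssociatedPrime_iff_exists_injective_linearMap _ _).1 hass).2
      exfalso
      refine hbot (maximalIdeal_eq_bot_of_free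
        (free_of_pdle_of_mul_eq_zero (s := z 1) ?_ ?_ n _ h))
      · intro h0
        have : (1 : R ⧸ maximalIdeal R) = 0 := hz (by rw [h0, map_zero])
        exact one_ne_zero this
      · intro x hx
        rw [← smul_eq_mul, ← map_smul, Algebra.smul_def, mul_one, Ideal.Quotient.algebraMap_eq,
          Ideal.Quotient.eq_zero_iff_mem.2 hx, map_zero]
    obtain ⟨x, hx, hx2, hxp⟩ := exists_mem_avoid (associatedPrimes.finite R R)
      (fun p hp => hp.1) (fun p hp hpm => hass (hpm ▸ hp)) hbot
    have hxreg : IsSMulRegular R x := by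
      have : x ∉ ⋃ p ∈ associatedPrimes R R, (p : Set R) := by simpa using hxp
      rw [biUnion_associatedPrimes_eq_compl_regular] at this
      simpa using this
    have : IsLocalRing (R ⧸ Ideal.span {x}) := isLocalRing_quotient (by simpa [Ideal.span_le])
    obtain ⟨t, ht, htc⟩ := exists_span_quotient hx hx2 s hsm
    have hm1 : PDLE R n (maximalIdeal R) := by
      have h1 := (PDLE.succ_iff (maximalIdeal R).mkQ (Submodule.mkQ_surjective _)).1
        (h.mono n.le_succ)
      rwa [Submodule.ker_mkQ] at h1
    have hm2 := hm1.quot hxreg n _ (isSMulRegular_submodule hxreg _)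
    have := ih _ n t (by omega) ht (PDLE.residue_of_maximalIdeal hx hx2 hm2)
    exact isRegularLocalRing_of_quotient hx this
      (ringKrullDim_quotient_span_singleton_succ_eq_ringKrullDim hxreg hx).le

/-- **Auslander–Buchsbaum–Serre**, homological criterion for regularity. -/
theorem isRegularLocalRing_of_pdle {R : Type u} [CommRing R] [IsLocalRing R]
    [IsNoetherianRing R] {n : ℕ} (h : PDLE R n (R ⧸ maximalIdeal R)) : IsRegularLocalRing R :=
  let ⟨s, hs, _⟩ := exists_span_card_eq R
  isRegularLocalRing_of_pdle_aux _ R n s le_rfl hs h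

theorem isSMulRegular_of_isDomain {R : Type*} [CommRing R] [IsDomain R] {x : R} (hx : x ≠ 0) :
    IsSMulRegular R x := fun _ _ h => mul_left_cancel₀ hx h

theorem pdle_of_isRegularLocalRing_aux (d : ℕ) : ∀ (R : Type u) [CommRing R]
    [IsRegularLocalRing R], ringKrullDim R = d → ∀ (M : Type u) [AddCommGroup M] [Module R M]
    [Module.Finite R M], PDLE R d M := by
  induction d with
  | zero =>
    intro R _ _ h M _ _ _
    obtain ⟨s, hs, hc⟩ := IsRegularLocalRing.exists_span_card_eq_dim (R := R)
    rw [h] at hc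
    have : s = ∅ := by rw [← Finset.card_eq_zero]; exact_mod_cast hc
    rw [this, Finset.coe_empty, Ideal.span_empty] at hs
    let _ : Field R := (IsLocalRing.isField_iff_maximalIdeal_eq.2 hs.symm).toField
    have : Module.Free R M := Module.Free.of_divisionRing R M
    exact PDLE.of_projective 0
  | succ d ih =>
    intro R _ _ h M _ _ _
    have hbot : maximalIdeal R ≠ ⊥ := by
      intro hb
      have hf := IsLocalRing.isField_iff_maximalIdeal_eq.2 hb
      rw [ringKrullDim_eq_zero_of_isField hf] at h
      exact absurd h (by exact_mod_cast (Nat.succ_ne_zero d).symm)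
    obtain ⟨x, hx, hx2, -⟩ := exists_mem_avoid (R := R) (S := ∅) Set.finite_empty (by simp)
      (by simp) hbot
    have := isDomain_of_isRegularLocalRing R
    have hx0 : IsSMulRegular R x := isSMulRegular_of_isDomain (by rintro rfl; simp at hx2)
    obtain ⟨h1, h2⟩ := isRegularLocalRing_quotient hx hx2
    have h3 : ringKrullDim (R ⧸ Ideal.span {x}) = d := by
      obtain ⟨k, hk⟩ := exists_ringKrullDim_eq_nat (R ⧸ Ideal.span {x})
      rw [hk, h] at h2
      rw [hk]
      have : k + 1 = d + 1 := by exact_mod_cast h2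
      exact_mod_cast (by omega : k = d)
    obtain ⟨k, f, hf⟩ := Module.Finite.exists_fin' R M
    rw [PDLE.succ_iff f hf]
    exact PDLE.of_quot hx0 hx d _ (isSMulRegular_submodule (isSMulRegular_fin hx0 k) _)
      (ih _ h3 _)

theorem exists_pdle_of_isRegularLocalRing (R : Type u) [CommRing R] [IsRegularLocalRing R] :
    ∃ d : ℕ, ∀ (M : Type u) [AddCommGroup M] [Module R M] [Module.Finite R M], PDLE R d M :=
  let ⟨d, hd⟩ := exists_ringKrullDim_eq_nat R
  ⟨d, pdle_of_isRegularLocalRing_aux d R hd⟩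

/-- Regularity descends along faithfully flat local homomorphisms. -/
theorem isRegularLocalRing_of_faithfullyFlat (A B : Type u) [CommRing A] [CommRing B]
    [Algebra A B] [IsLocalRing A] [IsNoetherianRing A] [IsRegularLocalRing B]
    [Module.FaithfullyFlat A B] : IsRegularLocalRing A :=
  let ⟨d, hd⟩ := exists_pdle_of_isRegularLocalRing B
  isRegularLocalRing_of_pdle (PDLE.of_baseChange B d (A ⧸ maximalIdeal A) (hd _))

theorem isRegularLocalRing_of_flat (A B : Type u) [CommRing A] [CommRing B]
    [Algebra A B] [IsLocalRing A] [IsNoetherianRing A] [IsRegularLocalRing B]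
    [Module.Flat A B] [IsLocalHom (algebraMap A B)] : IsRegularLocalRing A :=
  have := Module.FaithfullyFlat.of_flat_of_isLocalHom (A := A) (B := B)
  isRegularLocalRing_of_faithfullyFlat A B

/-- **Serre**: localizations of regular local rings are regular. -/
theorem isRegularLocalRing_isLocalizationAtPrime (R : Type u) [CommRing R]
    [IsRegularLocalRing R] (p : Ideal R) [p.IsPrime] (Rp : Type u) [CommRing Rp] [Algebra R Rp]
    [IsLocalization.AtPrime Rp p] : IsRegularLocalRing Rp := by
  have := IsLocalization.AtPrime.isLocalRing Rp p
  have := IsLocalization.isNoetherianRing p.primeCompl Rp inferInstance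
  have := IsLocalization.flat (R := R) Rp p.primeCompl
  obtain ⟨d, hd⟩ := exists_pdle_of_isRegularLocalRing R
  have h1 := PDLE.baseChange_of_flat Rp d (R ⧸ p) (hd _)
  refine isRegularLocalRing_of_pdle (n := d) (h1.equiv ?_)
  exact (Algebra.TensorProduct.quotIdealMapEquivTensorQuot Rp p).symm.toLinearEquiv ≪≫ₗ
    Submodule.quotEquivOfEq _ _ (IsLocalization.AtPrime.map_eq_maximalIdeal p Rp)

instance (R : Type u) [CommRing R] [IsRegularLocalRing R] : IsRegularRing R :=
  isRegularRing_iff.2 fun p _ => isRegularLocalRing_isLocalizationAtPrime R p _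

end Regular

section Regular
open TensorProduct IsLocalRing

theorem isRegularLocalRing_of_quotient_ideal {R : Type u} [CommRing R] [IsLocalRing R]
    [IsNoetherianRing R] {I : Ideal R} (hI : I ≤ maximalIdeal R)
    (h : IsRegularLocalRing (R ⧸ I)) (s : Finset R) (hs : Ideal.span (s : Set R) = I)
    (hd : s.card + ringKrullDim (R ⧸ I) ≤ ringKrullDim R) : IsRegularLocalRing R := by
  classical
  obtain ⟨t, ht, htc⟩ := IsRegularLocalRing.exists_span_card_eq_dim (R := R ⧸ I)
  obtain ⟨t', ht', rfl⟩ : ∃ t' : Finset R, t'.card = t.card ∧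
      t'.image (Ideal.Quotient.mk I) = t :=
    ⟨t.image (Function.surjInv Ideal.Quotient.mk_surjective),
      Finset.card_image_of_injective _ (Function.injective_surjInv _), by
        rw [Finset.image_image, show (Ideal.Quotient.mk I) ∘
          (Function.surjInv Ideal.Quotient.mk_surjective) = id from
            funext fun y => Function.surjInv_eq _ y, Finset.image_id]⟩
  refine isRegularLocalRing_of_span (s ∪ t') ?_ ?_
  · have h1 : (Ideal.span (t' : Set R)).map (Ideal.Quotient.mk I) =
        (maximalIdeal R).map (Ideal.Quotient.mk I) := by
      rw [map_maximalIdeal_quotient, ← ht, Ideal.map_span, Finset.coe_image]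
    have h2 := congrArg (Ideal.comap (Ideal.Quotient.mk I)) h1
    rw [Ideal.comap_map_of_surjective' _ Ideal.Quotient.mk_surjective,
      Ideal.comap_map_of_surjective' _ Ideal.Quotient.mk_surjective, Ideal.mk_ker,
      sup_eq_left.2 hI] at h2
    rw [← h2, Finset.coe_union, Ideal.span_union, sup_comm, hs]
  · refine le_trans ?_ hd
    rw [← htc, ← ht']
    exact_mod_cast Finset.card_union_le s t'

/-- Regularity ascends along flat local homomorphisms with regular closed fibre. -/
theorem isRegularLocalRing_of_flat_of_fibre (A B : Type u) [CommRing A] [CommRing B]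
    [Algebra A B] [IsRegularLocalRing A] [IsLocalRing B] [IsNoetherianRing B] [Module.Flat A B]
    [IsLocalHom (algebraMap A B)]
    (h : IsRegularLocalRing (B ⧸ (maximalIdeal A).map (algebraMap A B))) :
    IsRegularLocalRing B := by
  classical
  have hI : (maximalIdeal A).map (algebraMap A B) ≤ maximalIdeal B :=
    ((IsLocalRing.local_hom_TFAE (algebraMap A B)).out 0 2).1 ‹_›
  have hlo : (maximalIdeal B).LiesOver (maximalIdeal A) := by
    refine ⟨?_⟩
    have h0 : (maximalIdeal B).comap (algebraMap A B) = maximalIdeal A :=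
      ((IsLocalRing.local_hom_TFAE (algebraMap A B)).out 0 4).1 ‹_›
    exact h0.symm
  obtain ⟨s, hs, hsc⟩ := IsRegularLocalRing.exists_span_card_eq_dim (R := A)
  refine isRegularLocalRing_of_quotient_ideal hI h (s.image (algebraMap A B)) ?_ ?_
  · rw [Finset.coe_image, ← Ideal.map_span, hs]
  · have h1 := Ideal.height_eq_height_add_of_liesOver_of_hasGoingDown (maximalIdeal A)
      (maximalIdeal B)
    rw [map_maximalIdeal_quotient] at h1
    rw [← IsLocalRing.maximalIdeal_height_eq_ringKrullDim (R := B), h1, WithBot.coe_add,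
      IsLocalRing.maximalIdeal_height_eq_ringKrullDim,
      IsLocalRing.maximalIdeal_height_eq_ringKrullDim, ← hsc]
    gcongr
    exact Finset.card_image_le

theorem isRegularLocalRing_quotient_of_independent (h : ℕ) : ∀ (R : Type u) [CommRing R]
    [IsRegularLocalRing R] (f : Fin h → R), (∀ i, f i ∈ maximalIdeal R) →
    (∀ c : Fin h → R, ∑ i, c i * f i ∈ maximalIdeal R ^ 2 → ∀ i, c i ∈ maximalIdeal R) →
    IsRegularLocalRing (R ⧸ Ideal.span (Set.range f)) := by
  induction h with
  | zero =>
    intro R _ _ f _ _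
    exact .of_ringEquiv ((RingEquiv.quotientBot R).symm.trans
      (Ideal.quotEquivOfEq (by rw [Set.range_eq_empty, Ideal.span_empty])))
  | succ h ih =>
    intro R _ _ f hf hc
    have hx2 : f 0 ∉ maximalIdeal R ^ 2 := by
      intro h0
      have := hc (Pi.single 0 1) (by simpa [Pi.single_apply]) 0
      simp at this
    have := (isRegularLocalRing_quotient (hf 0) hx2).1
    have key := ih (R ⧸ Ideal.span {f 0}) (fun i => Ideal.Quotient.mk _ (f i.succ)) (fun i => by
      rw [← map_maximalIdeal_quotient]; exact Ideal.mem_map_of_mem _ (hf _)) (by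
      intro c hcm i
      choose c' hc' using fun i => Ideal.Quotient.mk_surjective (c i)
      obtain rfl : (fun i => Ideal.Quotient.mk _ (c' i)) = c := funext hc'
      rw [← map_maximalIdeal_quotient, ← Ideal.map_pow] at hcm
      simp only [← map_mul, ← map_sum] at hcm
      obtain ⟨y, hy, hyx⟩ := (Ideal.mem_map_iff_of_surjective _ Ideal.Quotient.mk_surjective).1 hcm
      obtain ⟨a, ha⟩ := Ideal.mem_span_singleton.1 (Ideal.Quotient.eq.1 hyx)
      have := hc (Fin.cons a c') (by
        rw [Fin.sum_univ_succ]
        simp only [Fin.cons_zero, Fin.cons_succ]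
        convert hy using 1
        linear_combination -ha) i.succ
      rw [← map_maximalIdeal_quotient]
      exact Ideal.mem_map_of_mem _ this)
    refine @IsRegularLocalRing.of_ringEquiv _ _ key _ _
      ((Ideal.quotEquivOfEq ?_).trans ((DoubleQuot.quotQuotEquivQuotSup (Ideal.span {f 0})
        (Ideal.span (Set.range fun i : Fin h => f i.succ))).trans (Ideal.quotEquivOfEq ?_)))
    · rw [Ideal.map_span, ← Set.range_comp]; rfl
    · rw [← Ideal.span_union, Set.singleton_union, ← Fin.range_cons (α := R) (f 0)]
      congr; exact Fin.cons_self_tail f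

theorem isRegularLocalRing_quotient_of_derivation {h : ℕ} {R : Type u} [CommRing R]
    [IsRegularLocalRing R] (f : Fin h → R) (hf : ∀ i, f i ∈ maximalIdeal R)
    (D : Fin h → Derivation ℤ R (ResidueField R))
    (hD : ∀ i j, D j (f i) = if i = j then 1 else 0) :
    IsRegularLocalRing (R ⧸ Ideal.span (Set.range f)) := by
  have hres : ∀ r ∈ maximalIdeal R, ∀ z : ResidueField R, r • z = 0 := by
    intro r hr z
    rw [Algebra.smul_def, ResidueField.algebraMap_eq, (residue_eq_zero_iff r).2 hr, zero_mul]
  have hsq : ∀ j, ∀ x ∈ maximalIdeal R ^ 2, D j x = 0 := by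
    intro j x hx
    rw [pow_two] at hx
    induction hx using Submodule.mul_induction_on' with
    | mem_mul_mem m hm n hn =>
      rw [Derivation.leibniz, hres m hm, hres n hn, add_zero]
    | add x _ y _ hx hy => rw [map_add, hx, hy, add_zero]
  refine isRegularLocalRing_quotient_of_independent h R f hf fun c hc i => ?_
  have h1 := hsq i _ hc
  simp only [map_sum, Derivation.leibniz, hres _ (hf _), add_zero, hD] at h1
  simp only [smul_ite, smul_zero, Finset.sum_ite_eq', Finset.mem_univ, if_true] at h1
  rwa [Algebra.smul_def, mul_one, ResidueField.algebraMap_eq, residue_eq_zero_iff] at h1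

end Regular

section Completion
open TensorProduct IsLocalRing

theorem exists_lift_of_dense {D E T : Type*} [CommRing D] [CommRing E] [CommRing T] [Algebra D E]
    (I : Ideal D) (hsurj : ∀ n (x : E), ∃ d : D, x - algebraMap D E d ∈ (I ^ n).map (algebraMap D E))
    (hinj : ∀ n, ((I ^ n).map (algebraMap D E)).comap (algebraMap D E) ≤ I ^ n)
    (J : Ideal T) [IsAdicComplete J T] (φ : D →+* T)
    (hφ : ∀ n, I ^ (n + 1) ≤ (J ^ n).comap φ) :
    ∃ Φ : E →+* T, Φ.comp (algebraMap D E) = φ := by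
  let e (n : ℕ) : D ⧸ I ^ (n + 1) →+* E ⧸ (I ^ (n + 1)).map (algebraMap D E) :=
    Ideal.quotientMap _ (algebraMap D E) Ideal.le_comap_map
  have he (n : ℕ) : Function.Bijective (e n) := by
    refine ⟨Ideal.quotientMap_injective' (hinj _), fun x => ?_⟩
    obtain ⟨x, rfl⟩ := Ideal.Quotient.mk_surjective x
    obtain ⟨d, hd⟩ := hsurj (n + 1) x
    exact ⟨Ideal.Quotient.mk _ d, by
      rw [Ideal.quotientMap_mk, Eq.comm, Ideal.Quotient.eq]; exact hd⟩
  let f (n : ℕ) : E →+* T ⧸ J ^ n :=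
    ((Ideal.quotientMap (J ^ n) φ (hφ n)).comp
      (RingEquiv.ofBijective (e n) (he n)).symm.toRingHom).comp (Ideal.Quotient.mk _)
  have hf (n : ℕ) (x : E) (d : D) (h : x - algebraMap D E d ∈ (I ^ (n + 1)).map (algebraMap D E)) :
      f n x = Ideal.Quotient.mk _ (φ d) := by
    have : (RingEquiv.ofBijective (e n) (he n)).symm (Ideal.Quotient.mk _ x) =
        Ideal.Quotient.mk _ d := by
      rw [RingEquiv.symm_apply_eq]
      change Ideal.Quotient.mk _ x = e n (Ideal.Quotient.mk _ d)
      rw [Ideal.quotientMap_mk, Ideal.Quotient.eq]; exact h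
    change Ideal.quotientMap (J ^ n) φ (hφ n)
      ((RingEquiv.ofBijective (e n) (he n)).symm (Ideal.Quotient.mk _ x)) = _
    rw [this, Ideal.quotientMap_mk]
  have hfc : ∀ {m n : ℕ} (hle : m ≤ n),
      (Ideal.Quotient.factorPow J hle).comp (f n) = f m := by
    intro m n hle
    ext x
    obtain ⟨d, hd⟩ := hsurj (n + 1) x
    rw [RingHom.comp_apply, hf n x d hd,
      hf m x d (Ideal.map_mono (Ideal.pow_le_pow_right (by omega)) hd)]
    rfl
  refine ⟨IsAdicComplete.liftRingHom J f hfc, ?_⟩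
  ext d
  refine (IsHausdorff.eq_iff_smodEq (I := J)).2 fun n => ?_
  rw [SModEq, RingHom.comp_apply]
  have := IsAdicComplete.mk_liftRingHom J f hfc n (algebraMap D E d)
  rw [hf n _ d (by simp)] at this
  rw [Submodule.Quotient.eq, smul_eq_mul, Ideal.mul_top]
  exact Ideal.Quotient.eq.1 this

theorem ringHom_eq_of_dense {D E T : Type*} [CommRing D] [CommRing E] [CommRing T] [Algebra D E]
    (I : Ideal D) (hsurj : ∀ n (x : E), ∃ d : D, x - algebraMap D E d ∈ (I ^ n).map (algebraMap D E))
    (J : Ideal T) [IsHausdorff J T] (Φ Ψ : E →+* T)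
    (h : Φ.comp (algebraMap D E) = Ψ.comp (algebraMap D E))
    (hφ : ∀ n, I ^ (n + 1) ≤ (J ^ n).comap (Φ.comp (algebraMap D E))) : Φ = Ψ := by
  ext x
  refine (IsHausdorff.eq_iff_smodEq (I := J)).2 fun n => ?_
  obtain ⟨d, hd⟩ := hsurj (n + 1) x
  have key (Θ : E →+* T) (hΘ : I ^ (n + 1) ≤ (J ^ n).comap (Θ.comp (algebraMap D E))) :
      Θ x - Θ (algebraMap D E d) ∈ J ^ n := by
    rw [← map_sub]
    have h2 : (I ^ (n + 1)).map (algebraMap D E) ≤ (J ^ n).comap Θ := Ideal.map_le_iff_le_comap.2 hΘ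
    exact h2 hd
  have h1 := key Φ (hφ n)
  have h2 := key Ψ (h ▸ hφ n)
  rw [SModEq, Submodule.Quotient.eq, smul_eq_mul, Ideal.mul_top]
  have h3 := (J ^ n).sub_mem h1 h2
  have h4 : Φ (algebraMap D E d) = Ψ (algebraMap D E d) := RingHom.congr_fun h d
  rw [h4] at h3
  simpa using h3

theorem isAdicComplete_of_finite {R M : Type u} [CommRing R] [IsNoetherianRing R] [AddCommGroup M]
    [Module R M] [Module.Finite R M] (I : Ideal R) [IsAdicComplete I R] : IsAdicComplete I M := by
  rw [← AdicCompletion.of_bijective_iff]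
  have h1 := AdicCompletion.ofTensorProduct_bijective_of_finite_of_isNoetherian I M
  let e : R ≃ₐ[R] AdicCompletion I R := AdicCompletion.ofAlgEquiv I
  let e1 : M ≃ₗ[R] R ⊗[R] M := (TensorProduct.lid R M).symm
  let e2 : R ⊗[R] M ≃ₗ[R] AdicCompletion I R ⊗[R] M :=
    TensorProduct.congr e.toLinearEquiv (LinearEquiv.refl R M)
  have : (AdicCompletion.of I M : M → _) =
      (AdicCompletion.ofTensorProduct I M) ∘ (e1.trans e2) := by
    ext1 m
    simp only [Function.comp, e1, e2, LinearEquiv.trans_apply, TensorProduct.lid_symm_apply,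
      TensorProduct.congr_tmul, AdicCompletion.ofTensorProduct_tmul]
    simp
  rw [this]
  exact h1.comp (e1.trans e2).bijective

end Completion

section Completion
open TensorProduct IsLocalRing

theorem adicCompletion_dense {D : Type*} [CommRing D] (I : Ideal D) (hI : I.FG) (n : ℕ)
    (x : AdicCompletion I D) :
    ∃ d : D, x - algebraMap D _ d ∈ (I ^ n).map (algebraMap D (AdicCompletion I D)) := by
  obtain ⟨d, hd⟩ := Ideal.Quotient.mk_surjective (AdicCompletion.evalₐ I n x)
  refine ⟨d, ?_⟩
  have h2 : x - algebraMap D _ d ∈ (AdicCompletion.eval I D n).ker := by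
    rw [LinearMap.mem_ker]
    refine (AdicCompletion.factor_evalₐ_eq_eval I (n := n) (x - algebraMap D _ d)
      (by rw [smul_eq_mul, Ideal.mul_top])).symm.trans ?_
    rw [map_sub, AlgHom.commutes, ← hd]
    exact (congrArg _ (sub_self _)).trans (map_zero _)
  rw [← AdicCompletion.pow_smul_top_eq_ker_eval hI] at h2
  rw [Ideal.map]
  refine Submodule.smul_induction_on (p := fun y => y ∈ Ideal.span _) h2 (fun r hr y _ => ?_)
    fun a b ha hb => add_mem ha hb
  rw [Algebra.smul_def]
  exact Ideal.mul_mem_right _ _ (Ideal.subset_span ⟨r, hr, rfl⟩)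

theorem adicCompletion_comap_map_le {D : Type*} [CommRing D] (I : Ideal D) (n : ℕ) :
    ((I ^ n).map (algebraMap D (AdicCompletion I D))).comap (algebraMap D (AdicCompletion I D))
      ≤ I ^ n := by
  have h : (I ^ n).map (algebraMap D (AdicCompletion I D)) ≤
      RingHom.ker (AdicCompletion.evalₐ I n) := by
    rw [Ideal.map_le_iff_le_comap]
    intro x hx
    rw [Ideal.mem_comap, RingHom.mem_ker, AlgHom.commutes]
    exact Ideal.Quotient.eq_zero_iff_mem.2 hx
  intro x hx
  have := h hx
  rw [RingHom.mem_ker, AlgHom.commutes] at this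
  exact Ideal.Quotient.eq_zero_iff_mem.1 this

theorem mvPowerSeries_dense {σ D : Type*} [Finite σ] [CommRing D] (n : ℕ)
    (x : MvPowerSeries σ D) :
    ∃ d : MvPolynomial σ D, x - algebraMap _ _ d ∈
      (MvPolynomial.idealOfVars σ D ^ n).map (algebraMap _ (MvPowerSeries σ D)) := by
  let e := MvPowerSeries.toAdicCompletionAlgEquiv σ D
  obtain ⟨d, hd⟩ := adicCompletion_dense _ (MvPolynomial.idealOfVars_fg σ D) n (e x)
  refine ⟨d, ?_⟩
  have := Ideal.mem_map_of_mem e.symm hd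
  rw [map_sub, AlgEquiv.symm_apply_apply, AlgEquiv.commutes, ← Ideal.map_coe e.symm,
    Ideal.map_map] at this
  have h3 : (e.symm : AdicCompletion (MvPolynomial.idealOfVars σ D) (MvPolynomial σ D) →+*
      MvPowerSeries σ D).comp (algebraMap (MvPolynomial σ D) _) =
    algebraMap _ _ := RingHom.ext fun y => e.symm.commutes y
  exact (congrArg (fun φ => _ ∈ Ideal.map φ (MvPolynomial.idealOfVars σ D ^ n)) h3).mp this

theorem mvPowerSeries_comap_map_le {σ D : Type*} [Finite σ] [CommRing D] (n : ℕ) :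
    ((MvPolynomial.idealOfVars σ D ^ n).map (algebraMap _ (MvPowerSeries σ D))).comap
      (algebraMap _ _) ≤ MvPolynomial.idealOfVars σ D ^ n := by
  let e := MvPowerSeries.toAdicCompletionAlgEquiv σ D
  intro x hx
  apply adicCompletion_comap_map_le _ n
  rw [Ideal.mem_comap] at hx ⊢
  have := Ideal.mem_map_of_mem e hx
  rw [AlgEquiv.commutes, ← Ideal.map_coe e, Ideal.map_map] at this
  have h3 : (e : MvPowerSeries σ D →+* AdicCompletion (MvPolynomial.idealOfVars σ D)
      (MvPolynomial σ D)).comp (algebraMap (MvPolynomial σ D) _) =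
    algebraMap _ _ := RingHom.ext fun y => e.commutes y
  exact (congrArg (fun φ => _ ∈ Ideal.map φ (MvPolynomial.idealOfVars σ D ^ n)) h3).mp this

theorem exists_mvPowerSeries_lift {σ D T : Type*} [Finite σ] [CommRing D] [CommRing T]
    (J : Ideal T) [IsAdicComplete J T] (φ : D →+* T) (y : σ → T) (hy : ∀ i, y i ∈ J) :
    ∃ Φ : MvPowerSeries σ D →+* T, (∀ a, Φ (MvPowerSeries.C a) = φ a) ∧
      ∀ i, Φ (MvPowerSeries.X i) = y i := by
  obtain ⟨Φ, hΦ⟩ := exists_lift_of_dense (MvPolynomial.idealOfVars σ D) mvPowerSeries_dense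
    mvPowerSeries_comap_map_le J (MvPolynomial.eval₂Hom φ y) (fun n => by
      refine (Ideal.pow_le_pow_right (Nat.le_succ n)).trans ?_
      rw [← Ideal.map_le_iff_le_comap, Ideal.map_pow]
      refine Ideal.pow_right_mono ?_ n
      rw [MvPolynomial.idealOfVars, Ideal.map_span, Ideal.span_le]
      rintro _ ⟨_, ⟨i, rfl⟩, rfl⟩
      simpa using hy i)
  refine ⟨Φ, fun a => ?_, fun i => ?_⟩
  · have := RingHom.congr_fun hΦ (MvPolynomial.C a)
    simpa [MvPowerSeries.algebraMap_apply'] using this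
  · have := RingHom.congr_fun hΦ (MvPolynomial.X i)
    simpa [MvPowerSeries.algebraMap_apply'] using this

theorem mvPowerSeries_lift_surjective {σ D T : Type*} [Finite σ] [CommRing D] [CommRing T]
    (J : Ideal T) [IsHausdorff J T] (Φ : MvPowerSeries σ D →+* T)
    (hJ : Ideal.span (Set.range fun i => Φ (MvPowerSeries.X i)) = J)
    (h : ∀ t : T, ∃ a : D, t - Φ (MvPowerSeries.C a) ∈ J) : Function.Surjective Φ := by
  have hm : (Ideal.span (Set.range MvPowerSeries.X)).map Φ = J := by
    rw [Ideal.map_span, ← hJ, ← Set.range_comp]; rfl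
  subst hm
  apply surjective_of_mk_map_comp_surjective Φ
    (I := Ideal.span (Set.range (MvPowerSeries.X : σ → MvPowerSeries σ D)))
  intro t
  obtain ⟨t, rfl⟩ := Ideal.Quotient.mk_surjective t
  obtain ⟨a, ha⟩ := h t
  exact ⟨MvPowerSeries.C a, (Ideal.Quotient.eq.2 ha).symm⟩

theorem isNoetherianRing_adicCompletion {D : Type*} [CommRing D] [IsNoetherianRing D]
    (I : Ideal D) : IsNoetherianRing (AdicCompletion I D) := by
  have hI : I.FG := (isNoetherianRing_iff_ideal_fg D).1 inferInstance I
  have : IsAdicComplete (I.map (algebraMap D (AdicCompletion I D))) (AdicCompletion I D) :=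
    AdicCompletion.isAdicComplete_self I hI
  obtain ⟨n, s, hs⟩ := Submodule.fg_iff_exists_fin_generating_family.1 hI
  have hsI (i) : s i ∈ I := hs ▸ Submodule.subset_span ⟨i, rfl⟩
  obtain ⟨Φ, h1, h2⟩ := exists_mvPowerSeries_lift (I.map (algebraMap D (AdicCompletion I D)))
    (algebraMap D (AdicCompletion I D)) (fun i => algebraMap _ _ (s i))
    (fun i => Ideal.mem_map_of_mem _ (hsI i))
  have : IsNoetherianRing (MvPowerSeries (Fin n) D) := inferInstance
  refine isNoetherianRing_of_surjective _ _ Φ (mvPowerSeries_lift_surjective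
    (I.map (algebraMap D (AdicCompletion I D))) Φ ?_ ?_)
  · simp_rw [h2]
    rw [← hs, Ideal.submodule_span_eq, Ideal.map_span, ← Set.range_comp]; rfl
  · intro t
    obtain ⟨a, ha⟩ := adicCompletion_dense I hI 1 t
    exact ⟨a, by rw [h1]; simpa using ha⟩

end Completion

section Completion
open TensorProduct IsLocalRing

/-- `E` is a completion of the local ring `D`. -/
structure IsCompl (D E : Type u) [CommRing D] [CommRing E] [Algebra D E] [IsLocalRing D]
    [IsLocalRing E] : Prop where
  flat : Module.Flat D E
  noeth : IsNoetherianRing E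
  map_max : (maximalIdeal D).map (algebraMap D E) = maximalIdeal E
  surj : ∀ x : E, ∃ d : D, x - algebraMap D E d ∈ maximalIdeal E
  complete : IsAdicComplete (maximalIdeal E) E

theorem IsCompl.adicCompletion (D : Type u) [CommRing D] [IsLocalRing D] [IsNoetherianRing D] :
    IsCompl D (AdicCompletion (maximalIdeal D) D) where
  flat := inferInstance
  noeth := isNoetherianRing_adicCompletion _
  map_max := AdicCompletion.maximalIdeal_eq_map.symm
  surj x := by
    obtain ⟨d, hd⟩ := adicCompletion_dense _
      ((isNoetherianRing_iff_ideal_fg D).1 inferInstance (maximalIdeal D)) 1 x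
    rw [pow_one, ← AdicCompletion.maximalIdeal_eq_map] at hd
    exact ⟨d, hd⟩
  complete := inferInstance

section
variable {D E : Type u} [CommRing D] [CommRing E] [Algebra D E] [IsLocalRing D] [IsLocalRing E]

theorem isLocalHom_of_map_max (h : (maximalIdeal D).map (algebraMap D E) = maximalIdeal E) :
    IsLocalHom (algebraMap D E) :=
  ((IsLocalRing.local_hom_TFAE (algebraMap D E)).out 0 2).2 h.le

theorem dense_of_map_max (hm : (maximalIdeal D).map (algebraMap D E) = maximalIdeal E)
    (hs : ∀ x : E, ∃ d : D, x - algebraMap D E d ∈ maximalIdeal E) (n : ℕ) (x : E) :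
    ∃ d : D, x - algebraMap D E d ∈ (maximalIdeal D ^ n).map (algebraMap D E) := by
  induction n with
  | zero => exact ⟨0, by simp [Ideal.map_top]⟩
  | succ n ih =>
    obtain ⟨d, hd⟩ := ih
    obtain ⟨d', hd'⟩ : ∃ d' : D, (x - algebraMap D E d) - algebraMap D E d' ∈
        (maximalIdeal D ^ (n + 1)).map (algebraMap D E) := by
      generalize x - algebraMap D E d = y at hd
      refine Submodule.span_induction (p := fun y _ => ∃ d' : D, y - algebraMap D E d' ∈
        (maximalIdeal D ^ (n + 1)).map (algebraMap D E)) ?_ ⟨0, by simp⟩ ?_ ?_ hd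
      · rintro _ ⟨a, _, rfl⟩
        exact ⟨a, by simp⟩
      · rintro a b _ _ ⟨a', ha⟩ ⟨b', hb⟩
        refine ⟨a' + b', ?_⟩
        have := add_mem ha hb
        rw [map_add]; convert this using 1; ring
      · rintro e a ha' ⟨a', ha⟩
        obtain ⟨d', hd'⟩ := hs e
        refine ⟨d' * a', ?_⟩
        have h1 : (e - algebraMap D E d') * a ∈ (maximalIdeal D ^ (n + 1)).map (algebraMap D E) := by
          rw [pow_succ', Ideal.map_mul, hm]
          exact Ideal.mul_mem_mul hd' ha'
        have h2 := add_mem h1 (Ideal.mul_mem_left _ (algebraMap D E d') ha)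
        rw [map_mul, smul_eq_mul]; convert h2 using 1; ring
    exact ⟨d + d', by rw [map_add, ← sub_sub]; exact hd'⟩

theorem comap_map_of_flat [Module.Flat D E] [IsLocalHom (algebraMap D E)] (I : Ideal D) :
    (I.map (algebraMap D E)).comap (algebraMap D E) ≤ I :=
  have := Module.FaithfullyFlat.of_flat_of_isLocalHom (A := D) (B := E)
  (Ideal.comap_map_eq_self_of_faithfullyFlat I).le

theorem IsCompl.of_comp {G : Type u} [CommRing G] [IsLocalRing G] [Algebra D G] [Algebra G E]
    [IsScalarTower D G E] [Module.Flat D G]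
    (hm : (maximalIdeal D).map (algebraMap D G) = maximalIdeal G)
    (hs : ∀ x : G, ∃ d : D, x - algebraMap D G d ∈ maximalIdeal G) (h : IsCompl G E) :
    IsCompl D E where
  flat := have := h.flat; Module.Flat.trans D G E
  noeth := h.noeth
  map_max := by
    rw [IsScalarTower.algebraMap_eq D G E, ← Ideal.map_map, hm, h.map_max]
  surj x := by
    obtain ⟨g, hg⟩ := h.surj x
    obtain ⟨d, hd⟩ := hs g
    refine ⟨d, ?_⟩
    have := Ideal.mem_map_of_mem (algebraMap G E) hd
    rw [h.map_max, map_sub, ← IsScalarTower.algebraMap_apply] at this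
    simpa using add_mem hg this
  complete := h.complete

theorem IsCompl.nonempty_equiv {E' : Type u} [CommRing E'] [Algebra D E'] [IsLocalRing E']
    (h : IsCompl D E) (h' : IsCompl D E') : Nonempty (E ≃ₐ[D] E') := by
  have := h.flat; have := h'.flat
  have := isLocalHom_of_map_max h.map_max; have := isLocalHom_of_map_max h'.map_max
  have := h.complete; have := h'.complete
  have hd := dense_of_map_max h.map_max h.surj
  have hd' := dense_of_map_max h'.map_max h'.surj
  have key {F F' : Type u} [CommRing F] [Algebra D F] [IsLocalRing F]
      (hm : (maximalIdeal D).map (algebraMap D F) = maximalIdeal F) (n : ℕ) :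
      maximalIdeal D ^ (n + 1) ≤ (maximalIdeal F ^ n).comap (algebraMap D F) := by
    rw [← Ideal.map_le_iff_le_comap, Ideal.map_pow, hm]
    exact Ideal.pow_le_pow_right (Nat.le_succ n)
  obtain ⟨Φ, hΦ⟩ := exists_lift_of_dense (maximalIdeal D) hd (fun n => comap_map_of_flat _)
    (maximalIdeal E') (algebraMap D E') (key (F' := E) h'.map_max)
  obtain ⟨Ψ, hΨ⟩ := exists_lift_of_dense (maximalIdeal D) hd' (fun n => comap_map_of_flat _)
    (maximalIdeal E) (algebraMap D E) (key (F' := E) h.map_max)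
  have h1 : Ψ.comp Φ = RingHom.id E := by
    refine ringHom_eq_of_dense (maximalIdeal D) hd (maximalIdeal E) _ _ ?_ ?_
    · rw [RingHom.comp_assoc, hΦ, hΨ]; rfl
    · rw [RingHom.comp_assoc, hΦ, hΨ]; exact key (F' := E) h.map_max
  have h2 : Φ.comp Ψ = RingHom.id E' := by
    refine ringHom_eq_of_dense (maximalIdeal D) hd' (maximalIdeal E') _ _ ?_ ?_
    · rw [RingHom.comp_assoc, hΨ, hΦ]; rfl
    · rw [RingHom.comp_assoc, hΨ, hΦ]; exact key (F' := E) h'.map_max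
  exact ⟨AlgEquiv.ofRingEquiv (f := RingEquiv.ofRingHom Φ Ψ h2 h1) fun x => RingHom.congr_fun hΦ x⟩

theorem IsCompl.quotient (h : IsCompl D E) (I : Ideal D) [IsLocalRing (D ⧸ I)]
    [IsLocalRing (E ⧸ I.map (algebraMap D E))] :
    IsCompl (D ⧸ I) (E ⧸ I.map (algebraMap D E)) := by
  have := h.flat; have := h.noeth; have := h.complete
  exact
  { flat := by
      exact Module.Flat.of_linearEquiv
        (Algebra.TensorProduct.quotIdealMapEquivQuotTensor E I).toLinearEquiv
    noeth := inferInstance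
    map_max := by
      rw [← map_maximalIdeal_quotient, ← map_maximalIdeal_quotient, ← h.map_max, Ideal.map_map,
        Ideal.map_map]
      rfl
    surj := fun x => by
      obtain ⟨x, rfl⟩ := Ideal.Quotient.mk_surjective x
      obtain ⟨d, hd⟩ := h.surj x
      refine ⟨Ideal.Quotient.mk _ d, ?_⟩
      rw [← map_maximalIdeal_quotient]
      exact Ideal.mem_map_of_mem (Ideal.Quotient.mk _) hd
    complete := by
      have h1 : IsAdicComplete (maximalIdeal E) (E ⧸ I.map (algebraMap D E)) :=
        isAdicComplete_of_finite _
      rw [← map_maximalIdeal_quotient]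
      exact (IsAdicComplete.map_algebraMap_iff (maximalIdeal E) _).2 h1 }

theorem IsCompl.isRegularLocalRing [IsNoetherianRing D] (h : IsCompl D E) (hD : IsRegularLocalRing D) :
    IsRegularLocalRing E := by
  have := h.flat; have := h.noeth
  have := isLocalHom_of_map_max h.map_max
  have := isLocalRing_quotient h.map_max.le
  refine isRegularLocalRing_of_flat_of_fibre D E (isRegularLocalRing_of_maximalIdeal_eq_bot ?_)
  rw [← map_maximalIdeal_quotient, h.map_max, Ideal.map_quotient_self]

end

end Completion

section Completion
open TensorProduct IsLocalRing

/-- The ring homomorphism `x ↦ φ x + d x ε` given by a derivation along `φ`. -/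
def dualHom {A B : Type*} [CommRing A] [CommRing B] (φ : A →+* B) (d : A →+ B)
    (h : ∀ x y, d (x * y) = φ x * d y + φ y * d x) : A →+* DualNumber B where
  toFun x := TrivSqZeroExt.inl (φ x) + TrivSqZeroExt.inr (d x)
  map_one' := by
    have h1 : d 1 = 0 := by simpa using h 1 1
    ext <;> simp [h1]
  map_mul' x y := by
    ext
    · simp
    · simp [h, mul_comm]
  map_zero' := by ext <;> simp
  map_add' x y := by ext <;> simp

theorem isUnit_dual {A B : Type*} [CommRing A] [CommRing B] {Φ : A →+* DualNumber B}
    {x : A} (h : IsUnit (Φ x).fst) : IsUnit (Φ x) :=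
  TrivSqZeroExt.isUnit_iff_isUnit_fst.2 h

/-- The first projection of the dual numbers, as a ring homomorphism. -/
abbrev dualFst (B : Type*) [CommRing B] : DualNumber B →+* B := (TrivSqZeroExt.fstHom ℤ B B).toRingHom

theorem exists_dual_localization {A A' B : Type*} [CommRing A] [CommRing A'] [CommRing B]
    [Algebra A A'] (M : Submonoid A) [IsLocalization M A'] (φ : A' →+* B) (Φ : A →+* DualNumber B)
    (h : (dualFst B).comp Φ = φ.comp (algebraMap A A')) :
    ∃ Φ' : A' →+* DualNumber B, Φ'.comp (algebraMap A A') = Φ ∧ (dualFst B).comp Φ' = φ := by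
  have hu (y : M) : IsUnit (Φ y) := by
    apply isUnit_dual
    have := RingHom.congr_fun h y
    change (Φ y).fst = φ (algebraMap A A' y) at this
    rw [this]
    exact (IsLocalization.map_units A' y).map φ
  refine ⟨IsLocalization.lift hu, IsLocalization.lift_comp hu, IsLocalization.ringHom_ext M ?_⟩
  rw [RingHom.comp_assoc, IsLocalization.lift_comp, h]

theorem sup_pow_succ_le {T : Type*} [CommRing T] (J N : Ideal T) (h : N * N = ⊥) (n : ℕ) :
    (J ⊔ N) ^ (n + 1) ≤ J ^ (n + 1) ⊔ N * J ^ n := by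
  induction n with
  | zero => simp
  | succ n ih =>
    rw [pow_succ]
    refine (Ideal.mul_mono_left ih).trans ?_
    rw [Ideal.sup_mul, Ideal.mul_sup, Ideal.mul_sup, ← pow_succ, mul_assoc, ← pow_succ,
      mul_right_comm, h, Ideal.bot_mul, sup_bot_eq, mul_comm (J ^ (n + 1)) N]
    simp

theorem exists_dual_completion {D E : Type u} [CommRing D] [CommRing E] [Algebra D E]
    [IsLocalRing D] [IsLocalRing E] (h : IsCompl D E) (Φ : D →+* DualNumber E)
    (hΦ : (dualFst E).comp Φ = algebraMap D E) :
    ∃ Φ' : E →+* DualNumber E, Φ'.comp (algebraMap D E) = Φ ∧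
      (dualFst E).comp Φ' = RingHom.id E := by
  have := h.flat; have := h.noeth; have := h.complete
  have := isLocalHom_of_map_max h.map_max
  let J : Ideal (DualNumber E) := (maximalIdeal E).map (algebraMap E (DualNumber E))
  have : Module.Finite E (DualNumber E) := inferInstanceAs (Module.Finite E (E × E))
  have : IsAdicComplete J (DualNumber E) :=
    (IsAdicComplete.map_algebraMap_iff (maximalIdeal E) _).2 (isAdicComplete_of_finite _)
  let N : Ideal (DualNumber E) := RingHom.ker (dualFst E)
  have hN : N * N = ⊥ := by
    rw [eq_bot_iff, Ideal.mul_le]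
    intro x hx y hy
    have hx' : x.fst = 0 := hx
    have hy' : y.fst = 0 := hy
    rw [Ideal.mem_bot]
    ext
    · simp [hx']
    · simp [hx', hy']
  have hJ : maximalIdeal D ≤ (J ⊔ N).comap Φ := by
    intro x hx
    rw [Ideal.mem_comap]
    have h1 : Φ x = algebraMap E (DualNumber E) (algebraMap D E x) +
        (Φ x - algebraMap E (DualNumber E) (algebraMap D E x)) := by ring
    rw [h1]
    refine add_mem (Ideal.mem_sup_left (Ideal.mem_map_of_mem _ ?_)) (Ideal.mem_sup_right ?_)
    · rw [← h.map_max]; exact Ideal.mem_map_of_mem _ hx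
    · have := RingHom.congr_fun hΦ x
      change (Φ x).fst = _ at this
      change (Φ x - algebraMap E (DualNumber E) (algebraMap D E x)).fst = 0
      rw [TrivSqZeroExt.fst_sub, this]
      exact sub_self _
  obtain ⟨Φ', hΦ'⟩ := exists_lift_of_dense (maximalIdeal D) (dense_of_map_max h.map_max h.surj)
    (fun n => comap_map_of_flat _) J Φ (fun n => by
      rw [← Ideal.map_le_iff_le_comap, Ideal.map_pow]
      refine (Ideal.pow_right_mono (Ideal.map_le_iff_le_comap.2 hJ) _).trans
        ((sup_pow_succ_le J N hN n).trans (sup_le (Ideal.pow_le_pow_right (Nat.le_succ n))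
          Ideal.mul_le_right)))
  refine ⟨Φ', hΦ', ?_⟩
  have hc : ((dualFst E).comp Φ').comp (algebraMap D E) = algebraMap D E := by
    rw [RingHom.comp_assoc, hΦ', hΦ]
  refine ringHom_eq_of_dense (maximalIdeal D) (dense_of_map_max h.map_max h.surj)
    (maximalIdeal E) _ _ (by rw [hc]; rfl) fun n => ?_
  rw [hc, ← Ideal.map_le_iff_le_comap, Ideal.map_pow, h.map_max]
  exact Ideal.pow_le_pow_right (Nat.le_succ n)

/-- The derivation into the residue field defined by a homomorphism to dual numbers. -/
noncomputable def dualDerivation {R : Type*} [CommRing R] [IsLocalRing R]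
    (Φ : R →+* DualNumber (ResidueField R)) (h : (dualFst _).comp Φ = residue R) :
    Derivation ℤ R (ResidueField R) :=
  Derivation.mk' (AddMonoidHom.toIntLinearMap
    { toFun := fun x => (Φ x).snd, map_zero' := by simp, map_add' := by simp }) (fun x y => by
      have hx (x : R) : (Φ x).fst = residue R x := RingHom.congr_fun h x
      change (Φ (x * y)).snd = x • (Φ y).snd + y • (Φ x).snd
      rw [map_mul, TrivSqZeroExt.snd_mul, hx, hx, op_smul_eq_mul, smul_eq_mul,
        Algebra.smul_def, Algebra.smul_def, mul_comm (Φ x).snd]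
      rfl)

/-- All primes of `E` over the zero ideal of `D` have regular local rings. -/
def GenReg (D E : Type u) [CommRing D] [CommRing E] [Algebra D E] : Prop :=
  ∀ (r : Ideal E) [r.IsPrime], r.comap (algebraMap D E) = ⊥ →
    IsRegularLocalRing (Localization.AtPrime r)

theorem GenReg.of_ringEquiv {D E D' E' : Type u} [CommRing D] [CommRing E] [Algebra D E]
    [CommRing D'] [CommRing E'] [Algebra D' E'] (e : D ≃+* D') (e' : E ≃+* E')
    (he : ∀ x, e' (algebraMap D E x) = algebraMap D' E' (e x)) (h : GenReg D E) :
    GenReg D' E' := by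
  intro r hr h0
  have h1 : (r.comap e').comap (algebraMap D E) = ⊥ := by
    rw [eq_bot_iff]
    intro x hx
    have : e x ∈ r.comap (algebraMap D' E') := by
      rw [Ideal.mem_comap, ← he]; exact hx
    rw [h0, Ideal.mem_bot] at this
    simpa using this
  have := h (r.comap e') h1
  exact IsRegularLocalRing.of_ringEquiv <| IsLocalization.ringEquivOfRingEquiv
    (Localization.AtPrime (r.comap e')) (Localization.AtPrime r) e' (e'.map_primeCompl_comap_eq r)

/-- The generic formal fibre of the local ring `D` is regular. -/
def IsGenReg (D : Type u) [CommRing D] [IsLocalRing D] : Prop :=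
  GenReg D (AdicCompletion (maximalIdeal D) D)

theorem isGenReg_iff {D E : Type u} [CommRing D] [IsLocalRing D] [IsNoetherianRing D] [CommRing E]
    [IsLocalRing E] [Algebra D E] (h : IsCompl D E) : IsGenReg D ↔ GenReg D E := by
  obtain ⟨e⟩ := h.nonempty_equiv (IsCompl.adicCompletion D)
  exact ⟨fun h => h.of_ringEquiv (RingEquiv.refl D) e.symm.toRingEquiv fun x => e.symm.commutes x,
    fun h => h.of_ringEquiv (RingEquiv.refl D) e.toRingEquiv fun x => e.commutes x⟩

theorem IsGenReg.of_ringEquiv {D D' : Type u} [CommRing D] [IsLocalRing D] [IsNoetherianRing D]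
    [CommRing D'] [IsLocalRing D'] (e : D ≃+* D') (h : IsGenReg D) : IsGenReg D' := by
  have := isNoetherianRing_of_ringEquiv D e
  let := e.toRingHom.toAlgebra
  have : IsScalarTower D D' (AdicCompletion (maximalIdeal D') D') :=
    IsScalarTower.of_algebraMap_eq fun x => rfl
  have : Module.Flat D D' := Module.Flat.of_linearEquiv
    (LinearEquiv.ofBijective (Algebra.linearMap D D') e.bijective).symm
  have hc : IsCompl D (AdicCompletion (maximalIdeal D') D') :=
    IsCompl.of_comp (G := D') (map_ringEquiv_maximalIdeal e)
      (fun x => ⟨e.symm x, by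
        rw [show algebraMap D D' (e.symm x) = x from e.apply_symm_apply x, sub_self]
        exact zero_mem _⟩) (IsCompl.adicCompletion D')
  exact ((isGenReg_iff hc).1 h).of_ringEquiv e (RingEquiv.refl _) fun x => rfl

end Completion

section Completion
open TensorProduct IsLocalRing

theorem ker_localRingHom {R S : Type u} [CommRing R] [CommRing S] (f : R →+* S)
    (hf : Function.Surjective f) (P : Ideal S) [P.IsPrime] :
    RingHom.ker (Localization.localRingHom (P.comap f) P f rfl) =
      (RingHom.ker f).map (algebraMap R (Localization.AtPrime (P.comap f))) :=
  IsLocalization.ker_map (Localization.AtPrime P) f (P.map_primeCompl_comap_of_surjective f hf)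

/-- The second projection of the dual numbers, as an additive map. -/
def dualSnd (B : Type*) [CommRing B] : DualNumber B →+ B where
  toFun x := x.snd
  map_zero' := by simp
  map_add' := by simp

/-- The ring homomorphism of dual numbers induced by a ring homomorphism. -/
def dualMap {B C : Type*} [CommRing B] [CommRing C] (g : B →+* C) : DualNumber B →+* DualNumber C :=
  dualHom (g.comp (dualFst B)) (g.toAddMonoidHom.comp (dualSnd B)) (fun x y => by
    change g (x * y).snd = g x.fst * g y.snd + g y.fst * g x.snd
    rw [TrivSqZeroExt.snd_mul]
    simp [mul_comm])

theorem dualMap_fst {B C : Type*} [CommRing B] [CommRing C] (g : B →+* C) (x : DualNumber B) :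
    (dualMap g x).fst = g x.fst := by
  change g x.fst + 0 = _
  rw [add_zero]

theorem dualMap_snd {B C : Type*} [CommRing B] [CommRing C] (g : B →+* C) (x : DualNumber B) :
    (dualMap g x).snd = g x.snd := by
  change 0 + g x.snd = _
  rw [zero_add]

/-- A derivation of `R` extends to the localization of the completion of a localization of `R`,
with values in the residue field. -/
theorem exists_derivation_extension {R RQ E Er : Type u} [CommRing R] [CommRing RQ] [CommRing E]
    [Algebra R RQ] [IsLocalRing RQ] [IsLocalRing E] [Algebra RQ E] (Q : Ideal R) [Q.IsPrime]
    [IsLocalization.AtPrime RQ Q] (hE : IsCompl RQ E) (r : Ideal E) [r.IsPrime]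
    [CommRing Er] [IsLocalRing Er] [Algebra E Er] [IsLocalization.AtPrime Er r]
    (D : Derivation ℤ R R) :
    ∃ D' : Derivation ℤ Er (ResidueField Er),
      ∀ x : R, D' (algebraMap E Er (algebraMap RQ E (algebraMap R RQ x))) =
        residue Er (algebraMap E Er (algebraMap RQ E (algebraMap R RQ (D x)))) := by
  let ι : R →+* E := (algebraMap RQ E).comp (algebraMap R RQ)
  let Φ0 : R →+* DualNumber E := dualHom ι (ι.toAddMonoidHom.comp D.toLinearMap.toAddMonoidHom)
    fun x y => by simp
  obtain ⟨Φ1, h1, h1'⟩ := exists_dual_localization (A' := RQ) Q.primeCompl (algebraMap RQ E) Φ0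
    (by ext x; simp [Φ0, dualHom, ι])
  obtain ⟨Φ2, h2, h2'⟩ := exists_dual_completion hE Φ1 h1'
  let g : E →+* ResidueField Er := (residue Er).comp (algebraMap E Er)
  obtain ⟨Φ4, h4, h4'⟩ := exists_dual_localization (A' := Er) r.primeCompl (residue Er)
    ((dualMap g).comp Φ2) (by
      ext x
      have : (Φ2 x).fst = x := RingHom.congr_fun h2' x
      change (dualMap g (Φ2 x)).fst = _
      rw [dualMap_fst, this])
  refine ⟨dualDerivation Φ4 h4', fun x => ?_⟩
  change (Φ4 (algebraMap E _ (algebraMap RQ E (algebraMap R RQ x)))).snd = _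
  have e4 := RingHom.congr_fun h4 (algebraMap RQ E (algebraMap R RQ x))
  have e2 := RingHom.congr_fun h2 (algebraMap R RQ x)
  have e1 := RingHom.congr_fun h1 x
  simp only [RingHom.comp_apply] at e4 e2 e1
  rw [e4, e2, e1, dualMap_snd]
  change g (0 + ι (D x)) = _
  rw [zero_add]
  rfl

theorem isRegularLocalRing_quotient_of_lifted_derivations {R Er : Type u} [CommRing R]
    [CommRing Er] [IsRegularLocalRing Er] {B : Type u} [CommRing B] (π : R →+* B) (ι : R →+* Er)
    (hι : ∀ x, residue Er (ι x) = 0 ↔ π x = 0) {h : ℕ} (f : Fin h → R) (hf : ∀ i, π (f i) = 0)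
    (D : Fin h → R → R) (t : R) (ht : π t ≠ 0)
    (hD : ∀ i j, π (D j (f i)) = if i = j then π t else 0)
    (D' : Fin h → Derivation ℤ Er (ResidueField Er))
    (hD' : ∀ j x, D' j (ι x) = residue Er (ι (D j x))) :
    IsRegularLocalRing (Er ⧸ Ideal.span (Set.range fun i => ι (f i))) := by
  refine isRegularLocalRing_quotient_of_derivation (fun i => ι (f i))
    (fun i => (residue_eq_zero_iff _).1 ((hι _).2 (hf i)))
    (fun j => (residue Er (ι t))⁻¹ • D' j) fun i j => ?_
  have h1 : D' j (ι (f i)) = residue Er (ι (D j (f i))) := hD' j (f i)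
  rw [Derivation.smul_apply, h1, smul_eq_mul]
  split_ifs with hij
  · have : residue Er (ι (D j (f i))) = residue Er (ι t) := by
      rw [← sub_eq_zero, ← map_sub, ← map_sub, hι, map_sub, hD, if_pos hij, sub_self]
    rw [this, inv_mul_cancel₀ (fun h => ht ((hι t).1 h))]
  · rw [(hι (D j (f i))).2 (by rw [hD, if_neg hij]), mul_zero]

theorem span_eq_map_ker {R Er B : Type u} [CommRing R] [CommRing Er] [IsLocalRing Er] [CommRing B]
    (π : R →+* B) (ι : R →+* Er) (hι : ∀ x, residue Er (ι x) = 0 ↔ π x = 0) {h : ℕ}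
    (f : Fin h → R) (hf : ∀ i, π (f i) = 0)
    (hgen : ∃ s, π s ≠ 0 ∧ ∀ x, π x = 0 → s * x ∈ Ideal.span (Set.range f)) :
    Ideal.span (Set.range fun i => ι (f i)) = Ideal.map ι (RingHom.ker π) := by
  apply le_antisymm
  · rw [Ideal.span_le]
    rintro _ ⟨i, rfl⟩
    exact Ideal.mem_map_of_mem ι (hf i)
  · rw [Ideal.map_le_iff_le_comap]
    intro x hx
    obtain ⟨s, hs, hsx⟩ := hgen
    have h1 := Ideal.mem_map_of_mem ι (hsx x hx)
    rw [Ideal.map_span, ← Set.range_comp, map_mul] at h1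
    have hu : IsUnit (ι s) := by
      by_contra hu
      exact hs ((hι s).1 ((residue_eq_zero_iff _).2 hu))
    exact (Ideal.unit_mul_mem_iff_mem _ hu).1 h1

theorem isGenReg_of_derivations {R B : Type u} [CommRing R] [IsRegularRing R] [CommRing B]
    [IsDomain B] (π : R →+* B) (hπ : Function.Surjective π) {h : ℕ} (f : Fin h → R)
    (hf : ∀ i, π (f i) = 0)
    (hgen : ∃ s, π s ≠ 0 ∧ ∀ x, π x = 0 → s * x ∈ Ideal.span (Set.range f))
    (D : Fin h → Derivation ℤ R R) (t : R) (ht : π t ≠ 0)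
    (hD : ∀ i j, π (D j (f i)) = if i = j then π t else 0) (q : Ideal B) [q.IsPrime] :
    IsGenReg (Localization.AtPrime q) := by
  let Q := q.comap π
  let RQ := Localization.AtPrime Q
  have : IsRegularLocalRing RQ := isRegularRing_iff.1 ‹_› Q
  let E := AdicCompletion (maximalIdeal RQ) RQ
  have hc : IsCompl RQ E := IsCompl.adicCompletion RQ
  have : IsRegularLocalRing E := hc.isRegularLocalRing inferInstance
  let ρ : RQ →+* Localization.AtPrime q := Localization.localRingHom Q q π rfl
  have hρ : Function.Surjective ρ := RingHom.surjective_localRingHom_of_surjective π hπ q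
  let I := RingHom.ker ρ
  have hIeq : I = (RingHom.ker π).map (algebraMap R RQ) := ker_localRingHom π hπ q
  have hρx (x : R) : algebraMap R RQ x ∈ I ↔ π x = 0 := by
    rw [RingHom.mem_ker, Localization.localRingHom_to_map]
    exact map_eq_zero_iff _ (IsLocalization.injective _ q.primeCompl_le_nonZeroDivisors)
  let e : RQ ⧸ I ≃+* Localization.AtPrime q := RingHom.quotientKerEquivOfSurjective hρ
  have : IsLocalRing (RQ ⧸ I) := e.symm.isLocalRing
  have hIm : I ≤ maximalIdeal RQ := IsLocalRing.le_maximalIdeal (RingHom.ker_ne_top ρ)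
  have : IsLocalRing (E ⧸ I.map (algebraMap RQ E)) :=
    isLocalRing_quotient ((Ideal.map_mono hIm).trans hc.map_max.le)
  refine IsGenReg.of_ringEquiv e ((isGenReg_iff (hc.quotient I)).2 fun r hr h0 => ?_)
  let mk : E →+* E ⧸ I.map (algebraMap RQ E) := Ideal.Quotient.mk _
  have hmk : Function.Surjective mk := Ideal.Quotient.mk_surjective
  let r' := r.comap mk
  let Er := Localization.AtPrime r'
  have : IsRegularLocalRing Er := isRegularLocalRing_isLocalizationAtPrime E r' Er
  have hrI (x : RQ) : algebraMap RQ E x ∈ r' ↔ x ∈ I := by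
    have : algebraMap RQ E x ∈ r' ↔ Ideal.Quotient.mk I x ∈ r.comap (algebraMap (RQ ⧸ I) _) :=
      Iff.rfl
    rw [this, h0, Ideal.mem_bot, Ideal.Quotient.eq_zero_iff_mem]
  let ι : R →+* Er := (algebraMap E Er).comp ((algebraMap RQ E).comp (algebraMap R RQ))
  have hι (x : R) : residue Er (ι x) = 0 ↔ π x = 0 := by
    rw [residue_eq_zero_iff, ← hρx, ← hrI]
    exact IsLocalization.AtPrime.to_map_mem_maximal_iff Er r' _
  choose D' hD' using fun j => exists_derivation_extension (Er := Er) Q hc r' (D j)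
  have key := isRegularLocalRing_quotient_of_lifted_derivations π ι hι f hf (fun j => D j) t ht hD
    D' hD'
  rw [span_eq_map_ker π ι hι f hf hgen] at key
  let τ : Er →+* Localization.AtPrime r := Localization.localRingHom r' r mk rfl
  have hτ : Function.Surjective τ := RingHom.surjective_localRingHom_of_surjective mk hmk r
  have hk : RingHom.ker τ = (RingHom.ker mk).map (algebraMap E Er) := ker_localRingHom mk hmk r
  have hk2 : RingHom.ker mk = (RingHom.ker π).map ((algebraMap RQ E).comp (algebraMap R RQ)) := by
    rw [← Ideal.map_map, ← hIeq]
    exact Ideal.mk_ker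
  have hker : Ideal.map ι (RingHom.ker π) = RingHom.ker τ := by
    rw [hk, hk2, Ideal.map_map]
  rw [hker] at key
  exact IsRegularLocalRing.of_ringEquiv (RingHom.quotientKerEquivOfSurjective hτ)

end Completion

section Sections
open TensorProduct IsLocalRing

/-- A ring section of `T → κ(T)` modulo the square of the maximal ideal gives a derivation with
values in the cotangent space. -/
theorem exists_cotangent_derivation {T : Type u} [CommRing T] (I : Ideal T)
    (G : Subring (T ⧸ I ^ 2)) (hG : ∀ g ∈ G, g ∈ I.cotangentIdeal → g = 0)
    (hG' : ∀ x, ∃ g ∈ G, x - g ∈ I.cotangentIdeal) :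
    ∃ d : Derivation ℤ T I.Cotangent, (∀ x : I, d x = I.toCotangent x) ∧
      ∀ x, Ideal.Quotient.mk (I ^ 2) x ∈ G → d x = 0 := by
  let ν := I.cotangentToQuotientSquare
  have hν : Function.Injective ν := I.cotangentToQuotientSquare_injective
  have hr : ∀ c, ν c ∈ I.cotangentIdeal := fun c => by
    have : ν c ∈ LinearMap.range ν := ⟨c, rfl⟩
    rw [show LinearMap.range ν = _ from I.range_cotangentToQuotientSquare] at this
    exact this
  have hr' : ∀ x ∈ I.cotangentIdeal, ∃ c, ν c = x := fun x hx => by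
    have : x ∈ LinearMap.range ν := by
      rw [show LinearMap.range ν = _ from I.range_cotangentToQuotientSquare]
      exact hx
    exact this
  have hmul (a b) : ν a * ν b = 0 := by
    have := Ideal.mul_mem_mul (hr a) (hr b)
    rwa [← pow_two, I.cotangentIdeal_square] at this
  have hex (x : T) : ∃ c, Ideal.Quotient.mk (I ^ 2) x - ν c ∈ G := by
    obtain ⟨g, hg, h⟩ := hG' (Ideal.Quotient.mk (I ^ 2) x)
    obtain ⟨c, hc⟩ := hr' _ h
    exact ⟨c, by rw [hc]; simpa using hg⟩
  choose d hd using hex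
  have huniq (x : T) (c) (hc : Ideal.Quotient.mk (I ^ 2) x - ν c ∈ G) : d x = c := by
    apply hν
    have h1 := G.sub_mem hc (hd x)
    have h2 : Ideal.Quotient.mk (I ^ 2) x - ν c - (Ideal.Quotient.mk (I ^ 2) x - ν (d x)) =
      ν (d x) - ν c := by ring
    rw [h2] at h1
    exact sub_eq_zero.1 (hG _ h1 (sub_mem (hr _) (hr _)))
  refine ⟨Derivation.mk' (AddMonoidHom.toIntLinearMap
    { toFun := d, map_zero' := huniq 0 0 (by simp), map_add' := fun x y => huniq _ _ ?_ })
    (fun x y => huniq _ _ ?_), fun x => huniq _ _ ?_, fun x hx => huniq _ _ (by simpa using hx)⟩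
  · have := G.add_mem (hd x) (hd y)
    rw [map_add, map_add]
    convert this using 1
    ring
  · have := G.mul_mem (hd x) (hd y)
    rw [map_add, map_mul, map_smul, map_smul]
    convert this using 1
    change _ - (x • ν (d y) + y • ν (d x)) = _
    rw [Algebra.smul_def, Algebra.smul_def, Ideal.Quotient.algebraMap_eq]
    linear_combination -hmul (d x) (d y)
  · change _ - I.cotangentToQuotientSquare (I.toCotangent x) ∈ G
    rw [Ideal.toCotangent_to_quotient_square]
    simp

/-- Derivations into the residue field dual to a basis of the cotangent space. -/
theorem exists_residue_derivations {T : Type u} [CommRing T] [IsLocalRing T] [IsNoetherianRing T]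
    (G : Subring (T ⧸ maximalIdeal T ^ 2)) (hG : ∀ g ∈ G, g ∈ (maximalIdeal T).cotangentIdeal → g = 0)
    (hG' : ∀ x, ∃ g ∈ G, x - g ∈ (maximalIdeal T).cotangentIdeal) :
    ∃ (h : ℕ) (f : Fin h → T) (δ : Fin h → Derivation ℤ T (ResidueField T)),
      Ideal.span (Set.range f) = maximalIdeal T ∧ (∀ i j, δ j (f i) = if i = j then 1 else 0) ∧
      ∀ j x, Ideal.Quotient.mk (maximalIdeal T ^ 2) x ∈ G → δ j x = 0 := by
  obtain ⟨d, hd, hd'⟩ := exists_cotangent_derivation _ G hG hG'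
  let b := Module.finBasis (ResidueField T) (CotangentSpace T)
  choose f hf using fun i => (maximalIdeal T).toCotangent_surjective (b i)
  let L (j) : CotangentSpace T →ₗ[T] ResidueField T := (b.coord j).restrictScalars T
  let δ (j) : Derivation ℤ T (ResidueField T) := (L j).compDer d
  refine ⟨_, fun i => f i, δ, ?_, fun i j => ?_, fun j x hx => ?_⟩
  · have h1 : Submodule.span (ResidueField T)
        ((maximalIdeal T).toCotangent '' (Set.range f)) = ⊤ := by
      rw [← Set.range_comp, show (maximalIdeal T).toCotangent ∘ f = b from funext hf]
      exact b.span_eq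
    have h2 := CotangentSpace.span_image_eq_top_iff.1 h1
    have h3 := congrArg (Submodule.map (maximalIdeal T).subtype) h2
    rw [Submodule.map_span, ← Set.range_comp, Submodule.map_top, Submodule.range_subtype] at h3
    exact h3
  · change b.coord j (d (f i)) = _
    rw [hd, hf]
    simp [Finsupp.single_apply]
  · change b.coord j (d x) = _
    rw [hd' x hx, map_zero]

end Sections

section Sections
open TensorProduct IsLocalRing

theorem derivation_eq_sum {R V : Type u} [CommRing R] [CommRing V] (ρ : R →+* V) (δ : R →+ V)
    (hδ : ∀ x y, δ (x * y) = ρ x * δ y + ρ y * δ x) {m : ℕ} (D : Fin m → Derivation ℤ R R)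
    (A : Set R) (y : Fin m → R) (hgen : Subring.closure (A ∪ Set.range y) = ⊤)
    (hA : ∀ a ∈ A, δ a = 0) (hDA : ∀ i, ∀ a ∈ A, D i a = 0)
    (hDy : ∀ i j, D i (y j) = if i = j then 1 else 0) (x : R) :
    δ x = ∑ i, δ (y i) * ρ (D i x) := by
  have hx : x ∈ Subring.closure (A ∪ Set.range y) := hgen ▸ Subring.mem_top x
  have h1 : δ 1 = 0 := by simpa using hδ 1 1
  induction hx using Subring.closure_induction with
  | mem x hx =>
    rcases hx with hx | ⟨j, rfl⟩
    · simp [hA x hx, hDA _ x hx]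
    · simp [hDy]
  | zero => simp
  | one => simp [h1]
  | add a b _ _ ha hb => simp only [map_add, ha, hb, mul_add, Finset.sum_add_distrib]
  | neg a _ ha => simp only [map_neg, ha, mul_neg, Finset.sum_neg_distrib]
  | mul a b _ _ ha hb =>
    rw [hδ, ha, hb, Finset.mul_sum, Finset.mul_sum, ← Finset.sum_add_distrib]
    refine Finset.sum_congr rfl fun i _ => ?_
    rw [Derivation.leibniz, smul_eq_mul, smul_eq_mul, map_add, map_mul, map_mul]
    ring

theorem isGenReg_of_section {R B RP : Type u} [CommRing R] [IsRegularRing R] [CommRing B]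
    [IsDomain B] (π : R →+* B) (hπ : Function.Surjective π) (P : Ideal R) [P.IsPrime]
    (hP : RingHom.ker π = P) [CommRing RP] [IsLocalRing RP] [Algebra R RP]
    [IsLocalization.AtPrime RP P]
    (G : Subring (RP ⧸ maximalIdeal RP ^ 2))
    (hG : ∀ g ∈ G, g ∈ (maximalIdeal RP).cotangentIdeal → g = 0)
    (hG' : ∀ x, ∃ g ∈ G, x - g ∈ (maximalIdeal RP).cotangentIdeal)
    (A : Set R) (hAG : ∀ a ∈ A, Ideal.Quotient.mk (maximalIdeal RP ^ 2) (algebraMap R RP a) ∈ G)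
    {m : ℕ} (D : Fin m → Derivation ℤ R R) (y : Fin m → R)
    (hgen : Subring.closure (A ∪ Set.range y) = ⊤) (hDA : ∀ i, ∀ a ∈ A, D i a = 0)
    (hDy : ∀ i j, D i (y j) = if i = j then 1 else 0) (q : Ideal B) [q.IsPrime] :
    IsGenReg (Localization.AtPrime q) := by
  have : IsNoetherianRing R := inferInstance
  have : IsNoetherianRing RP := IsLocalization.isNoetherianRing P.primeCompl RP inferInstance
  obtain ⟨h, f', δ, hf', hδf, hδG⟩ := exists_residue_derivations G hG hG'
  let ρ : R →+* ResidueField RP := (residue RP).comp (algebraMap R RP)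
  have hρ (x : R) : ρ x = 0 ↔ π x = 0 := by
    rw [← RingHom.mem_ker (f := π), hP]
    change residue RP (algebraMap R RP x) = 0 ↔ _
    rw [residue_eq_zero_iff]
    exact IsLocalization.AtPrime.to_map_mem_maximal_iff RP P x
  have hP' (x : R) (hx : π x = 0) : x ∈ P := hP.le hx
  obtain ⟨s, hs⟩ := IsLocalization.exist_integer_multiples_of_finite P.primeCompl f'
  choose f hf using hs
  have hf2 (i) : algebraMap R RP (f i) = algebraMap R RP s * f' i := by
    rw [← Algebra.smul_def]; exact hf i
  have hf'm (i) : residue RP (f' i) = 0 := by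
    rw [residue_eq_zero_iff, ← hf']
    exact Ideal.subset_span ⟨i, rfl⟩
  have hπs : π s ≠ 0 := fun h => s.2 (hP' _ h)
  choose c hc using fun j i => residue_surjective (R := RP) (δ j (algebraMap R RP (y i)))
  obtain ⟨t, ht⟩ := IsLocalization.exist_integer_multiples_of_finite P.primeCompl
    (fun ji : Fin h × Fin m => c ji.1 ji.2)
  choose a ha using ht
  have ha2 (j i) : ρ (a (j, i)) = ρ t * δ j (algebraMap R RP (y i)) := by
    change residue RP (algebraMap R RP _) = _
    rw [ha (j, i), Algebra.smul_def, map_mul, hc]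
    rfl
  have hπt : π t ≠ 0 := fun h => t.2 (hP' _ h)
  have hsmul (x : RP) (z : ResidueField RP) : x • z = residue RP x * z := Algebra.smul_def _ _
  have hδf2 (i j) : δ j (algebraMap R RP (f i)) = if i = j then ρ s else 0 := by
    rw [hf2, Derivation.leibniz, hδf, hsmul, hsmul, hf'm, zero_mul, add_zero]
    simp [ρ]
  have hsum (j) (x : R) : δ j (algebraMap R RP x) =
      ∑ i, δ j (algebraMap R RP (y i)) * ρ (D i x) :=
    derivation_eq_sum ρ ((δ j).toLinearMap.toAddMonoidHom.comp (algebraMap R RP).toAddMonoidHom)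
      (fun x y => by
        change δ j (algebraMap R RP (x * y)) = ρ x * δ j _ + ρ y * δ j _
        rw [map_mul, Derivation.leibniz, hsmul, hsmul]
        rfl) D A y hgen (fun a ha => hδG j _ (hAG a ha)) hDA hDy x
  refine isGenReg_of_derivations π hπ f (fun i => ?_) ?_ (fun j => ∑ i, a (j, i) • D i) (s * t)
    (by rw [map_mul]; exact mul_ne_zero hπs hπt) (fun i j => ?_) q
  · rw [← hρ]
    change residue RP (algebraMap R RP _) = 0
    rw [hf2, map_mul, hf'm, mul_zero]
  · obtain ⟨gs, hgs⟩ := (IsNoetherian.noetherian P : P.FG)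
    have hloc (x : R) (hx : π x = 0) : ∃ w ∈ P.primeCompl, w * x ∈ Ideal.span (Set.range f) := by
      rw [← IsLocalization.algebraMap_mem_map_algebraMap_iff P.primeCompl RP, Ideal.map_span,
        ← Set.range_comp]
      have h1 : algebraMap R RP x ∈ Ideal.span (Set.range f') := by
        rw [hf', IsLocalization.AtPrime.to_map_mem_maximal_iff RP P x, ← hP]
        exact hx
      refine (Ideal.span_le.2 ?_ : Ideal.span (Set.range f') ≤ _) h1
      rintro _ ⟨i, rfl⟩
      have hu : IsUnit (algebraMap R RP s) := IsLocalization.map_units RP s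
      rw [SetLike.mem_coe, ← Ideal.unit_mul_mem_iff_mem _ hu, ← hf2]
      exact Ideal.subset_span ⟨i, rfl⟩
    have hgsP (g) (hg : g ∈ gs) : π g = 0 := by
      rw [← RingHom.mem_ker, hP, ← hgs]
      exact Ideal.subset_span hg
    choose! w hw hw' using hloc
    classical
    refine ⟨∏ g ∈ gs, w g, ?_, fun x hx => ?_⟩
    · rw [map_prod]
      refine Finset.prod_ne_zero_iff.2 fun g hg h0 => hw g (hgsP g hg) (hP' _ h0)
    · have hx' : x ∈ Ideal.span (gs : Set R) := by
        rw [show Ideal.span (gs : Set R) = P from hgs, ← hP]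
        exact hx
      refine Submodule.span_induction (p := fun x _ => (∏ g ∈ gs, w g) * x ∈
        Ideal.span (Set.range f)) (fun g hg => ?_) (by simp) (fun a b _ _ ha hb => ?_)
        (fun r a _ ha => ?_) hx'
      · rw [← Finset.prod_erase_mul _ _ hg, mul_assoc]
        exact Ideal.mul_mem_left _ _ (hw' g (hgsP g hg))
      · rw [mul_add]; exact add_mem ha hb
      · rw [smul_eq_mul, mul_left_comm]; exact Ideal.mul_mem_left _ _ ha
  · have h1 : ρ ((∑ k, a (j, k) • D k) (f i)) = ρ (if i = j then s * t else 0) := by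
      have : (∑ k, a (j, k) • D k) (f i) = ∑ k, a (j, k) * D k (f i) := by
        rw [← Derivation.coeFnAddMonoidHom_apply, map_sum, Finset.sum_apply]
        rfl
      rw [this, map_sum]
      simp_rw [map_mul, ha2, mul_assoc]
      rw [← Finset.mul_sum, ← hsum, hδf2]
      split_ifs
      · rw [map_mul, mul_comm]
      · simp
    have h2 := sub_eq_zero.2 h1
    rw [← map_sub, hρ, map_sub, sub_eq_zero] at h2
    rw [h2]
    split_ifs <;> simp

end Sections

section CharPSections
open Polynomial

variable {T : Type u} [CommRing T] (p : ℕ) [Fact p.Prime] [CharP T p] (N : Ideal T)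

theorem pow_char_eq_of_sub_mem (hN : N ^ 2 = ⊥) {x y : T} (h : x - y ∈ N) : x ^ p = y ^ p := by
  have hp := (Fact.out : p.Prime).two_le
  have h1 : (x - y) ^ p = 0 := by
    have := Ideal.pow_le_pow_right hp (Ideal.pow_mem_pow h p)
    rwa [hN] at this
  rw [sub_pow_char] at h1
  exact sub_eq_zero.1 h1

/-- In characteristic `p`, a subring which contains all `p`-th powers and which maps injectively to
the residue field of a square zero thickening is contained in a coefficient field. -/
theorem exists_section_of_pow_mem [N.IsMaximal] (hN : N ^ 2 = ⊥) (F : Subring T)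
    (hF : ∀ x, x ^ p ∈ F) (hFN : ∀ g ∈ F, g ∈ N → g = 0) :
    ∃ G : Subring T, F ≤ G ∧ (∀ g ∈ G, g ∈ N → g = 0) ∧ ∀ x, ∃ g ∈ G, x - g ∈ N := by
  obtain ⟨G, hFG, hG⟩ := zorn_le_nonempty₀ {G : Subring T | F ≤ G ∧ ∀ g ∈ G, g ∈ N → g = 0}
    (fun c hc hcc G0 hG0 => by
      have hne : c.Nonempty := ⟨G0, hG0⟩
      refine ⟨sSup c, ⟨(hc hG0).1.trans (le_sSup hG0), fun g hg hgN => ?_⟩,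
        fun _ h => le_sSup h⟩
      obtain ⟨G1, h1, h2⟩ := (Subring.mem_sSup_of_directedOn hne hcc.directedOn).1 hg
      exact (hc h1).2 g h2 hgN) F ⟨le_rfl, hFN⟩
  refine ⟨G, hFG, hG.prop.2, fun x => ?_⟩
  by_contra! hx
  have hpG (x : T) : x ^ p ∈ G := hFG (hF x)
  have hfield : IsField G := by
    refine ⟨⟨0, 1, fun h => ?_⟩, mul_comm, fun {a} ha => ?_⟩
    · have h' : (0 : T) = 1 := congrArg Subtype.val h
      exact (Ideal.ne_top_iff_one N).1 (Ideal.IsMaximal.ne_top ‹_›) (h' ▸ N.zero_mem)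
    · have haN : (a : T) ∉ N := fun h => ha (Subtype.ext (hG.prop.2 _ a.2 h))
      obtain ⟨b, hb⟩ := Ideal.IsMaximal.exists_inv ‹_› haN
      obtain ⟨i, hi, hbi⟩ := hb
      have h1 : ((a : T) * b) ^ p = 1 := by
        rw [pow_char_eq_of_sub_mem p N hN (y := 1), one_pow]
        rw [← hbi]
        have : a * b - (b * a + i) = -i := by ring
        rw [this]
        exact neg_mem hi
      have hp := (Fact.out : p.Prime).pos
      refine ⟨⟨a ^ (p - 1) * b ^ p, G.mul_mem (G.pow_mem a.2 _) (hpG b)⟩, Subtype.ext ?_⟩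
      change (a : T) * (a ^ (p - 1) * b ^ p) = 1
      rw [← mul_assoc, mul_pow_sub_one hp.ne', ← mul_pow, h1]
  let : Field G := hfield.toField
  let : Field (T ⧸ N) := Ideal.Quotient.field N
  let alg : Algebra G (T ⧸ N) := ((Ideal.Quotient.mk N).comp G.subtype).toAlgebra
  let f : G[X] := X ^ p - C ⟨x ^ p, hpG x⟩
  have hirr : Irreducible f := by
    refine X_pow_sub_C_irreducible_of_prime Fact.out fun b hb => hx b b.2 ?_
    have h1 : (b : T) ^ p = x ^ p := congrArg Subtype.val hb
    have h2 : (x - b) ^ p ∈ N := by rw [sub_pow_char, h1, sub_self]; exact N.zero_mem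
    exact Ideal.IsPrime.mem_of_pow_mem inferInstance _ h2
  have hfx : aeval (Ideal.Quotient.mk N x) f = 0 := by
    simp only [f, map_sub, map_pow, aeval_X, aeval_C]
    rw [← map_pow]
    exact sub_self _
  have hmin : minpoly G (Ideal.Quotient.mk N x) = f :=
    (minpoly.eq_of_irreducible_of_monic hirr hfx
      (monic_X_pow_sub_C _ (Fact.out : p.Prime).ne_zero)).symm
  let ev : G[X] →+* T := eval₂RingHom G.subtype x
  have hle : ev.range ≤ G := by
    refine hG.le_of_ge ⟨hFG.trans fun g hg => ⟨C ⟨g, hg⟩, by simp [ev]⟩, ?_⟩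
      fun g hg => ⟨C ⟨g, hg⟩, by simp [ev]⟩
    rintro _ ⟨g, rfl⟩ hgN
    have h1 : aeval (Ideal.Quotient.mk N x) g = 0 := by
      rw [← Ideal.Quotient.eq_zero_iff_mem] at hgN
      rw [← hgN]
      change _ = Ideal.Quotient.mk N (eval₂ G.subtype x g)
      rw [hom_eval₂]
      rfl
    obtain ⟨g', rfl⟩ := hmin ▸ minpoly.dvd _ _ h1
    rw [map_mul]
    simp [ev, f]
  exact hx x (hle ⟨X, by simp [ev]⟩) (by simp)

/-- Existence of a section of `T → T / N`, for a square zero ideal `N`, over a subfield `L` of `M`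
which contains `M ^ p`, when `L` and `(T / N) ^ p` are linearly disjoint over `M ^ p`. -/
theorem exists_section_of_linearDisjoint [N.IsMaximal] (hN : N ^ 2 = ⊥) {L M : Type*} [Field L]
    [Field M] [Algebra L M] [Algebra M T] [Algebra L T] [IsScalarTower L M T]
    (hL : ∀ x : M, x ^ p ∈ (algebraMap L M).range) {n : ℕ} (b : Fin n → T)
    (hb : ∀ x, ∃ c : Fin n → M, x - ∑ i, c i • b i ∈ N)
    (hbL : ∀ c : Fin n → L, ∑ i, c i • b i ^ p ∈ N → c = 0) :
    ∃ G : Subring T, (algebraMap L T).range ≤ G ∧ (∀ g ∈ G, g ∈ N → g = 0) ∧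
      ∀ x, ∃ g ∈ G, x - g ∈ N := by
  have hpow (x : T) : x ^ p ∈ Submodule.span L (Set.range fun i => b i ^ p) := by
    obtain ⟨c, hc⟩ := hb x
    rw [pow_char_eq_of_sub_mem p N hN hc, sum_pow_char]
    refine sum_mem fun i _ => ?_
    obtain ⟨l, hl⟩ := hL (c i)
    rw [_root_.smul_pow, ← hl, algebraMap_smul]
    exact Submodule.smul_mem _ _ (Submodule.subset_span ⟨i, rfl⟩)
  let F := Algebra.adjoin L (MonoidHom.mrange (powMonoidHom p : T →* T) : Set T)
  have hF : Subalgebra.toSubmodule F ≤ Submodule.span L (Set.range fun i => b i ^ p) := by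
    rw [Algebra.adjoin_eq_span, Submonoid.closure_eq, Submodule.span_le]
    rintro _ ⟨x, rfl⟩
    exact hpow x
  obtain ⟨G, h1, h2, h3⟩ := exists_section_of_pow_mem p N hN F.toSubring
    (fun x => Algebra.subset_adjoin ⟨x, rfl⟩) (fun g hg hgN => by
      obtain ⟨c, rfl⟩ := (Submodule.mem_span_range_iff_exists_fun L).1 (hF hg)
      simp [hbL c hgN])
  refine ⟨G, ?_, h2, h3⟩
  rintro _ ⟨l, rfl⟩
  exact h1 (F.algebraMap_mem l)

end CharPSections

section PDerivations

/-- A finite family of vectors that is linearly independent over the intersection of a decreasing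
directed family of subfields is linearly independent over some member of the family. -/
theorem exists_linearIndependent_of_iInf {M K ι : Type*} [Field M] [CommRing K] [Algebra M K]
    (L : Finset ι → Subfield M) (hL : Antitone L) {n : ℕ} (v : Fin n → K)
    (hv : ∀ c : Fin n → M, (∀ i J, c i ∈ L J) → ∑ i, c i • v i = 0 → c = 0) :
    ∃ J, ∀ c : Fin n → M, (∀ i, c i ∈ L J) → ∑ i, c i • v i = 0 → c = 0 := by
  classical
  induction n with
  | zero => exact ⟨∅, fun c _ _ => Subsingleton.elim _ _⟩
  | succ n ih =>
    obtain ⟨J0, hJ0⟩ := ih (fun i => v i.succ) fun c hc h0 => by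
      have := hv (Fin.cons 0 c) (Fin.cases (fun J => (L J).zero_mem) (fun i J => by simpa using hc i J))
        (by simpa [Fin.sum_univ_succ] using h0)
      ext i
      simpa using congrFun this i.succ
    by_contra! hcon
    have key (J) (hJ : J0 ⊆ J) : ∃ a : Fin n → M, (∀ i, a i ∈ L J) ∧
        v 0 + ∑ i, a i • v i.succ = 0 := by
      obtain ⟨c, hc, h0, hne⟩ := hcon J
      have hc0 : c 0 ≠ 0 := fun h => hne <| by
        have := hJ0 (fun i => c i.succ) (fun i => hL hJ (hc _))
          (by simpa [Fin.sum_univ_succ, h] using h0)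
        ext i
        exact Fin.cases h (fun i => congrFun this i) i
      refine ⟨fun i => (c 0)⁻¹ * c i.succ, fun i => (L J).mul_mem ((L J).inv_mem (hc 0)) (hc _), ?_⟩
      have := congrArg (fun z => (c 0)⁻¹ • z) h0
      simpa [Fin.sum_univ_succ, smul_add, Finset.smul_sum, smul_smul, hc0] using this
    obtain ⟨a, ha, ha0⟩ := key J0 subset_rfl
    have hmem (i J) : a i ∈ L J := by
      obtain ⟨a', ha', ha0'⟩ := key (J0 ∪ J) Finset.subset_union_left
      have := hJ0 (fun i => a i - a' i)
        (fun i => (L J0).sub_mem (ha i) (hL Finset.subset_union_left (ha' i))) (by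
          simp only [sub_smul, Finset.sum_sub_distrib]
          linear_combination ha0 - ha0')
      rw [sub_eq_zero.1 (congrFun this i)]
      exact hL Finset.subset_union_right (ha' i)
    have := hv (Fin.cons 1 a) (Fin.cases (fun J => (L J).one_mem) (fun i J => by simpa using hmem i J))
      (by simpa [Fin.sum_univ_succ] using ha0)
    simpa using congrFun this 0

theorem iterate_derivation_mul {A : Type*} [CommRing A] (D : Derivation ℤ A A) (c x : A)
    (hc : D c = 0) (n : ℕ) : D^[n] (c * x) = c * D^[n] x := by
  induction n with
  | zero => rfl
  | succ n ih =>
    rw [Function.iterate_succ_apply', ih, Function.iterate_succ_apply', Derivation.leibniz, hc]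
    simp

theorem iterate_derivation_pow {A : Type*} [CommRing A] (D : Derivation ℤ A A) (y : A)
    (hy : D y = 1) (n : ℕ) : D^[n] (y ^ n) = n.factorial := by
  induction n with
  | zero => simp
  | succ n ih =>
    rw [Function.iterate_succ_apply, Derivation.leibniz_pow, hy]
    have h1 : ((n + 1) • y ^ (n + 1 - 1) • (1 : A)) = ((n + 1 : ℕ) : A) * y ^ n := by simp
    rw [h1, iterate_derivation_mul _ _ _ (D.map_natCast _), ih, Nat.factorial_succ, Nat.cast_mul]

theorem isUnit_factorial_of_lt {A : Type*} [CommRing A] (p : ℕ) [Fact p.Prime] [CharP A p] {n : ℕ}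
    (hn : n < p) : IsUnit (n.factorial : A) := by
  refine (CharP.isUnit_natCast_iff Fact.out).2 fun hd => ?_
  exact absurd ((Fact.out : p.Prime).dvd_factorial.1 hd) (by omega)

/-- If `D y = 1` and `D ^ p = 0` then any ring of characteristic `p` is generated by `y` over the
constants of `D`. -/
theorem mem_closure_constants {A : Type*} [CommRing A] (p : ℕ) [Fact p.Prime] [CharP A p]
    (D : Derivation ℤ A A) (y : A) (hy : D y = 1) (S : Subring A) (hS : ∀ x ∈ S, D x ∈ S)
    (hyS : y ∈ S)
    (hp : ∀ x, D^[p] x = 0) (x : A) (hx : x ∈ S) :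
    x ∈ Subring.closure ({c | c ∈ S ∧ D c = 0} ∪ {y}) := by
  have hSit (x) (hx : x ∈ S) (n : ℕ) : D^[n] x ∈ S := by
    induction n with
    | zero => exact hx
    | succ n ih => rw [Function.iterate_succ_apply']; exact hS _ ih
  suffices h : ∀ n ≤ p, ∀ x ∈ S, D^[n] x = 0 →
      x ∈ Subring.closure ({c | c ∈ S ∧ D c = 0} ∪ {y}) from h p le_rfl x hx (hp x)
  intro n
  induction n with
  | zero => intro _ x _ hx; simp only [Function.iterate_zero, id] at hx; rw [hx]; exact zero_mem _
  | succ n ih =>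
    intro hn x hxS hx
    obtain ⟨u, hu⟩ := isUnit_factorial_of_lt (A := A) p hn
    have hDu : D (↑u⁻¹ : A) = 0 := by
      have h1 : D ((u : A) * ↑u⁻¹) = 0 := by rw [Units.mul_inv]; exact D.map_one_eq_zero
      rw [Derivation.leibniz, hu, D.map_natCast, smul_zero, add_zero, smul_eq_mul, ← hu] at h1
      simpa using h1
    have hDx : D (D^[n] x) = 0 := (Function.iterate_succ_apply' D n x).symm.trans hx
    have huS : (↑u⁻¹ : A) ∈ S := by
      have h1 : (n.factorial : A) ^ (p - 1) = 1 := by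
        have h2 : ((n.factorial : ZMod p)) ^ (p - 1) = 1 :=
          ZMod.pow_card_sub_one_eq_one fun h0 => by
            have h3 := congrArg (ZMod.castHom (dvd_refl p) A) h0
            rw [map_natCast, map_zero, ← hu] at h3
            have := u.mul_inv
            rw [h3, zero_mul] at this
            exact CharP.nontrivial_of_char_ne_one (R := A)
              (Fact.out : p.Prime).ne_one |>.exists_pair_ne.elim fun a ⟨b, hab⟩ =>
                hab (by rw [← mul_one a, ← mul_one b, ← this, mul_zero, mul_zero])
        have h3 := congrArg (ZMod.castHom (dvd_refl p) A) h2
        simpa using h3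
      have h2 : (↑u⁻¹ : A) = (n.factorial : A) ^ (p - 1 - 1) := by
        have hp2 := (Fact.out : p.Prime).two_le
        have : (u : A) * (n.factorial : A) ^ (p - 1 - 1) = 1 := by
          rw [hu, mul_pow_sub_one (by omega), h1]
        exact (Units.inv_eq_of_mul_eq_one_right this)
      rw [h2]
      exact S.pow_mem (natCast_mem S _) _
    let c := ↑u⁻¹ * D^[n] x
    have hc : D c = 0 := by rw [Derivation.leibniz, hDx, hDu]; simp
    have hcS : c ∈ S := S.mul_mem huS (hSit x hxS n)
    have h1 : D^[n] (x - c * y ^ n) = 0 := by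
      rw [iterate_map_sub D, iterate_derivation_mul _ _ _ hc, iterate_derivation_pow _ _ hy, ← hu]
      simp [c, mul_comm, ← mul_assoc]
    have h2 := ih (by omega) _ (S.sub_mem hxS (S.mul_mem hcS (S.pow_mem hyS n))) h1
    have h3 : x = (x - c * y ^ n) + c * y ^ n := by ring
    have hyc : y ∈ Subring.closure ({c | c ∈ S ∧ D c = 0} ∪ {y}) :=
      Subring.subset_closure (Or.inr rfl)
    have hcc : c ∈ Subring.closure ({c | c ∈ S ∧ D c = 0} ∪ {y}) :=
      Subring.subset_closure (Or.inl ⟨hcS, hc⟩)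
    rw [h3]
    exact add_mem h2 (mul_mem hcc (pow_mem hyc n))

end PDerivations

section PDer

/-- A family of commuting derivations `D i` with `D i ^ p = 0` and dual coordinates `y i`, such
that the common constants are `p`-th powers. -/
structure PDer (p : ℕ) (A : Type u) [CommRing A] where
  /-- The index type. -/
  ι : Type u
  /-- The derivations. -/
  D : ι → Derivation ℤ A A
  /-- The coordinates. -/
  y : ι → A
  self : ∀ i, D i (y i) = 1
  ne : ∀ i j, i ≠ j → D i (y j) = 0
  comm : ∀ i j x, D i (D j x) = D j (D i x)
  pow : ∀ i x, (D i)^[p] x = 0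
  pth : ∀ x, (∀ i, D i x = 0) → ∃ z, z ^ p = x

/-- The common constants of finitely many members of a family of derivations. -/
def PDer.const {p : ℕ} {A : Type u} [CommRing A] (d : PDer p A) (J : Finset d.ι) : Subring A where
  carrier := {x | ∀ i ∈ J, d.D i x = 0}
  mul_mem' hx hy i hi := by rw [Derivation.leibniz, hx i hi, hy i hi]; simp
  one_mem' i _ := Derivation.map_one_eq_zero _
  add_mem' hx hy i hi := by rw [map_add, hx i hi, hy i hi, add_zero]
  zero_mem' i _ := map_zero _
  neg_mem' hx i hi := by rw [map_neg, hx i hi, neg_zero]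

theorem derivation_pow_char {A : Type*} [CommRing A] (p : ℕ) [CharP A p] (D : Derivation ℤ A A)
    (x : A) : D (x ^ p) = 0 := by
  rw [Derivation.leibniz_pow]
  simp [nsmul_eq_mul]

theorem PDer.pow_mem_const {p : ℕ} {A : Type u} [CommRing A] [CharP A p] (d : PDer p A)
    (J : Finset d.ι) (x : A) : x ^ p ∈ d.const J := fun _ _ => derivation_pow_char p _ _

theorem PDer.closure_const {p : ℕ} [Fact p.Prime] {A : Type u} [CommRing A] [CharP A p]
    (d : PDer p A) (J : Finset d.ι) :
    Subring.closure ((d.const J : Set A) ∪ d.y '' J) = ⊤ := by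
  classical
  induction J using Finset.induction_on with
  | empty =>
    refine eq_top_iff.2 fun x _ => Subring.subset_closure (Or.inl fun i hi => ?_)
    simp at hi
  | insert j J hj ih =>
    refine eq_top_iff.2 (ih.symm.le.trans ?_)
    refine Subring.closure_le.2 (Set.union_subset (fun x hx => ?_) ?_)
    · have h1 := mem_closure_constants p (d.D j) (d.y j) (d.self j) (d.const J)
        (fun x hx i hi => by rw [d.comm, hx i hi, map_zero])
        (fun i hi => d.ne i j (fun h => hj (h ▸ hi))) (d.pow j) x hx
      refine Subring.closure_mono (Set.union_subset_union ?_ ?_) h1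
      · rintro c ⟨hc, hc'⟩ i hi
        rcases Finset.mem_insert.1 hi with rfl | hi
        · exact hc'
        · exact hc i hi
      · rintro _ rfl
        exact ⟨j, by simp, rfl⟩
    · rintro _ ⟨i, hi, rfl⟩
      exact Subring.subset_closure (Or.inr ⟨i, by simp [Finset.mem_coe.1 hi], rfl⟩)

/-- The subfield of the fraction field defined by the constants of finitely many derivations. -/
def PDer.subfield {p : ℕ} [Fact p.Prime] {A : Type u} [CommRing A] [IsDomain A] [CharP A p]
    (d : PDer p A) (M : Type u) [Field M] [Algebra A M] [IsFractionRing A M] (J : Finset d.ι) :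
    Subfield M where
  carrier := {x | ∃ b : A, b ≠ 0 ∧ ∃ a ∈ d.const J, x * algebraMap A M b ^ p = algebraMap A M a}
  mul_mem' := by
    rintro x y ⟨b, hb, a, ha, h⟩ ⟨b', hb', a', ha', h'⟩
    refine ⟨b * b', mul_ne_zero hb hb', a * a', mul_mem ha ha', ?_⟩
    rw [map_mul, map_mul, ← h, ← h']
    ring
  one_mem' := ⟨1, one_ne_zero, 1, one_mem _, by simp⟩
  add_mem' := by
    rintro x y ⟨b, hb, a, ha, h⟩ ⟨b', hb', a', ha', h'⟩
    refine ⟨b * b', mul_ne_zero hb hb', a * b' ^ p + a' * b ^ p,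
      add_mem (mul_mem ha (d.pow_mem_const J _)) (mul_mem ha' (d.pow_mem_const J _)), ?_⟩
    rw [map_mul, map_add, map_mul, map_mul, ← h, ← h', map_pow, map_pow]
    ring
  zero_mem' := ⟨1, one_ne_zero, 0, zero_mem _, by simp⟩
  neg_mem' := by
    rintro x ⟨b, hb, a, ha, h⟩
    exact ⟨b, hb, -a, neg_mem ha, by rw [map_neg, ← h, neg_mul]⟩
  inv_mem' := by
    rintro x ⟨b, hb, a, ha, h⟩
    by_cases hx : x = 0
    · exact ⟨1, one_ne_zero, 0, zero_mem _, by simp [hx]⟩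
    have hp := (Fact.out : p.Prime).pos
    have hinj := IsFractionRing.injective A M
    have hbM : algebraMap A M b ≠ 0 := (map_ne_zero_iff _ hinj).2 hb
    have haM : algebraMap A M a ≠ 0 := h ▸ mul_ne_zero hx (pow_ne_zero _ hbM)
    refine ⟨a, fun h0 => haM (by simp [h0]), a ^ (p - 1) * b ^ p,
      mul_mem (pow_mem ha _) (d.pow_mem_const J _), ?_⟩
    obtain ⟨q, rfl⟩ : ∃ q, p = q + 1 := ⟨p - 1, by omega⟩
    rw [map_mul, map_pow, map_pow, Nat.add_sub_cancel, pow_succ, ← h]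
    field_simp

theorem PDer.subfield_antitone {p : ℕ} [Fact p.Prime] {A : Type u} [CommRing A] [IsDomain A]
    [CharP A p] (d : PDer p A) (M : Type u) [Field M] [Algebra A M] [IsFractionRing A M] :
    Antitone (d.subfield M) := by
  rintro J J' h x ⟨b, hb, a, ha, hx⟩
  exact ⟨b, hb, a, fun i hi => ha i (h hi), hx⟩

theorem PDer.pow_mem_subfield {p : ℕ} [Fact p.Prime] {A : Type u} [CommRing A] [IsDomain A]
    [CharP A p] (d : PDer p A) (M : Type u) [Field M] [Algebra A M] [IsFractionRing A M]
    (J : Finset d.ι) (x : M) : x ^ p ∈ d.subfield M J := by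
  obtain ⟨a, b, hb, rfl⟩ := IsFractionRing.div_surjective (A := A) x
  have hb0 := nonZeroDivisors.ne_zero hb
  refine ⟨b, hb0, a ^ p, d.pow_mem_const J _, ?_⟩
  have hbM : algebraMap A M b ≠ 0 := (map_ne_zero_iff _ (IsFractionRing.injective A M)).2 hb0
  rw [map_pow, ← mul_pow, div_mul_cancel₀ _ hbM]

theorem PDer.exists_pow_of_mem_subfield {p : ℕ} [Fact p.Prime] {A : Type u} [CommRing A]
    [IsDomain A] [CharP A p] (d : PDer p A) (M : Type u) [Field M] [Algebra A M]
    [IsFractionRing A M] (x : M) (hx : ∀ J, x ∈ d.subfield M J) : ∃ z, z ^ p = x := by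
  have hinj := IsFractionRing.injective A M
  obtain ⟨a, b, hb, rfl⟩ := IsFractionRing.div_surjective (A := A) x
  have hb0 := nonZeroDivisors.ne_zero hb
  have hbM : algebraMap A M b ≠ 0 := (map_ne_zero_iff _ hinj).2 hb0
  obtain ⟨q, hq⟩ : ∃ q, p = q + 1 := ⟨p - 1, by have := (Fact.out : p.Prime).pos; omega⟩
  obtain ⟨z, hz⟩ := d.pth (a * b ^ q) fun i => by
    obtain ⟨c, hc, e, he, h⟩ := hx {i}
    have h1 : c ^ p * (a * b ^ q) = e * b ^ p := by
      apply hinj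
      have h2 : algebraMap A M a * algebraMap A M c ^ p = algebraMap A M e * algebraMap A M b := by
        rw [← h]; field_simp
      simp only [map_mul, map_pow]
      calc _ = (algebraMap A M a * algebraMap A M c ^ p) * algebraMap A M b ^ q := by ring
        _ = _ := by rw [h2, hq]; ring
    have h2 := congrArg (d.D i) h1
    rw [Derivation.leibniz _ (c ^ p), Derivation.leibniz _ e, derivation_pow_char p, derivation_pow_char p,
      he i (by simp)] at h2
    simpa [pow_eq_zero_iff (Fact.out : p.Prime).ne_zero, hc] using h2
  refine ⟨algebraMap A M z / algebraMap A M b, ?_⟩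
  rw [div_pow, ← map_pow, hz, map_mul, map_pow, hq]
  field_simp
  ring

end PDer

section PDerMain
open IsLocalRing

/-- The coefficientwise extension of an additive map to polynomials. -/
noncomputable def mvPolyMap {σ A : Type*} [CommRing A] (D : A →+ A) :
    MvPolynomial σ A →+ MvPolynomial σ A where
  toFun f := AddMonoidAlgebra.ofCoeff (Finsupp.mapRange D D.map_zero (AddMonoidAlgebra.coeff f))
  map_zero' := by
    ext s
    change D (MvPolynomial.coeff s 0) = MvPolynomial.coeff s 0
    simp
  map_add' f g := by
    ext s
    change D (MvPolynomial.coeff s (f + g)) = MvPolynomial.coeff s (_ + _)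
    rw [MvPolynomial.coeff_add, MvPolynomial.coeff_add, map_add]
    rfl

/-- The coefficientwise extension of a derivation to polynomials. -/
noncomputable def mvPolyDer {σ A : Type*} [CommRing A] (D : Derivation ℤ A A) :
    Derivation ℤ (MvPolynomial σ A) (MvPolynomial σ A) :=
  Derivation.mk' (AddMonoidHom.toIntLinearMap (mvPolyMap (D : A →+ A)))
    (fun f g => by
      classical
      ext s
      change D (MvPolynomial.coeff s (f * g)) = MvPolynomial.coeff s
        (f * mvPolyMap (D : A →+ A) g + g * mvPolyMap (D : A →+ A) f)
      rw [MvPolynomial.coeff_add, mul_comm g, MvPolynomial.coeff_mul, MvPolynomial.coeff_mul,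
        MvPolynomial.coeff_mul, map_sum, ← Finset.sum_add_distrib]
      refine Finset.sum_congr rfl fun x _ => ?_
      rw [Derivation.leibniz, smul_eq_mul, smul_eq_mul, mul_comm (MvPolynomial.coeff x.2 g)]
      rfl)

theorem coeff_mvPolyDer {σ A : Type*} [CommRing A] (D : Derivation ℤ A A) (f : MvPolynomial σ A)
    (s : σ →₀ ℕ) : (mvPolyDer D f).coeff s = D (f.coeff s) := rfl

theorem mvPolyDer_C {σ A : Type*} [CommRing A] (D : Derivation ℤ A A) (a : A) :
    mvPolyDer D (MvPolynomial.C a : MvPolynomial σ A) = MvPolynomial.C (D a) := by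
  classical
  ext s
  rw [coeff_mvPolyDer, MvPolynomial.coeff_C, MvPolynomial.coeff_C]
  split_ifs <;> simp

theorem mvPolyDer_X {σ A : Type*} [CommRing A] (D : Derivation ℤ A A) (i : σ) :
    mvPolyDer D (MvPolynomial.X i : MvPolynomial σ A) = 0 := by
  classical
  ext s
  rw [coeff_mvPolyDer, MvPolynomial.coeff_X]
  split_ifs <;> simp

section
variable {A B RP M : Type u} [CommRing A] [IsDomain A] [CommRing B] [IsDomain B] [Algebra A B]
  [FaithfulSMul A B] [Algebra.IsAlgebraic A B] {n : ℕ} (π : MvPolynomial (Fin n) A →ₐ[A] B)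
  [CommRing RP] [IsLocalRing RP] [Algebra (MvPolynomial (Fin n) A) RP]
  (P : Ideal (MvPolynomial (Fin n) A)) [P.IsPrime] (hP : RingHom.ker π = P)
  [IsLocalization.AtPrime RP P] [Field M] [Algebra A M] [IsFractionRing A M]

include hP in
omit [IsDomain B] [Algebra.IsAlgebraic A B] [IsLocalRing RP] in
theorem isUnit_of_ker_eq (a : nonZeroDivisors A) :
    IsUnit ((algebraMap (MvPolynomial (Fin n) A) RP).comp MvPolynomial.C a) := by
  refine IsLocalization.map_units RP (⟨MvPolynomial.C (a : A), fun h => ?_⟩ : P.primeCompl)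
  rw [← hP, SetLike.mem_coe, RingHom.mem_ker, MvPolynomial.C_eq_algebraMap] at h
  change π (algebraMap A _ (a : A)) = 0 at h
  rw [AlgHom.commutes] at h
  exact nonZeroDivisors.ne_zero a.2 ((FaithfulSMul.algebraMap_eq_zero_iff A B).1 h)

include hP in
omit [IsDomain A] [IsDomain B] [FaithfulSMul A B] in
theorem finite_residueField [Algebra M (ResidueField RP)]
    (hM : ∀ a : A, algebraMap M (ResidueField RP) (algebraMap A M a) =
      residue RP (algebraMap (MvPolynomial (Fin n) A) RP (MvPolynomial.C a))) : Module.Finite M (ResidueField RP) := by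
  let ρ : MvPolynomial (Fin n) A →+* ResidueField RP := (residue RP).comp (algebraMap _ RP)
  have hρ (x) : ρ x = 0 ↔ x ∈ P := by
    change residue RP _ = 0 ↔ _
    rw [residue_eq_zero_iff, IsLocalization.AtPrime.to_map_mem_maximal_iff RP P]
  let S : Set (ResidueField RP) := Set.range fun i => ρ (MvPolynomial.X i)
  have h_int (i) : IsIntegral M (ρ (MvPolynomial.X i)) := by
    obtain ⟨f, hf0, hf⟩ := Algebra.IsAlgebraic.isAlgebraic (R := A) (π (MvPolynomial.X i))
    refine IsAlgebraic.isIntegral ⟨f.map (algebraMap A M),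
      (Polynomial.map_ne_zero_iff (IsFractionRing.injective A M)).2 hf0, ?_⟩
    have h1 : π (Polynomial.aeval (MvPolynomial.X i) f) = 0 := by
      rw [← hf, Polynomial.aeval_algHom_apply]
    have h2 : ρ (Polynomial.aeval (MvPolynomial.X i) f) = 0 := by
      rw [hρ, ← hP]; exact h1
    rw [← h2, Polynomial.aeval_def, Polynomial.eval₂_map, Polynomial.aeval_def,
      Polynomial.hom_eval₂]
    congr 1
    ext a
    exact hM a
  have htop : IntermediateField.adjoin M S = ⊤ := by
    refine eq_top_iff.2 fun x _ => ?_
    have h1 (r) : ρ r ∈ IntermediateField.adjoin M S := by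
      induction r using MvPolynomial.induction_on with
      | C a =>
        change residue RP _ ∈ _
        rw [← hM]
        exact IntermediateField.algebraMap_mem _ _
      | add a b ha hb => rw [map_add]; exact add_mem ha hb
      | mul_X a i ha =>
        rw [map_mul]
        exact mul_mem ha (IntermediateField.subset_adjoin _ _ ⟨i, rfl⟩)
    obtain ⟨z, rfl⟩ := residue_surjective x
    obtain ⟨r, s, rfl⟩ := IsLocalization.exists_mk'_eq P.primeCompl z
    have h2 : residue RP (IsLocalization.mk' RP r s) * ρ s = ρ r := by
      change residue RP _ * residue RP _ = residue RP _
      rw [← map_mul, IsLocalization.mk'_spec]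
    have h3 : ρ s ≠ 0 := fun h => s.2 ((hρ _).1 h)
    rw [eq_div_of_mul_eq h3 h2]
    exact div_mem (h1 _) (h1 _)
  have hfin : Module.Finite M (IntermediateField.adjoin M S) := by
    have : Finite S := Set.finite_range _
    exact IntermediateField.finiteDimensional_adjoin fun x hx => by
      obtain ⟨i, rfl⟩ := hx
      exact h_int i
  rw [htop] at hfin
  exact Module.Finite.equiv (IntermediateField.topEquiv (F := M) (E := ResidueField RP)).toLinearEquiv
end

end PDerMain

section SectionCriterion
open IsLocalRing

theorem finite_quotient_of_surjective {M T κ : Type*} [Field M] [CommRing T] [Algebra M T] [Field κ]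
    [Algebra M κ] [Module.Finite M κ] (ψ : T →+* κ) (hψ : Function.Surjective ψ)
    (h : ∀ x, ψ (algebraMap M T x) = algebraMap M κ x) (N : Ideal T) (hN : RingHom.ker ψ = N) :
    Module.Finite M (T ⧸ N) := by
  subst hN
  exact Module.Finite.equiv (Ideal.quotientKerAlgEquivOfSurjective
    (f := ({ ψ with commutes' := h } : T →ₐ[M] κ)) hψ).symm.toLinearEquiv

theorem isGenReg_of_exists_section_aux {A B : Type u} (M : Type u) [CommRing A] [IsDomain A]
    [IsRegularRing A] [CommRing B] [IsDomain B] [Algebra A B] [FaithfulSMul A B]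
    [Algebra.FiniteType A B] [Algebra.IsAlgebraic A B] [Field M] [Algebra A M] [IsFractionRing A M]
    (H : ∀ (T : Type u) [CommRing T] [Algebra M T] (N : Ideal T) [N.IsMaximal], N ^ 2 = ⊥ →
      Module.Finite M (T ⧸ N) → ∃ (A0 : Set A) (m : ℕ) (D : Fin m → Derivation ℤ A A)
        (y : Fin m → A) (G : Subring T), Subring.closure (A0 ∪ Set.range y) = ⊤ ∧
        (∀ i, ∀ a ∈ A0, D i a = 0) ∧ (∀ i j, D i (y j) = if i = j then 1 else 0) ∧
        (∀ g ∈ G, g ∈ N → g = 0) ∧ (∀ x, ∃ g ∈ G, x - g ∈ N) ∧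
        ∀ a ∈ A0, algebraMap M T (algebraMap A M a) ∈ G)
    {n : ℕ} (π : MvPolynomial (Fin n) A →ₐ[A] B) (hπ : Function.Surjective π)
    (P0 : Ideal (MvPolynomial (Fin n) A)) [P0.IsPrime] (hP : RingHom.ker π = P0)
    (RP : Type u) [CommRing RP] [IsLocalRing RP] [Algebra (MvPolynomial (Fin n) A) RP]
    [IsLocalization.AtPrime RP P0]
    (q : Ideal B) [q.IsPrime] : IsGenReg (Localization.AtPrime q) := by
  classical
  have hRm : IsRegularRing (MvPolynomial (Fin n) A) := inferInstance
  let φ : M →+* RP := IsLocalization.lift (M := nonZeroDivisors A) (S := M)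
    (isUnit_of_ker_eq (RP := RP) π P0 hP)
  have hφ (a : A) : φ (algebraMap A M a) = algebraMap (MvPolynomial (Fin n) A) RP (MvPolynomial.C a) :=
    IsLocalization.lift_eq _ a
  let T := RP ⧸ maximalIdeal RP ^ 2
  let N : Ideal T := (maximalIdeal RP).cotangentIdeal
  have hNmk (x : RP) : Ideal.Quotient.mk (maximalIdeal RP ^ 2) x ∈ N ↔ x ∈ maximalIdeal RP := by
    rw [Ideal.mk_mem_cotangentIdeal]
  let ψ : T →+* ResidueField RP := Ideal.Quotient.lift (maximalIdeal RP ^ 2) (residue RP)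
    (fun x hx => (residue_eq_zero_iff x).2 (Ideal.pow_le_self two_ne_zero hx))
  have hψs : Function.Surjective ψ := fun x => by
    obtain ⟨y, rfl⟩ := residue_surjective x
    exact ⟨Ideal.Quotient.mk _ y, rfl⟩
  have hψ : RingHom.ker ψ = N := by
    ext x
    obtain ⟨y, rfl⟩ := Ideal.Quotient.mk_surjective x
    rw [hNmk, RingHom.mem_ker]
    exact residue_eq_zero_iff y
  have hNm : N.IsMaximal := by
    rw [← hψ]; exact RingHom.ker_isMaximal_of_surjective ψ hψs
  let iT : Algebra M T :=
    RingHom.toAlgebra (S := RP ⧸ maximalIdeal RP ^ 2) ((Ideal.Quotient.mk (maximalIdeal RP ^ 2)).comp φ)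
  let iκ : Algebra M (ResidueField RP) := ((residue RP).comp φ).toAlgebra
  have hfin : Module.Finite M (ResidueField RP) :=
    finite_residueField (RP := RP) π P0 hP (fun a => congrArg (residue RP) (hφ a))
  have hfinT : Module.Finite M (T ⧸ N) :=
    finite_quotient_of_surjective ψ hψs (fun _ => rfl) N hψ
  obtain ⟨A0, m, D, y, G, hgen, hDA, hDy, hG, hG', hAG⟩ :=
    H T N (Ideal.cotangentIdeal_square _) hfinT
  let e := finSumFinEquiv (m := m) (n := n)
  let D' : Fin m ⊕ Fin n → Derivation ℤ (MvPolynomial (Fin n) A) (MvPolynomial (Fin n) A) :=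
    Sum.elim (fun i => mvPolyDer (D i)) (fun j => (MvPolynomial.pderiv j).restrictScalars ℤ)
  let y' : Fin m ⊕ Fin n → MvPolynomial (Fin n) A :=
    Sum.elim (fun i => MvPolynomial.C (y i)) MvPolynomial.X
  have hDy' (i j) : D' i (y' j) = if i = j then 1 else 0 := by
    rcases i with i | i <;> rcases j with j | j
    · simp only [D', y', Sum.elim_inl, mvPolyDer_C, hDy, Sum.inl.injEq]
      split_ifs <;> simp
    · simp [D', y', mvPolyDer_X]
    · simp [D', y']
    · simp [D', y', MvPolynomial.pderiv_X, Pi.single_apply, eq_comm]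
  refine isGenReg_of_section π.toRingHom hπ P0 hP (RP := RP) G hG hG'
    (MvPolynomial.C '' A0) ?_ (fun i => D' (e.symm i)) (fun i => y' (e.symm i)) ?_ ?_ ?_ q
  · rintro _ ⟨a, ha, rfl⟩
    rw [← hφ]
    exact hAG a ha
  · refine eq_top_iff.2 fun f _ => ?_
    have hC (a : A) : (MvPolynomial.C a : MvPolynomial (Fin n) A) ∈ Subring.closure
        (MvPolynomial.C '' A0 ∪ Set.range fun i => y' (e.symm i)) := by
      have h1 : a ∈ Subring.closure (A0 ∪ Set.range y) := hgen ▸ Subring.mem_top a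
      have h2 : Subring.closure (A0 ∪ Set.range y) ≤ (Subring.closure
        (MvPolynomial.C '' A0 ∪ Set.range fun i => y' (e.symm i))).comap MvPolynomial.C := by
        refine Subring.closure_le.2 (Set.union_subset (fun a ha => ?_) ?_)
        · exact Subring.subset_closure (Or.inl ⟨a, ha, rfl⟩)
        · rintro _ ⟨i, rfl⟩
          exact Subring.subset_closure (Or.inr ⟨e (Sum.inl i), by simp [y']⟩)
      exact h2 h1
    induction f using MvPolynomial.induction_on with
    | C a => exact hC a
    | add f g hf hg => exact add_mem (hf trivial) (hg trivial)
    | mul_X f i hf =>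
      exact mul_mem (hf trivial) (Subring.subset_closure (Or.inr ⟨e (Sum.inr i), by simp [y']⟩))
  · rintro i _ ⟨a, ha, rfl⟩
    generalize e.symm i = i
    rcases i with i | i
    · exact (mvPolyDer_C _ _).trans (by rw [hDA i a ha, map_zero])
    · exact MvPolynomial.pderiv_C
  · intro i j
    exact (hDy' _ _).trans (by simp)

/-- A regularity criterion for the generic formal fibres of an algebraic algebra of finite type
over a regular domain, in terms of sections of square-zero extensions. -/
theorem isGenReg_of_exists_section {A B : Type u} (M : Type u) [CommRing A] [IsDomain A]
    [IsRegularRing A] [CommRing B] [IsDomain B] [Algebra A B] [FaithfulSMul A B]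
    [Algebra.FiniteType A B] [Algebra.IsAlgebraic A B] [Field M] [Algebra A M] [IsFractionRing A M]
    (H : ∀ (T : Type u) [CommRing T] [Algebra M T] (N : Ideal T) [N.IsMaximal], N ^ 2 = ⊥ →
      Module.Finite M (T ⧸ N) → ∃ (A0 : Set A) (m : ℕ) (D : Fin m → Derivation ℤ A A)
        (y : Fin m → A) (G : Subring T), Subring.closure (A0 ∪ Set.range y) = ⊤ ∧
        (∀ i, ∀ a ∈ A0, D i a = 0) ∧ (∀ i j, D i (y j) = if i = j then 1 else 0) ∧
        (∀ g ∈ G, g ∈ N → g = 0) ∧ (∀ x, ∃ g ∈ G, x - g ∈ N) ∧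
        ∀ a ∈ A0, algebraMap M T (algebraMap A M a) ∈ G)
    (q : Ideal B) [q.IsPrime] : IsGenReg (Localization.AtPrime q) := by
  obtain ⟨n, π, hπ⟩ := Algebra.FiniteType.iff_quotient_mvPolynomial''.1
    (inferInstance : Algebra.FiniteType A B)
  have : (RingHom.ker π).IsPrime := RingHom.ker_isPrime _
  exact isGenReg_of_exists_section_aux M H π hπ _ rfl (Localization.AtPrime (RingHom.ker π)) q

end SectionCriterion

section PDerGenReg

theorem exists_section_of_pder {p : ℕ} [Fact p.Prime] {A : Type u} [CommRing A] [IsDomain A]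
    [CharP A p] (d : PDer p A) (M : Type u) [Field M] [Algebra A M] [IsFractionRing A M]
    {T : Type u} [CommRing T] [Algebra M T] (N : Ideal T) [N.IsMaximal] (hN : N ^ 2 = ⊥)
    [Module.Finite M (T ⧸ N)] :
    ∃ (J : Finset d.ι) (G : Subring T), (∀ g ∈ G, g ∈ N → g = 0) ∧ (∀ x, ∃ g ∈ G, x - g ∈ N) ∧
      ∀ a ∈ d.const J, algebraMap M T (algebraMap A M a) ∈ G := by
  classical
  have : Nontrivial T := ⟨0, 1, fun h => Ideal.IsPrime.ne_top' (I := N)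
    ((Ideal.eq_top_iff_one N).2 (h ▸ N.zero_mem))⟩
  have hMp : CharP M p := charP_of_injective_algebraMap (IsFractionRing.injective A M) p
  have hTp : CharP T p := charP_of_injective_algebraMap (algebraMap M T).injective p
  let _ : Field (T ⧸ N) := Ideal.Quotient.field N
  have hKp : CharP (T ⧸ N) p := charP_of_injective_algebraMap (algebraMap M (T ⧸ N)).injective p
  let n := Module.finrank M (T ⧸ N)
  let bb : Module.Basis (Fin n) M (T ⧸ N) := Module.finBasis M (T ⧸ N)
  choose b hb using fun i => Ideal.Quotient.mk_surjective (bb i)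
  have hmk (c : M) (x : T) : Ideal.Quotient.mk N (c • x) = c • Ideal.Quotient.mk N x := rfl
  obtain ⟨J, hJ⟩ := exists_linearIndependent_of_iInf (d.subfield M) (d.subfield_antitone M)
    (fun i => bb i ^ p) (fun c hc h0 => by
      choose z hz using fun i => d.exists_pow_of_mem_subfield M (c i) (hc i)
      have h1 : (∑ i, z i • bb i) ^ p = 0 := by
        rw [sum_pow_char, ← h0]
        exact Finset.sum_congr rfl fun i _ => by rw [_root_.smul_pow, hz]
      have h2 := pow_eq_zero_iff (Fact.out : p.Prime).ne_zero |>.1 h1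
      have h3 := Fintype.linearIndependent_iff.1 bb.linearIndependent z h2
      ext i
      rw [← hz, h3, zero_pow (Fact.out : p.Prime).ne_zero]; rfl)
  let L := d.subfield M J
  obtain ⟨G, hLG, hG, hG'⟩ := exists_section_of_linearDisjoint p N hN (L := L) (M := M)
    (fun x => ⟨⟨x ^ p, d.pow_mem_subfield M J x⟩, rfl⟩) b
    (fun x => ⟨bb.repr (Ideal.Quotient.mk N x), by
      rw [← Ideal.Quotient.eq, map_sum]
      simp only [hmk, hb]
      exact (bb.sum_repr _).symm⟩)
    (fun c hc => by
      have h1 := hJ (fun i => (c i : M)) (fun i => (c i).2) (by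
        rw [← Ideal.Quotient.eq_zero_iff_mem, map_sum] at hc
        rw [← hc]
        refine Finset.sum_congr rfl fun i _ => ?_
        rw [← hb, ← map_pow, ← hmk]
        rfl)
      ext i
      exact congrFun h1 i)
  exact ⟨J, G, hG, hG', fun a ha => hLG ⟨⟨algebraMap A M a, 1, one_ne_zero, a, ha, by simp⟩, rfl⟩⟩

theorem isGenReg_of_pder {p : ℕ} [Fact p.Prime] {A B : Type u} [CommRing A] [IsDomain A]
    [IsRegularRing A] [CharP A p] (d : PDer p A) [CommRing B] [IsDomain B] [Algebra A B]
    [FaithfulSMul A B] [Algebra.FiniteType A B] [Algebra.IsAlgebraic A B]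
    (q : Ideal B) [q.IsPrime] : IsGenReg (Localization.AtPrime q) := by
  classical
  refine isGenReg_of_exists_section (A := A) (FractionRing A) (fun T _ _ N _ hN hfin => ?_) q
  obtain ⟨J, G, hG, hG', hJ⟩ := exists_section_of_pder d (FractionRing A) N hN
  refine ⟨d.const J, J.card, fun i => d.D (J.equivFin.symm i), fun i => d.y (J.equivFin.symm i), G,
    ?_, fun i a ha => ha _ (J.equivFin.symm i).2, fun i j => ?_, hG, hG', hJ⟩
  · rw [← d.closure_const J]
    congr 2
    ext x
    constructor
    · rintro ⟨i, rfl⟩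
      exact ⟨_, (J.equivFin.symm i).2, rfl⟩
    · rintro ⟨i, hi, rfl⟩
      exact ⟨J.equivFin ⟨i, hi⟩, by simp⟩
  · split_ifs with h
    · rw [h, d.self]
    · exact d.ne _ _ fun h' => h (J.equivFin.symm.injective (Subtype.ext h'))

/-- A separable algebraic residue field extension lifts to a square-zero extension. -/
theorem exists_section_of_charZero {M : Type u} [Field M] [CharZero M]
    {T : Type u} [CommRing T] [Algebra M T] (N : Ideal T) [N.IsMaximal] (hN : N ^ 2 = ⊥)
    [Module.Finite M (T ⧸ N)] :
    ∃ G : Subring T, (∀ g ∈ G, g ∈ N → g = 0) ∧ (∀ x, ∃ g ∈ G, x - g ∈ N) ∧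
      ∀ a, algebraMap M T a ∈ G := by
  let _ : Field (T ⧸ N) := Ideal.Quotient.field N
  have : Algebra.FormallyEtale M (T ⧸ N) := Algebra.FormallyEtale.of_isSeparable M (T ⧸ N)
  let s : (T ⧸ N) →ₐ[M] T := Algebra.FormallySmooth.lift N ⟨2, hN⟩ (AlgHom.id M (T ⧸ N))
  have hs (x : T ⧸ N) : Ideal.Quotient.mk N (s x) = x :=
    Algebra.FormallySmooth.mk_lift N ⟨2, hN⟩ (AlgHom.id M (T ⧸ N)) x
  refine ⟨s.toRingHom.range, ?_, fun x => ⟨s (Ideal.Quotient.mk N x), ⟨_, rfl⟩, ?_⟩, fun a =>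
    ⟨algebraMap M _ a, s.commutes a⟩⟩
  · rintro _ ⟨x, rfl⟩ h
    have h1 := hs x
    have h2 : x = 0 := h1.symm.trans (Ideal.Quotient.eq_zero_iff_mem.2 h)
    rw [h2, map_zero]
  · rw [← Ideal.Quotient.eq, hs]

theorem isGenReg_of_charZero {A B : Type u} [CommRing A] [IsDomain A]
    [IsRegularRing A] [CharZero A] [CommRing B] [IsDomain B] [Algebra A B]
    [FaithfulSMul A B] [Algebra.FiniteType A B] [Algebra.IsAlgebraic A B]
    (q : Ideal B) [q.IsPrime] : IsGenReg (Localization.AtPrime q) := by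
  have : CharZero (FractionRing A) := charZero_of_injective_algebraMap (R := A)
    (IsFractionRing.injective A _)
  refine isGenReg_of_exists_section (A := A) (FractionRing A) (fun T _ _ N _ hN hfin => ?_) q
  obtain ⟨G, hG, hG', h⟩ := exists_section_of_charZero (M := FractionRing A) N hN
  exact ⟨Set.univ, 0, Fin.elim0, Fin.elim0, G, eq_top_iff.2 fun x _ =>
    Subring.subset_closure (Or.inl trivial), fun i => i.elim0, fun i => i.elim0, hG, hG',
    fun a _ => h _⟩

end PDerGenReg

section PDerExt

theorem iterate_pderiv_coeff {σ R A : Type*} [CommRing A] (c : (σ →₀ ℕ) → R → A) (i : σ) (D : R → R)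
    (h : ∀ s f, c s (D f) = c (s + Finsupp.single i 1) f * (s i + 1)) (n : ℕ) (s : σ →₀ ℕ) (f : R) :
    c s (D^[n] f) = c (s + Finsupp.single i n) f * ((s i + 1).ascFactorial n : ℕ) := by
  induction n generalizing s with
  | zero => simp
  | succ n ih =>
    rw [Function.iterate_succ_apply', h, ih, add_assoc, ← Finsupp.single_add, add_comm 1 n,
      Nat.ascFactorial_succ]
    simp only [Finsupp.add_apply, Finsupp.single_eq_same]
    have h1 : ((s i + 1 + n : ℕ) : A) * ((s i + 1).ascFactorial n : ℕ) =
        (s i + 1 : ℕ) * ((s i + 1 + 1).ascFactorial n : ℕ) := by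
      rw [← Nat.cast_mul, ← Nat.succ_ascFactorial, Nat.cast_mul]
    rw [Nat.cast_mul, h1]
    push_cast
    ring

theorem iterate_pderiv_char {σ R A : Type*} [CommRing A] (p : ℕ) [CharP A p]
    (c : (σ →₀ ℕ) → R → A) (i : σ) (D : R → R)
    (h : ∀ s f, c s (D f) = c (s + Finsupp.single i 1) f * (s i + 1)) (hp : 0 < p) (s : σ →₀ ℕ)
    (f : R) : c s (D^[p] f) = 0 := by
  rw [iterate_pderiv_coeff c i D h, (CharP.cast_eq_zero_iff A p _).2
    ((Nat.dvd_factorial hp le_rfl).trans (Nat.factorial_dvd_ascFactorial _ _)), mul_zero]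

theorem dvd_of_pderiv_eq_zero {σ R A : Type*} [CommRing A] (p : ℕ) [Fact p.Prime] [CharP A p]
    (c : (σ →₀ ℕ) → R → A) (i : σ) (D : R → R)
    (h : ∀ s f, c s (D f) = c (s + Finsupp.single i 1) f * (s i + 1)) (f : R)
    (hf : ∀ s, c s (D f) = 0) (s : σ →₀ ℕ) (hs : c s f ≠ 0) : p ∣ s i := by
  by_contra hps
  have hsi : s i ≠ 0 := fun h0 => hps (h0 ▸ dvd_zero p)
  have h1 := h (s - Finsupp.single i 1) f
  rw [hf, tsub_add_cancel_of_le (Finsupp.single_le_iff.2 (Nat.one_le_iff_ne_zero.2 hsi))] at h1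
  have h2 : (((s - Finsupp.single i 1 : σ →₀ ℕ) i : ℕ) : A) + 1 = (s i : ℕ) := by
    have : (s - Finsupp.single i 1 : σ →₀ ℕ) i + 1 = s i := by simp; omega
    rw [← this]; push_cast; rfl
  rw [h2] at h1
  have hu : IsUnit ((s i : ℕ) : A) := (CharP.isUnit_natCast_iff Fact.out).2 hps
  exact hs ((hu.mul_left_eq_zero).1 h1.symm)

/-- A derivation from an additive map satisfying the Leibniz rule. -/
def toDer {R : Type*} [CommRing R] (D : R →+ R) (h : ∀ f g, D (f * g) = f * D g + g * D f) :
    Derivation ℤ R R := Derivation.mk' (AddMonoidHom.toIntLinearMap D) h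

theorem toDer_apply {R : Type*} [CommRing R] (D : R →+ R)
    (h : ∀ f g, D (f * g) = f * D g + g * D f) (x : R) : toDer D h x = D x := rfl

theorem natCast_mul_derivation {A : Type*} [CommRing A] (D : Derivation ℤ A A) (x : A) (n : ℕ) :
    D (x * (n + 1)) = D x * (n + 1) := by
  have h : ((n : A) + 1) = ((n + 1 : ℕ) : A) := by push_cast; rfl
  rw [h, Derivation.leibniz, D.map_natCast]
  simp [mul_comm]

/-- The extension of a `p`-coordinate system along a ring of formal expressions in variables `σ`
with coefficient maps `c`. -/
noncomputable def PDer.extend {p : ℕ} [Fact p.Prime] {A R : Type u} [CommRing A] [CharP A p]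
    [CommRing R] (d : PDer p A) {σ : Type u} (c : (σ →₀ ℕ) → R →+ A)
    (hc : ∀ f g, (∀ s, c s f = c s g) → f = g) (E : Derivation ℤ A A → Derivation ℤ R R)
    (hE : ∀ D s f, c s (E D f) = D (c s f)) (Dσ : σ → Derivation ℤ R R)
    (hD : ∀ i s f, c s (Dσ i f) = c (s + Finsupp.single i 1) f * (s i + 1))
    (C : A →+* R) (X : σ → R) (hEC : ∀ D a, E D (C a) = C (D a)) (hEX : ∀ D i, E D (X i) = 0)
    (hDC : ∀ i a, Dσ i (C a) = 0) (hDX : ∀ i, Dσ i (X i) = 1)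
    (hDX' : ∀ i j, i ≠ j → Dσ i (X j) = 0)
    (hpth : ∀ (z : (σ →₀ ℕ) → A) (f : R), (∀ s, c s f ≠ 0 → z s ^ p = c s f ∧ ∀ i, p ∣ s i) →
      ∃ g, g ^ p = f) : PDer p R where
  ι := d.ι ⊕ σ
  D := Sum.elim (fun i => E (d.D i)) Dσ
  y := Sum.elim (fun i => C (d.y i)) X
  self i := by
    rcases i with i | i
    · exact (hEC _ _).trans (by rw [d.self, map_one])
    · exact hDX i
  ne i j h := by
    rcases i with i | i <;> rcases j with j | j
    · exact (hEC _ _).trans (by rw [d.ne _ _ (fun h' => h (congrArg _ h')), map_zero])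
    · exact hEX _ _
    · exact hDC _ _
    · exact hDX' i j fun h' => h (congrArg _ h')
  comm i j x := by
    refine hc _ _ fun s => ?_
    rcases i with i | i <;> rcases j with j | j
    · simp only [Sum.elim_inl, hE, d.comm i j]
    · simp only [Sum.elim_inl, Sum.elim_inr, hE, hD, natCast_mul_derivation]
    · simp only [Sum.elim_inl, Sum.elim_inr, hE, hD, natCast_mul_derivation]
    · classical
      simp only [Sum.elim_inr, hD]
      rw [add_right_comm]
      by_cases hij : i = j
      · rw [hij]
      · simp [hij, Ne.symm hij]
        ring
  pow i x := by
    refine hc _ _ fun s => ?_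
    rw [map_zero]
    rcases i with i | i
    · have h (n : ℕ) (s) : c s ((E (d.D i))^[n] x) = (d.D i)^[n] (c s x) := by
        induction n with
        | zero => rfl
        | succ n ih =>
          rw [Function.iterate_succ_apply', Function.iterate_succ_apply', hE, ih]
      exact (h p s).trans (d.pow i _)
    · exact iterate_pderiv_char p (fun s f => c s f) i (Dσ i) (hD i) (Fact.out : p.Prime).pos s x
  pth x hx := by
    have h1 (s) : ∃ z, z ^ p = c s x := d.pth _ fun i => by
      rw [← hE, show E (d.D i) x = 0 from hx (Sum.inl i), map_zero]
    choose z hz using h1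
    exact hpth z x fun s hs => ⟨hz s, fun i => dvd_of_pderiv_eq_zero p (fun s f => c s f) i
      (Dσ i) (hD i) x (fun s => by rw [show Dσ i x = 0 from hx (Sum.inr i), map_zero]) s hs⟩

theorem exists_eq_smul_of_dvd {σ : Type*} {p : ℕ} {s : σ →₀ ℕ} (h : ∀ i, p ∣ s i) :
    ∃ m : σ →₀ ℕ, s = p • m := ⟨s.mapRange (fun n => n / p) (Nat.zero_div p),
        Finsupp.ext fun a => Nat.eq_mul_of_div_eq_right (h a) rfl⟩

/-- The coefficientwise extension of an additive map to power series. -/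
noncomputable def mvPowMap {σ A : Type*} [CommRing A] (D : A →+ A) :
    MvPowerSeries σ A →+ MvPowerSeries σ A where
  toFun f s := D (f s)
  map_zero' := funext fun _ => map_zero D
  map_add' _ _ := funext fun _ => map_add D _ _

theorem coeff_mvPowMap {σ A : Type*} [CommRing A] (D : A →+ A) (f : MvPowerSeries σ A)
    (s : σ →₀ ℕ) : MvPowerSeries.coeff s (mvPowMap D f) = D (MvPowerSeries.coeff s f) := rfl

theorem mvPowMap_mul {σ A : Type*} [CommRing A] (D : Derivation ℤ A A) (f g : MvPowerSeries σ A) :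
    mvPowMap (D : A →+ A) (f * g) = f * mvPowMap (D : A →+ A) g + g * mvPowMap (D : A →+ A) f := by
  classical
  ext s
  rw [map_add, mul_comm g, coeff_mvPowMap, MvPowerSeries.coeff_mul, MvPowerSeries.coeff_mul,
    MvPowerSeries.coeff_mul, map_sum, ← Finset.sum_add_distrib]
  refine Finset.sum_congr rfl fun x _ => ?_
  rw [coeff_mvPowMap, coeff_mvPowMap]
  change D _ = _ * D _ + D _ * _
  rw [Derivation.leibniz, smul_eq_mul, smul_eq_mul, mul_comm (MvPowerSeries.coeff x.2 g)]

/-- The extension of a `p`-coordinate system to power series. -/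
noncomputable def PDer.mvPowerSeries {p : ℕ} [Fact p.Prime] {A : Type u} [CommRing A] [CharP A p]
    (d : PDer p A) (σ : Type u) [Finite σ] : PDer p (MvPowerSeries σ A) :=
  d.extend (R := MvPowerSeries σ A) (fun s => (MvPowerSeries.coeff (R := A) s).toAddMonoidHom)
    (fun f g h => MvPowerSeries.ext h)
    (fun D => toDer (mvPowMap (D : A →+ A)) (mvPowMap_mul D)) (fun D s f => rfl)
    (fun i => toDer (MvPowerSeries.pderiv A i : MvPowerSeries σ A →+ MvPowerSeries σ A)
      (fun f g => by
        change MvPowerSeries.pderiv A i (f * g) = _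
        rw [Derivation.leibniz]; rfl))
    (fun i s f => MvPowerSeries.coeff_pderiv ..)
    (MvPowerSeries.C) MvPowerSeries.X
    (fun D a => by
      classical
      refine MvPowerSeries.ext fun s => ?_
      rw [toDer_apply, coeff_mvPowMap, MvPowerSeries.coeff_C, MvPowerSeries.coeff_C]
      change D _ = _
      split_ifs <;> simp)
    (fun D i => by
      classical
      refine MvPowerSeries.ext fun s => ?_
      rw [toDer_apply, coeff_mvPowMap, MvPowerSeries.coeff_X]
      change D _ = _
      split_ifs <;> simp)
    (fun i a => MvPowerSeries.pderiv_C)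
    (fun i => by classical exact MvPowerSeries.pderiv_X_self)
    (fun i j h => by classical exact MvPowerSeries.pderiv_X_of_ne (Ne.symm h))
    (fun z x h => by
      have hp0 := (Fact.out : p.Prime).ne_zero
      let f : MvPowerSeries σ A := fun s => open Classical in
        if MvPowerSeries.coeff (p • s) x = 0 then 0 else z (p • s)
      have hf (s) : MvPowerSeries.coeff s f = open Classical in
        if MvPowerSeries.coeff (p • s) x = 0 then 0 else z (p • s) := rfl
      refine ⟨f, ?_⟩
      rw [← MvPowerSeries.map_frobenius_expand p hp0]
      ext s
      rw [MvPowerSeries.coeff_map]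
      by_cases hs : ∀ i, p ∣ s i
      · obtain ⟨m, rfl⟩ := exists_eq_smul_of_dvd hs
        rw [MvPowerSeries.coeff_expand_smul, hf]
        split_ifs with h0
        · rw [h0, map_zero]
        · exact (h _ h0).1
      · push Not at hs
        obtain ⟨i, hi⟩ := hs
        rw [MvPowerSeries.coeff_expand_of_not_dvd p hp0 _ hi, map_zero]
        by_contra h0
        exact hi ((h s (Ne.symm h0)).2 i))

/-- The extension of a `p`-coordinate system to polynomials. -/
noncomputable def PDer.mvPolynomial {p : ℕ} [Fact p.Prime] {A : Type u} [CommRing A] [CharP A p]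
    (d : PDer p A) (σ : Type u) : PDer p (MvPolynomial σ A) :=
  d.extend (R := MvPolynomial σ A) (fun s => (MvPolynomial.lcoeff A s).toAddMonoidHom)
    (fun f g h => MvPolynomial.ext _ _ h)
    (fun D => toDer (mvPolyMap (D : A →+ A)) (mvPolyDer D).leibniz) (fun D s f => rfl)
    (fun i => toDer (MvPolynomial.pderiv (R := A) i).toLinearMap.toAddMonoidHom
      (fun f g => by
        change MvPolynomial.pderiv i (f * g) = _
        rw [Derivation.leibniz]; rfl))
    (fun i s f => MvPolynomial.coeff_pderiv ..)
    (MvPolynomial.C) MvPolynomial.X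
    (fun D a => mvPolyDer_C D a) (fun D i => mvPolyDer_X D i)
    (fun i a => MvPolynomial.pderiv_C)
    (fun i => by classical exact MvPolynomial.pderiv_X_self i)
    (fun i j h => by classical exact MvPolynomial.pderiv_X_of_ne (Ne.symm h))
    (fun z x h => by
      choose! m hm using fun s : σ →₀ ℕ => exists_eq_smul_of_dvd (p := p) (s := s)
      refine ⟨∑ s ∈ x.support, MvPolynomial.monomial (m s) (z s), ?_⟩
      have : CharP (MvPolynomial σ A) p := inferInstance
      rw [sum_pow_char p]
      conv_rhs => rw [x.as_sum]
      refine Finset.sum_congr rfl fun s hs => ?_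
      have hs' := h s (MvPolynomial.mem_support_iff.1 hs)
      rw [MvPolynomial.monomial_pow, ← hm s hs'.2]
      exact congrArg _ hs'.1)

end PDerExt

section PDerField

theorem iterate_derivation_leibniz {A : Type*} [CommRing A] (D : Derivation ℤ A A) (n : ℕ)
    (x y : A) : D^[n] (x * y) =
      ∑ ij ∈ Finset.HasAntidiagonal.antidiagonal n, n.choose ij.1 • (D^[ij.1] x * D^[ij.2] y) := by
  induction n with
  | zero => simp
  | succ n ih =>
    rw [Finset.sum_antidiagonal_choose_succ_nsmul (M := A) (fun i j => D^[i] x * D^[j] y) n]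
    simp only [Function.iterate_succ_apply', ih, map_sum, map_nsmul, Derivation.leibniz, smul_add,
      Finset.sum_add_distrib, add_right_inj, smul_eq_mul]
    refine Finset.sum_congr rfl fun ij hij => ?_
    rw [n.choose_symm_of_eq_add (Finset.HasAntidiagonal.mem_antidiagonal.1 hij).symm, mul_comm]

theorem iterate_derivation_leibniz_char {A : Type*} [CommRing A] (p : ℕ) [hp : Fact p.Prime]
    [CharP A p] (D : Derivation ℤ A A) (x y : A) :
    D^[p] (x * y) = x * D^[p] y + y * D^[p] x := by
  rw [iterate_derivation_leibniz, Finset.sum_eq_add (0, p) (p, 0)]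
  · simp [mul_comm]
  · exact fun h => hp.out.ne_zero (congrArg Prod.fst h).symm
  · rintro ⟨i, j⟩ hij ⟨h1, h2⟩
    rw [Finset.HasAntidiagonal.mem_antidiagonal] at hij
    have hi : i ≠ 0 := by rintro rfl; exact h1 (by simp_all)
    have hj : i < p := by
      rcases Nat.lt_or_ge i p with h | h
      · exact h
      · exact absurd (show (i, j) = (p, 0) by ext <;> simp at hij ⊢ <;> omega) h2
    rw [← Nat.cast_smul_eq_nsmul A, (CharP.cast_eq_zero_iff A p _).2
      (hp.out.dvd_choose_self hi hj), zero_smul]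
  · intro h; simp at h
  · intro h; simp at h

/-- In characteristic `p`, the `p`-th iterate of a derivation is a derivation. -/
def derivationIterateChar {A : Type*} [CommRing A] (p : ℕ) [Fact p.Prime]
    [CharP A p] (D : Derivation ℤ A A) : Derivation ℤ A A :=
  toDer { toFun := D^[p], map_zero' := iterate_map_zero D p, map_add' := iterate_map_add D p }
    (iterate_derivation_leibniz_char p D)

theorem exists_derivation_eq_one {k : Type u} [Field k] (p : ℕ) [hp : Fact p.Prime] [CharP k p]
    (F : Subfield k) (hF : ∀ x, x ^ p ∈ F) (a : k) (ha : a ∉ F) :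
    ∃ D : Derivation ℤ k k, (∀ x ∈ F, D x = 0) ∧ D a = 1 := by
  have hTp : CharP (DualNumber k) p :=
    charP_of_injective_algebraMap (algebraMap k (DualNumber k)).injective p
  have hbij : Function.Surjective (dualFst k) := fun x => ⟨TrivSqZeroExt.inl x, rfl⟩
  let N : Ideal (DualNumber k) := RingHom.ker (dualFst k)
  have hN : N.IsMaximal := RingHom.ker_isMaximal_of_surjective _ hbij
  have hN2 : N ^ 2 = ⊥ := by
    rw [pow_two, eq_bot_iff, Ideal.mul_le]
    intro x hx y hy
    have hx' : x.fst = 0 := hx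
    have hy' : y.fst = 0 := hy
    rw [Ideal.mem_bot]
    ext <;> simp [hx', hy']
  let t : DualNumber k := TrivSqZeroExt.inl a + DualNumber.eps
  let α : F := ⟨a ^ p, hF a⟩
  let φ : Polynomial F →+* DualNumber k :=
    Polynomial.eval₂RingHom ((algebraMap k (DualNumber k)).comp F.subtype) t
  have hφC (x : F) : φ (Polynomial.C x) = TrivSqZeroExt.inl (x : k) := Polynomial.eval₂_C _ _
  have hφ : φ (Polynomial.X ^ p - Polynomial.C α) = 0 := by
    have h1 : t ^ p = (TrivSqZeroExt.inl a : (DualNumber k)) ^ p :=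
      pow_char_eq_of_sub_mem p N hN2 (by
        change (t - TrivSqZeroExt.inl a).fst = 0
        simp [t])
    have h2 : φ Polynomial.X = t := Polynomial.eval₂_X _ _
    rw [map_sub, map_pow, h2, hφC, h1]
    change _ - TrivSqZeroExt.inl (a ^ p) = 0
    rw [TrivSqZeroExt.inl_pow, sub_self]
  have hirr : Irreducible (Polynomial.X ^ p - Polynomial.C α) :=
    X_pow_sub_C_irreducible_of_prime hp.out fun b hb => ha (by
      have h1 : (b : k) ^ p = a ^ p := congrArg Subtype.val hb
      rw [← frobenius_inj k p h1]
      exact b.2)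
  have hmax : (Ideal.span {Polynomial.X ^ p - Polynomial.C α}).IsMaximal :=
    PrincipalIdealRing.isMaximal_of_irreducible hirr
  have hker : RingHom.ker ((dualFst k).comp φ) =
      Ideal.span {Polynomial.X ^ p - Polynomial.C α} := by
    refine (hmax.eq_of_le (RingHom.ker_ne_top _) ?_).symm
    rw [Ideal.span_singleton_le_iff_mem, RingHom.mem_ker, RingHom.comp_apply, hφ, map_zero]
  obtain ⟨G, hFG, hG1, hG2⟩ := exists_section_of_pow_mem p N hN2 φ.range (fun x => by
      refine ⟨Polynomial.C ⟨x.fst ^ p, hF _⟩, ?_⟩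
      rw [hφC]
      change TrivSqZeroExt.inl (x.fst ^ p) = _
      rw [← TrivSqZeroExt.inl_pow]
      refine pow_char_eq_of_sub_mem p N hN2 ?_
      change ((TrivSqZeroExt.inl x.fst : (DualNumber k)) - x).fst = 0
      simp) (by
      rintro _ ⟨f, rfl⟩ hf
      have : f ∈ RingHom.ker ((dualFst k).comp φ) := hf
      rw [hker, Ideal.mem_span_singleton] at this
      obtain ⟨g, rfl⟩ := this
      rw [map_mul, hφ, zero_mul])
  choose s hs hsN using fun x : k => hG2 (TrivSqZeroExt.inl x)
  have hfst (x : k) : (s x).fst = x := by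
    have : ((TrivSqZeroExt.inl x : (DualNumber k)) - s x).fst = 0 := hsN x
    rw [TrivSqZeroExt.fst_sub, TrivSqZeroExt.fst_inl] at this
    exact (sub_eq_zero.1 this).symm
  have huniq (g : DualNumber k) (hg : g ∈ G) : s g.fst = g :=
    sub_eq_zero.1 (hG1 _ (G.sub_mem (hs _) hg) (by
      change (s g.fst - g).fst = 0
      simp [hfst]))
  refine ⟨toDer { toFun := fun x => (s x).snd, map_zero' := ?_, map_add' := fun x y => ?_ } ?_,
    fun x hx => ?_, ?_⟩
  · have := huniq 0 G.zero_mem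
    rw [TrivSqZeroExt.fst_zero] at this
    rw [this]; simp
  · have := huniq (s x + s y) (G.add_mem (hs x) (hs y))
    rw [TrivSqZeroExt.fst_add, hfst, hfst] at this
    rw [this]; simp
  · intro x y
    change (s (x * y)).snd = x * (s y).snd + y * (s x).snd
    have := huniq (s x * s y) (G.mul_mem (hs x) (hs y))
    rw [TrivSqZeroExt.fst_mul, hfst, hfst] at this
    rw [this, TrivSqZeroExt.snd_mul, hfst, hfst]
    simp [mul_comm]
  · change (s x).snd = 0
    have := huniq (TrivSqZeroExt.inl x) (hFG ⟨Polynomial.C ⟨x, hx⟩, hφC _⟩)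
    rw [TrivSqZeroExt.fst_inl] at this
    rw [this, TrivSqZeroExt.snd_inl]
  · change (s a).snd = 1
    have := huniq t (hFG ⟨Polynomial.X, Polynomial.eval₂_X _ _⟩)
    have h1 : t.fst = a := by simp [t]
    rw [h1] at this
    rw [this]
    simp [t]

/-- Evaluation of polynomials over `k` at `y`, where coefficients are raised to the `p`-th power. -/
noncomputable def frobEval {k : Type u} [Field k] (p : ℕ) [Fact p.Prime] [CharP k p] {ι : Type u}
    (y : ι → k) : MvPolynomial ι k →+* k := MvPolynomial.eval₂Hom (frobenius k p) y

theorem frobEval_C {k : Type u} [Field k] (p : ℕ) [Fact p.Prime] [CharP k p] {ι : Type u}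
    (y : ι → k) (a : k) : frobEval p y (MvPolynomial.C a) = a ^ p := MvPolynomial.eval₂_C _ _ _

theorem frobEval_X {k : Type u} [Field k] (p : ℕ) [Fact p.Prime] [CharP k p] {ι : Type u}
    (y : ι → k) (i : ι) : frobEval p y (MvPolynomial.X i) = y i := MvPolynomial.eval₂_X _ _ _

theorem derivation_frobEval {k : Type u} [Field k] (p : ℕ) [Fact p.Prime] [CharP k p] {ι : Type u}
    (y : ι → k) (i : ι) (D : Derivation ℤ k k) (h1 : D (y i) = 1) (h0 : ∀ j, i ≠ j → D (y j) = 0)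
    (g : MvPolynomial ι k) : D (frobEval p y g) = frobEval p y (MvPolynomial.pderiv i g) := by
  classical
  induction g using MvPolynomial.induction_on with
  | C a => rw [frobEval_C, MvPolynomial.pderiv_C, derivation_pow_char, map_zero]
  | add f g hf hg => simp only [map_add, hf, hg]
  | mul_X f j hf =>
    rw [map_mul, Derivation.leibniz, hf, frobEval_X, Derivation.leibniz, smul_eq_mul, smul_eq_mul,
      smul_eq_mul, smul_eq_mul, map_add, map_mul, map_mul, frobEval_X]
    by_cases h : i = j
    · subst h; rw [h1, MvPolynomial.pderiv_X_self, map_one]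
    · rw [h0 j h, MvPolynomial.pderiv_X_of_ne (Ne.symm h), map_zero]

theorem frobEval_injOn {k : Type u} [Field k] (p : ℕ) [hp : Fact p.Prime] [CharP k p] {ι : Type u}
    (y : ι → k) (D : ι → Derivation ℤ k k) (h1 : ∀ i, D i (y i) = 1)
    (h0 : ∀ i j, i ≠ j → D i (y j) = 0) (n : ℕ) (g : MvPolynomial ι k)
    (hn : ∀ s, g.coeff s ≠ 0 → s.degree < n) (hg : ∀ s, g.coeff s ≠ 0 → ∀ i, s i < p)
    (h : frobEval p y g = 0) : g = 0 := by
  classical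
  induction n generalizing g with
  | zero =>
    ext s
    by_contra hs
    exact absurd (hn s hs) (by simp)
  | succ n ih =>
    have hD (i) : MvPolynomial.pderiv i g = 0 := by
      have hs (s : ι →₀ ℕ) (hs : (MvPolynomial.pderiv i g).coeff s ≠ 0) :
          g.coeff (s + Finsupp.single i 1) ≠ 0 := by
        rw [MvPolynomial.coeff_pderiv] at hs
        exact left_ne_zero_of_mul hs
      refine ih _ (fun s h => ?_) (fun s h j => ?_) ?_
      · have := hn _ (hs s h)
        rw [map_add, Finsupp.degree_single] at this
        omega
      · have := hg _ (hs s h) j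
        rw [Finsupp.add_apply] at this
        omega
      · rw [← derivation_frobEval p y i (D i) (h1 i) (h0 i), h, map_zero]
    have hC : g = MvPolynomial.C (g.coeff 0) := by
      ext s
      rw [MvPolynomial.coeff_C]
      split_ifs with hs
      · rw [hs]
      · by_contra hgs
        obtain ⟨i, hi⟩ : ∃ i, s i ≠ 0 := by
          by_contra! h'
          exact hs (Finsupp.ext fun i => (h' i).symm)
        have := dvd_of_pderiv_eq_zero p (fun s f => MvPolynomial.coeff s f) i
          (MvPolynomial.pderiv (R := k) i) (fun s f => MvPolynomial.coeff_pderiv ..) g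
          (fun s => by simp [hD]) s hgs
        exact absurd (Nat.le_of_dvd (Nat.pos_of_ne_zero hi) this) (by have := hg s hgs i; omega)
    rw [hC, frobEval_C] at h
    rw [hC, pow_eq_zero_iff hp.out.ne_zero |>.1 h, map_zero]

theorem exists_pder_of_field (k : Type u) [Field k] (p : ℕ) [hp : Fact p.Prime] [CharP k p] :
    ∃ d : PDer p k, Function.Surjective (frobEval p d.y) ∧
      ∀ g : MvPolynomial d.ι k, (∀ s, g.coeff s ≠ 0 → ∀ i, s i < p) → frobEval p d.y g = 0 →
        g = 0 := by
  classical
  let d := KaehlerDifferential.D ℤ k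
  let b := Module.Basis.ofSpan (KaehlerDifferential.span_range_derivation ℤ k).ge
  have hb (i) : ∃ y, d y = b i := Module.Basis.ofSpan_subset
    (KaehlerDifferential.span_range_derivation ℤ k).ge ⟨i, rfl⟩
  choose y hy using hb
  let D (i) : Derivation ℤ k k := (b.coord i).compDer d
  have hDapp (i x) : D i x = b.coord i (d x) := rfl
  have hext (D1 D2 : Derivation ℤ k k) (h : ∀ i, D1 (y i) = D2 (y i)) : D1 = D2 := by
    have : D1.liftKaehlerDifferential = D2.liftKaehlerDifferential := b.ext fun i => by
      rw [← hy, Derivation.liftKaehlerDifferential_comp_D, Derivation.liftKaehlerDifferential_comp_D,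
        h]
    rw [← D1.liftKaehlerDifferential_comp, this, D2.liftKaehlerDifferential_comp]
  have hself (i) : D i (y i) = 1 := by rw [hDapp, hy]; simp
  have hne (i j) (h : i ≠ j) : D i (y j) = 0 := by
    rw [hDapp, hy]; simp [h.symm]
  refine ⟨⟨_, D, y, hself, hne, fun i j x => ?_, fun i x => ?_, fun x hx => ?_⟩, fun x => ?_,
    fun g hg h => ?_⟩
  · have : ⁅D i, D j⁆ = 0 := hext _ _ fun l => by
      rw [Derivation.commutator_apply]
      have h1 (i j) : D i (D j (y l)) = 0 := by
        by_cases h : j = l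
        · rw [h, hself, Derivation.map_one_eq_zero]
        · rw [hne _ _ h, map_zero]
      rw [h1, h1]; simp
    have := congrArg (fun E : Derivation ℤ k k => E x) this
    simpa [Derivation.commutator_apply, sub_eq_zero] using this
  · have : derivationIterateChar p (D i) = 0 := hext _ _ fun l => by
      change (D i)^[p] (y l) = 0
      obtain ⟨n, hn⟩ := Nat.exists_eq_add_of_le hp.out.two_le
      rw [hn, add_comm, Function.iterate_add_apply]
      have : (D i)^[2] (y l) = 0 := by
        change D i (D i (y l)) = 0
        by_cases h : i = l
        · rw [← h, hself, Derivation.map_one_eq_zero]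
        · rw [hne _ _ h, map_zero]
      rw [this, iterate_map_zero]
    exact congrArg (fun E : Derivation ℤ k k => E x) this
  · by_contra! h
    obtain ⟨E, -, hE⟩ := exists_derivation_eq_one p (frobenius k p).fieldRange
      (fun x => ⟨x, rfl⟩) x (fun ⟨b, hb⟩ => h b hb)
    have h0 : d x = 0 := b.ext_elem fun i => by
      rw [map_zero]; exact hx i
    rw [← E.liftKaehlerDifferential_comp_D, show KaehlerDifferential.D ℤ k x = 0 from h0,
      map_zero] at hE
    exact zero_ne_one hE
  · by_contra hx
    have hF (x : k) : x ^ p ∈ (frobEval p y).range := ⟨MvPolynomial.C x, frobEval_C _ _ _⟩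
    let F : Subfield k := { (frobEval p y).range with
      inv_mem' := fun x hx => by
        rcases eq_or_ne x 0 with rfl | h0
        · rwa [inv_zero]
        · have : x⁻¹ = x ^ (p - 1) * x⁻¹ ^ p := by
            obtain ⟨n, hn⟩ := Nat.exists_eq_succ_of_ne_zero hp.out.ne_zero
            rw [hn, Nat.succ_sub_one, pow_succ, ← mul_assoc, ← mul_pow, mul_inv_cancel₀ h0]
            simp
          change x⁻¹ ∈ (frobEval p y).range
          rw [this]
          exact Subring.mul_mem _ (Subring.pow_mem _ hx _) (hF _) }
    obtain ⟨E, hE0, hE⟩ := exists_derivation_eq_one p F hF x hx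
    have : E = 0 := hext _ _ fun i => hE0 _ ⟨MvPolynomial.X i, frobEval_X _ _ _⟩
    rw [this] at hE
    exact zero_ne_one hE
  · exact frobEval_injOn p y D hself hne _ g (fun s hs => Nat.lt_succ_of_le
      (Finset.le_sup (f := Finsupp.degree) (MvPolynomial.mem_support_iff.2 hs))) hg h

end PDerField

section CoefRing
open IsLocalRing

theorem Subring.exists_add_pow_prime {A : Type*} [CommRing A] (p : ℕ) [hp : Fact p.Prime]
    (C : Subring A) {x y : A} (hx : x ∈ C) (hy : y ∈ C) :
    ∃ r ∈ C, (x + y) ^ p = x ^ p + y ^ p + p * r := by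
  obtain ⟨r, hr⟩ := exists_add_pow_prime_eq hp.out (⟨x, hx⟩ : C) ⟨y, hy⟩
  refine ⟨x * y * r, C.mul_mem (C.mul_mem hx hy) r.2, (congrArg Subtype.val hr).trans ?_⟩
  simp [mul_assoc]

/-- The subring of elements `c ^ p + p y` with `c, y` in a given subring. -/
def powSubring {A : Type*} [CommRing A] (p : ℕ) [hp : Fact p.Prime] (C : Subring A) :
    Subring A where
  carrier := {x | ∃ c ∈ C, ∃ y ∈ C, x = c ^ p + p * y}
  mul_mem' := by
    rintro _ _ ⟨c, hc, y, hy, rfl⟩ ⟨d, hd, z, hz, rfl⟩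
    refine ⟨c * d, C.mul_mem hc hd, c ^ p * z + d ^ p * y + p * (y * z), ?_, by ring⟩
    exact C.add_mem (C.add_mem (C.mul_mem (C.pow_mem hc _) hz) (C.mul_mem (C.pow_mem hd _) hy))
      (C.mul_mem (natCast_mem _ _) (C.mul_mem hy hz))
  one_mem' := ⟨1, C.one_mem, 0, C.zero_mem, by simp⟩
  add_mem' := by
    rintro _ _ ⟨c, hc, y, hy, rfl⟩ ⟨d, hd, z, hz, rfl⟩
    obtain ⟨r, hr, h⟩ := Subring.exists_add_pow_prime p C hc hd
    exact ⟨c + d, C.add_mem hc hd, y + z - r, C.sub_mem (C.add_mem hy hz) hr, by rw [h]; ring⟩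
  zero_mem' := ⟨0, C.zero_mem, 0, C.zero_mem, by simp [hp.out.ne_zero]⟩
  neg_mem' := by
    rintro _ ⟨c, hc, y, hy, rfl⟩
    obtain ⟨r, hr, h⟩ := Subring.exists_add_pow_prime p C hc (C.neg_mem hc)
    refine ⟨-c, C.neg_mem hc, r - y, C.sub_mem hr hy, ?_⟩
    rw [add_neg_cancel, zero_pow hp.out.ne_zero] at h
    linear_combination h

theorem powSubring_le {A : Type*} [CommRing A] (p : ℕ) [Fact p.Prime] (C : Subring A) :
    powSubring p C ≤ C := by
  rintro _ ⟨c, hc, y, hy, rfl⟩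
  exact C.add_mem (C.pow_mem hc _) (C.mul_mem (natCast_mem _ _) hy)

theorem exists_reduced_eval₂ {A : Type*} [CommRing A] (p : ℕ) (hp : 0 < p) (E : Subring A)
    {ι : Type*} (T : ι → A) (hT : ∀ i, T i ^ p ∈ E) (g : MvPolynomial ι E) :
    ∃ g' : MvPolynomial ι E, (∀ s, g'.coeff s ≠ 0 → ∀ i, s i < p) ∧
      MvPolynomial.eval₂Hom E.subtype T g' = MvPolynomial.eval₂Hom E.subtype T g := by
  classical
  induction g using MvPolynomial.induction_on' with
  | monomial s a =>
    let q : ι →₀ ℕ := s.mapRange (· / p) (Nat.zero_div p)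
    let r : ι →₀ ℕ := s.mapRange (· % p) (Nat.zero_mod p)
    have hs : p • q + r = s := by ext i; simp [q, r, Nat.div_add_mod]
    let b : E := a * q.prod fun i n => (⟨T i ^ p, hT i⟩ : E) ^ n
    refine ⟨MvPolynomial.monomial r b, fun t ht i => ?_, ?_⟩
    · rw [MvPolynomial.coeff_monomial] at ht
      split_ifs at ht with h
      · rw [← h]; exact Nat.mod_lt _ hp
      · exact absurd rfl ht
    · conv_rhs => rw [← hs]
      simp only [MvPolynomial.coe_eval₂Hom, MvPolynomial.eval₂_monomial]
      rw [Finsupp.prod_add_index' (fun _ => pow_zero _) (fun _ _ _ => pow_add _ _ _), ← mul_assoc]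
      congr 1
      rw [map_mul, Finsupp.prod, map_prod]
      congr 1
      rw [Finsupp.prod_of_support_subset _ Finsupp.support_smul _ (fun _ _ => pow_zero _)]
      refine Finset.prod_congr rfl fun i _ => ?_
      rw [map_pow, Finsupp.smul_apply, smul_eq_mul, pow_mul]
      rfl
  | add f g hf hg =>
    obtain ⟨f', h1, h2⟩ := hf
    obtain ⟨g', h3, h4⟩ := hg
    refine ⟨f' + g', fun s hs => ?_, by rw [map_add, map_add, h2, h4]⟩
    rw [MvPolynomial.coeff_add] at hs
    by_cases h : f'.coeff s = 0
    · exact h3 s fun h' => hs (by rw [h, h', add_zero])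
    · exact h1 s h

variable {A : Type u} [CommRing A] [IsLocalRing A] (p : ℕ) [hp : Fact p.Prime]
  [CharP (ResidueField A) p] {ι : Type u} (T : ι → A)

/-- The approximation properties of a subring to a coefficient ring, modulo the `N`-th power of the
maximal ideal. -/
structure CoefStage (N : ℕ) (C : Subring A) : Prop where
  pow_le : ∀ x ∈ maximalIdeal A ^ N, x ∈ C
  mem : ∀ i, T i ∈ C
  surj : ∀ x, ∃ c ∈ C, x - c ∈ maximalIdeal A
  inf : ∀ c ∈ C, c ∈ maximalIdeal A → ∃ y ∈ C, c - p * y ∈ maximalIdeal A ^ N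

/-- The next approximation to a coefficient ring. -/
noncomputable def nextStage (N : ℕ) (C : Subring A) : Subring A :=
  ((MvPolynomial.eval₂Hom (powSubring p C).subtype T).range.map
    (Ideal.Quotient.mk (maximalIdeal A ^ N))).comap (Ideal.Quotient.mk (maximalIdeal A ^ N))

omit [CharP (ResidueField A) p] in
theorem mem_nextStage {N : ℕ} {C : Subring A} {x : A} : x ∈ nextStage p T N C ↔
    ∃ g, x - MvPolynomial.eval₂Hom (powSubring p C).subtype T g ∈ maximalIdeal A ^ N := by
  rw [nextStage, Subring.mem_comap, Subring.mem_map]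
  constructor
  · rintro ⟨_, ⟨g, rfl⟩, h⟩
    exact ⟨g, Ideal.Quotient.eq.1 h.symm⟩
  · rintro ⟨g, h⟩
    exact ⟨_, ⟨g, rfl⟩, (Ideal.Quotient.eq.2 h).symm⟩

omit [CharP (ResidueField A) p] in
theorem powSubring_le_nextStage (N : ℕ) (C : Subring A) : powSubring p C ≤ nextStage p T N C :=
  fun x hx => (mem_nextStage p T).2 ⟨MvPolynomial.C ⟨x, hx⟩, by simp⟩

omit [CharP (ResidueField A) p] in
theorem eval_mem_of_stage {N : ℕ} {C : Subring A} (h : CoefStage p T N C)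
    (g : MvPolynomial ι (powSubring p C)) :
    MvPolynomial.eval₂Hom (powSubring p C).subtype T g ∈ C := by
  induction g using MvPolynomial.induction_on with
  | C a => simpa using powSubring_le p C a.2
  | add f g hf hg => rw [map_add]; exact C.add_mem hf hg
  | mul_X f i hf => rw [map_mul]; exact C.mul_mem hf (by simpa using h.mem i)

omit [CharP (ResidueField A) p] in
theorem nextStage_le {N : ℕ} {C : Subring A} (h : CoefStage p T N C) :
    nextStage p T (N + 1) C ≤ C := by
  intro x hx
  obtain ⟨g, hg⟩ := (mem_nextStage p T).1 hx
  have := C.add_mem (h.pow_le _ (Ideal.pow_le_pow_right N.le_succ hg)) (eval_mem_of_stage p T h g)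
  rwa [sub_add_cancel] at this

omit hp in
theorem natCast_mem_maximalIdeal : (p : A) ∈ maximalIdeal A := by
  rw [← residue_eq_zero_iff, map_natCast, CharP.cast_eq_zero]

variable (hT1 : Function.Surjective (frobEval p fun i => residue A (T i)))
  (hT2 : ∀ g : MvPolynomial ι (ResidueField A), (∀ s, g.coeff s ≠ 0 → ∀ i, s i < p) →
    frobEval p (fun i => residue A (T i)) g = 0 → g = 0)

include hT1 in
theorem nextStage_surj {N : ℕ} {C : Subring A} (h : CoefStage p T N C) (x : A) :
    ∃ c ∈ nextStage p T (N + 1) C, x - c ∈ maximalIdeal A := by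
  obtain ⟨g, hg⟩ := hT1 (residue A x)
  suffices H : ∀ g : MvPolynomial ι (ResidueField A), ∃ c ∈ nextStage p T (N + 1) C,
      residue A c = frobEval p (fun i => residue A (T i)) g by
    obtain ⟨c, hc, hc'⟩ := H g
    exact ⟨c, hc, by rw [← residue_eq_zero_iff, map_sub, hc', hg, sub_self]⟩
  intro g
  induction g using MvPolynomial.induction_on with
  | C a =>
    obtain ⟨a, rfl⟩ := residue_surjective a
    obtain ⟨c, hc, hc'⟩ := h.surj a
    refine ⟨c ^ p, powSubring_le_nextStage p T _ _ ⟨c, hc, 0, C.zero_mem, by simp⟩, ?_⟩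
    rw [frobEval_C, map_pow]
    rw [← residue_eq_zero_iff, map_sub, sub_eq_zero] at hc'
    rw [hc']
  | add f g hf hg =>
    obtain ⟨c, hc, hc'⟩ := hf
    obtain ⟨d, hd, hd'⟩ := hg
    exact ⟨c + d, add_mem hc hd, by rw [map_add, map_add, hc', hd']⟩
  | mul_X f i hf =>
    obtain ⟨c, hc, hc'⟩ := hf
    refine ⟨c * T i, mul_mem hc ((mem_nextStage p T).2 ⟨MvPolynomial.X i, by simp⟩), ?_⟩
    rw [map_mul, map_mul, hc', frobEval_X]

include hT1 hT2 in
theorem nextStage_inf {N : ℕ} (hN : 1 ≤ N) {C : Subring A} (h : CoefStage p T N C) (c : A)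
    (hc : c ∈ nextStage p T (N + 1) C) (hcm : c ∈ maximalIdeal A) :
    ∃ y ∈ nextStage p T (N + 1) C, c - p * y ∈ maximalIdeal A ^ (N + 1) := by
  classical
  have hpm := natCast_mem_maximalIdeal (A := A) p
  have hpC (y : A) (hy : y ∈ C) : p * y ∈ nextStage p T (N + 1) C :=
    powSubring_le_nextStage p T _ _ ⟨0, C.zero_mem, y, hy, by simp [hp.out.ne_zero]⟩
  obtain ⟨g, hg⟩ := (mem_nextStage p T).1 hc
  obtain ⟨g', hg1, hg2⟩ := exists_reduced_eval₂ p hp.out.pos (powSubring p C) T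
    (fun i => ⟨T i, h.mem i, 0, C.zero_mem, by simp⟩) g
  rw [← hg2] at hg
  have hgm : MvPolynomial.eval₂Hom (powSubring p C).subtype T g' ∈ maximalIdeal A := by
    have := (maximalIdeal A).sub_mem hcm (Ideal.pow_le_self (Nat.succ_ne_zero N) hg)
    rwa [sub_sub_cancel] at this
  choose a ha b hb hab using fun s => (g'.coeff s).2
  have ham (s) (hs : g'.coeff s ≠ 0) : a s ∈ maximalIdeal A := by
    let f : MvPolynomial ι (ResidueField A) :=
      ∑ s ∈ g'.support, MvPolynomial.monomial s (residue A (a s))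
    have hfc (s) (hs : g'.coeff s ≠ 0) : f.coeff s = residue A (a s) := by
      simp only [f, MvPolynomial.coeff_sum, MvPolynomial.coeff_monomial]
      rw [Finset.sum_eq_single_of_mem s (MvPolynomial.mem_support_iff.2 hs)
        (fun b _ hb => if_neg hb), if_pos rfl]
    have hf : f = 0 := by
      refine hT2 f (fun s hs => hg1 s fun h0 => hs ?_) ?_
      · simp only [f, MvPolynomial.coeff_sum, MvPolynomial.coeff_monomial]
        refine Finset.sum_eq_zero fun b hb => if_neg ?_
        rintro rfl
        exact MvPolynomial.mem_support_iff.1 hb h0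
      · rw [← residue_eq_zero_iff, MvPolynomial.coe_eval₂Hom, MvPolynomial.eval₂_eq, map_sum] at hgm
        rw [← hgm, map_sum]
        refine Finset.sum_congr rfl fun s _ => ?_
        rw [map_mul, map_prod, Subring.subtype_apply, hab, map_add, map_mul, map_natCast,
          CharP.cast_eq_zero, zero_mul, add_zero, map_pow]
        simp only [frobEval, MvPolynomial.coe_eval₂Hom, MvPolynomial.eval₂_monomial, Finsupp.prod,
          frobenius_def, map_pow]
    rw [← residue_eq_zero_iff, ← hfc s hs, hf, MvPolynomial.coeff_zero]
  have key (e) (he : ∃ s, g'.coeff s ≠ 0 ∧ e = a s ^ p + p * b s) :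
      ∃ y ∈ C, e - p * y ∈ maximalIdeal A ^ (N + 1) := by
    obtain ⟨s, hs, rfl⟩ := he
    obtain ⟨z, hz, hv⟩ := h.inf (a s) (ha s) (ham s hs)
    set v := a s - p * z with hv'
    have hpz : p * z ∈ C := C.mul_mem (natCast_mem _ _) hz
    have hv2 : v ^ p ∈ maximalIdeal A ^ (N + 1) := by
      have := Ideal.pow_mem_pow hv p
      rw [← pow_mul] at this
      exact Ideal.pow_le_pow_right (by nlinarith [hp.out.two_le]) this
    obtain ⟨r, hr⟩ := exists_add_pow_prime_eq hp.out (p * z) v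
    obtain ⟨n, hn⟩ := Nat.exists_eq_succ_of_ne_zero hp.out.ne_zero
    refine ⟨b s + p ^ n * z ^ p, C.add_mem (hb s) (C.mul_mem (C.pow_mem (natCast_mem _ _) _)
      (C.pow_mem hz _)), ?_⟩
    have e1 : a s = p * z + v := by rw [hv']; ring
    have e2 : (p : A) ^ p = p * p ^ n := by
      rw [← pow_succ', ← Nat.succ_eq_add_one, ← hn]
    rw [e1, hr, mul_pow, e2]
    have e3 : (p * (p ^ n : A) * z ^ p + v ^ p + p * (p * z) * v * r + p * b s -
      p * (b s + p ^ n * z ^ p)) = v ^ p + p * v * (p * z * r) := by ring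
    rw [e3]
    refine Ideal.add_mem _ hv2 (Ideal.mul_mem_right _ _ ?_)
    rw [pow_succ']
    exact Ideal.mul_mem_mul hpm hv
  choose! y hy hyN using key
  have hfin : ∃ y ∈ C, c - p * y ∈ maximalIdeal A ^ (N + 1) := by
    refine ⟨∑ s ∈ g'.support, y (a s ^ p + p * b s) * s.prod fun i n => T i ^ n,
      C.sum_mem fun s hs => C.mul_mem (hy _ ⟨s, MvPolynomial.mem_support_iff.1 hs, rfl⟩)
        (C.prod_mem fun i _ => C.pow_mem (h.mem i) _), ?_⟩
    rw [← sub_add_sub_cancel c (MvPolynomial.eval₂Hom (powSubring p C).subtype T g')]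
    refine Ideal.add_mem _ hg ?_
    rw [MvPolynomial.coe_eval₂Hom, MvPolynomial.eval₂_eq, Finset.mul_sum, ← Finset.sum_sub_distrib]
    refine Ideal.sum_mem _ fun s hs => ?_
    rw [← mul_assoc, Finsupp.prod, ← sub_mul, Subring.subtype_apply, hab]
    exact Ideal.mul_mem_right _ _ (hyN _ ⟨s, MvPolynomial.mem_support_iff.1 hs, rfl⟩)
  obtain ⟨y, hyC, hy⟩ := hfin
  obtain ⟨c', hc', hm⟩ := nextStage_surj p T hT1 h y
  obtain ⟨u, hu, hw⟩ := h.inf (y - c') (C.sub_mem hyC (nextStage_le p T h hc')) hm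
  refine ⟨c' + p * u, add_mem hc' (hpC u hu), ?_⟩
  have : c - p * (c' + p * u) = (c - p * y) + p * (y - c' - p * u) := by ring
  rw [this]
  refine Ideal.add_mem _ hy ?_
  rw [pow_succ']
  exact Ideal.mul_mem_mul hpm hw

/-- The sequence of approximations to a coefficient ring. -/
noncomputable def stage : ℕ → Subring A
  | 0 => ⊤
  | n + 1 => nextStage p T (n + 2) (stage n)

include hT1 hT2 in
theorem coefStage (n : ℕ) : CoefStage p T (n + 1) (stage p T n) := by
  induction n with
  | zero =>
    exact ⟨fun _ _ => Subring.mem_top _, fun _ => Subring.mem_top _,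
      fun x => ⟨x, Subring.mem_top _, by simp⟩, fun c _ hc => ⟨0, Subring.mem_top _, by simpa⟩⟩
  | succ n ih =>
    exact ⟨fun x hx => (mem_nextStage p T).2 ⟨0, by simpa using hx⟩,
      fun i => (mem_nextStage p T).2 ⟨MvPolynomial.X i, by simp⟩,
      nextStage_surj p T hT1 ih, nextStage_inf p T hT1 hT2 (Nat.succ_pos n) ih⟩

include hT1 hT2 in
theorem stage_antitone : Antitone (stage p T : ℕ → Subring A) :=
  antitone_nat_of_succ_le fun n => nextStage_le p T (coefStage p T hT1 hT2 n)

include hT1 hT2 in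
theorem exists_mem_stage_succ (n : ℕ) (c : A) (hc : c ∈ stage p T n) :
    ∃ d ∈ stage p T (n + 1), c - d ∈ maximalIdeal A ^ (n + 1) := by
  have h := coefStage p T hT1 hT2 n
  obtain ⟨d, hd, hm⟩ := (coefStage p T hT1 hT2 (n + 1)).surj c
  obtain ⟨y, hy, hw⟩ := h.inf (c - d)
    (Subring.sub_mem _ hc (stage_antitone p T hT1 hT2 n.le_succ hd)) hm
  refine ⟨d + p * y, add_mem hd (powSubring_le_nextStage p T _ _
    ⟨0, Subring.zero_mem _, y, hy, by simp [hp.out.ne_zero]⟩), ?_⟩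
  rwa [← sub_sub]

include hT1 hT2 in
theorem exists_mem_iInf_stage [IsAdicComplete (maximalIdeal A) A] (n : ℕ) (c : A)
    (hc : c ∈ stage p T n) :
    ∃ d ∈ (⨅ n, stage p T n : Subring A), c - d ∈ maximalIdeal A ^ (n + 1) := by
  choose! f hf hfd using exists_mem_stage_succ p T hT1 hT2
  let s (i : ℕ) : A := Nat.rec c (fun i x => f (n + i) x) i
  have hs (i : ℕ) : s i ∈ stage p T (n + i) := by
    induction i with
    | zero => exact hc
    | succ i ih => exact hf _ _ ih
  have hs' (i j : ℕ) (hij : i ≤ j) : s i - s j ∈ maximalIdeal A ^ (n + i + 1) := by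
    induction j, hij using Nat.le_induction with
    | base => simp
    | succ j hij ih =>
      rw [← sub_add_sub_cancel _ (s j)]
      exact Ideal.add_mem _ ih (Ideal.pow_le_pow_right (by omega) (hfd _ _ (hs j)))
  obtain ⟨d, hd⟩ := IsPrecomplete.prec' (I := maximalIdeal A) (M := A) s fun {i j} hij => by
    rw [SModEq.sub_mem, smul_eq_mul, Ideal.mul_top]
    exact Ideal.pow_le_pow_right (by omega) (hs' i j hij)
  have hd' (i : ℕ) : s i - d ∈ maximalIdeal A ^ i := by
    have := hd i
    rwa [SModEq.sub_mem, smul_eq_mul, Ideal.mul_top] at this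
  have hd2 (i : ℕ) : s i - d ∈ maximalIdeal A ^ (n + i + 1) := by
    rw [← sub_add_sub_cancel _ (s (n + i + 1))]
    exact Ideal.add_mem _ (hs' i (n + i + 1) (by omega)) (hd' _)
  refine ⟨d, Subring.mem_iInf.2 fun i => ?_, hd2 0⟩
  have h1 := (coefStage p T hT1 hT2 (n + i)).pow_le _ (hd2 i)
  have h2 := Subring.sub_mem _ (hs i) h1
  rw [sub_sub_cancel] at h2
  exact stage_antitone p T hT1 hT2 (Nat.le_add_left i n) h2

theorem exists_mem_pow_of_mul_mem {A : Type u} [CommRing A] [IsNoetherianRing A] [IsDomain A]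
    (I : Ideal A) (a : A) (ha : a ≠ 0) :
    ∃ r, ∀ n x, a * x ∈ I ^ (n + r) → x ∈ I ^ n := by
  obtain ⟨r, hr⟩ := Ideal.exists_pow_inf_eq_pow_smul I (Ideal.span {a})
  refine ⟨r, fun n x hx => ?_⟩
  have h1 := hr (n + r) (Nat.le_add_left _ _)
  have h2 : a * x ∈ (I ^ (n + r) • ⊤ ⊓ Ideal.span {a} : Ideal A) :=
    ⟨by rwa [smul_eq_mul, Ideal.mul_top], Ideal.mem_span_singleton.2 ⟨x, rfl⟩⟩
  rw [h1, Nat.add_sub_cancel, smul_eq_mul] at h2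
  have h3 := Ideal.mul_mono_right inf_le_right h2
  rw [mul_comm, Ideal.mem_span_singleton_mul] at h3
  obtain ⟨z, hz, h⟩ := h3
  rwa [← mul_left_cancel₀ ha h]

include hT1 hT2 in
theorem exists_eq_mul_of_mem_iInf_stage [IsNoetherianRing A] [IsDomain A]
    [IsAdicComplete (maximalIdeal A) A] (c : A) (hc : c ∈ (⨅ n, stage p T n : Subring A))
    (hcm : c ∈ maximalIdeal A) : ∃ d ∈ (⨅ n, stage p T n : Subring A), c = p * d := by
  have hsep (x : A) (hx : ∀ n, x ∈ maximalIdeal A ^ n) : x = 0 :=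
    IsHausdorff.haus' (I := maximalIdeal A) x fun n => by
      rw [SModEq.zero, smul_eq_mul, Ideal.mul_top]; exact hx n
  have h1 (n : ℕ) : ∃ d ∈ (⨅ n, stage p T n : Subring A), c - p * d ∈ maximalIdeal A ^ (n + 1) := by
    obtain ⟨y, hy, hyc⟩ := (coefStage p T hT1 hT2 n).inf c (Subring.mem_iInf.1 hc n) hcm
    obtain ⟨d, hd, hyd⟩ := exists_mem_iInf_stage p T hT1 hT2 n y hy
    refine ⟨d, hd, ?_⟩
    have : c - p * d = (c - p * y) + p * (y - d) := by ring
    rw [this]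
    exact Ideal.add_mem _ hyc (Ideal.mul_mem_left _ _ hyd)
  rcases eq_or_ne (p : A) 0 with h0 | h0
  · refine ⟨0, Subring.zero_mem _, ?_⟩
    rw [mul_zero]
    refine hsep c fun n => ?_
    obtain ⟨d, -, hd⟩ := h1 n
    rw [h0, zero_mul, sub_zero] at hd
    exact Ideal.pow_le_pow_right n.le_succ hd
  · obtain ⟨r, hr⟩ := exists_mem_pow_of_mul_mem (maximalIdeal A) (p : A) h0
    choose d hd hcd using fun n => h1 (n + r)
    have hs' (i j : ℕ) (hij : i ≤ j) : d i - d j ∈ maximalIdeal A ^ (i + 1) := by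
      refine hr (i + 1) _ ?_
      have : p * (d i - d j) = (c - p * d j) - (c - p * d i) := by ring
      rw [this]
      exact Ideal.sub_mem _ (Ideal.pow_le_pow_right (by omega) (hcd j))
        (Ideal.pow_le_pow_right (by omega) (hcd i))
    obtain ⟨e, he⟩ := IsPrecomplete.prec' (I := maximalIdeal A) (M := A) d fun {i j} hij => by
      rw [SModEq.sub_mem, smul_eq_mul, Ideal.mul_top]
      exact Ideal.pow_le_pow_right (by omega) (hs' i j hij)
    have he' (i : ℕ) : d i - e ∈ maximalIdeal A ^ i := by
      have := he i
      rwa [SModEq.sub_mem, smul_eq_mul, Ideal.mul_top] at this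
    refine ⟨e, Subring.mem_iInf.2 fun i => ?_, sub_eq_zero.1 (hsep _ fun n => ?_)⟩
    · have h2 := (coefStage p T hT1 hT2 i).pow_le _ (he' (i + 1))
      have h3 := Subring.sub_mem _ (Subring.mem_iInf.1 (hd (i + 1)) i) h2
      rwa [sub_sub_cancel] at h3
    · have : c - p * e = (c - p * d n) + p * (d n - e) := by ring
      rw [this]
      exact Ideal.add_mem _ (Ideal.pow_le_pow_right (by omega) (hcd n))
        (Ideal.mul_mem_left _ _ (he' n))

omit [CharP (ResidueField A) p] in
/-- A complete local Noetherian domain with residue characteristic `p` contains a coefficient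
ring. -/
theorem exists_coefficient_subring (A : Type u) [CommRing A] [IsLocalRing A] [IsNoetherianRing A]
    [IsDomain A] [IsAdicComplete (maximalIdeal A) A] [CharP (ResidueField A) p] :
    ∃ C : Subring A, (∀ x, ∃ c ∈ C, x - c ∈ maximalIdeal A) ∧
      ∀ c ∈ C, c ∈ maximalIdeal A → ∃ d ∈ C, c = p * d := by
  obtain ⟨d, h1, h2⟩ := exists_pder_of_field (ResidueField A) p
  choose T hT using fun i => residue_surjective (d.y i)
  have hT' : (fun i => residue A (T i)) = d.y := funext hT
  rw [← hT'] at h1 h2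
  refine ⟨⨅ n, stage p T n, fun x => ?_, exists_eq_mul_of_mem_iInf_stage p T h1 h2⟩
  obtain ⟨c, hc, h⟩ := exists_mem_iInf_stage p T h1 h2 0 x (Subring.mem_top _)
  exact ⟨c, hc, by simpa using h⟩

end CoefRing

section Normalization
open TensorProduct IsLocalRing

theorem exists_finset_span_of_residue {R A : Type u} [CommRing R] [CommRing A] [Algebra R A]
    [IsLocalRing A] [IsNoetherianRing A]
    (hs : ∀ a : A, ∃ r : R, a - algebraMap R A r ∈ maximalIdeal A) (n : ℕ) :
    ∃ s : Finset A, ∀ a, ∃ x ∈ Submodule.span R (s : Set A), a - x ∈ maximalIdeal A ^ n := by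
  classical
  induction n with
  | zero => exact ⟨∅, fun a => ⟨0, Submodule.zero_mem _, by simp⟩⟩
  | succ n ih =>
    obtain ⟨s, hs'⟩ := ih
    obtain ⟨t, ht⟩ := (isNoetherianRing_iff_ideal_fg A).1 inferInstance (maximalIdeal A ^ n)
    have key : ∀ b ∈ maximalIdeal A ^ n, ∃ x ∈ Submodule.span R (t : Set A),
        b - x ∈ maximalIdeal A ^ (n + 1) := by
      intro b hb
      rw [← ht] at hb
      induction hb using Submodule.span_induction with
      | mem x hx => exact ⟨x, Submodule.subset_span hx, by simp⟩
      | zero => exact ⟨0, Submodule.zero_mem _, by simp⟩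
      | add x y _ _ hx hy =>
        obtain ⟨x', h1, h2⟩ := hx
        obtain ⟨y', h3, h4⟩ := hy
        exact ⟨x' + y', add_mem h1 h3, by rw [add_sub_add_comm]; exact add_mem h2 h4⟩
      | smul a x hx' hx =>
        obtain ⟨x', h1, h2⟩ := hx
        obtain ⟨r, hr⟩ := hs a
        refine ⟨r • x', Submodule.smul_mem _ r h1, ?_⟩
        have h3 : (a - algebraMap R A r) * x ∈ maximalIdeal A ^ (n + 1) := by
          rw [pow_succ']
          exact Ideal.mul_mem_mul hr (ht ▸ hx')
        have h4 := add_mem h3 (Ideal.mul_mem_left _ (algebraMap R A r) h2)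
        rw [Algebra.smul_def r, smul_eq_mul]
        convert h4 using 1; ring
    refine ⟨s ∪ t, fun a => ?_⟩
    obtain ⟨x, hx, hx'⟩ := hs' a
    obtain ⟨y, hy, hy'⟩ := key _ hx'
    refine ⟨x + y, ?_, by rwa [← sub_sub]⟩
    rw [Finset.coe_union, Submodule.span_union]
    exact add_mem (Submodule.mem_sup_left hx) (Submodule.mem_sup_right hy)

/-- A local ring whose closed fibre over a complete local ring is finite is itself finite. -/
theorem finite_of_isAdicComplete {R A : Type u} [CommRing R] [IsLocalRing R] [IsNoetherianRing R]
    [IsAdicComplete (maximalIdeal R) R] [CommRing A] [Algebra R A] [IsLocalRing A]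
    [IsNoetherianRing A] (hm : (maximalIdeal R).map (algebraMap R A) ≤ maximalIdeal A)
    (hs : ∀ a : A, ∃ r : R, a - algebraMap R A r ∈ maximalIdeal A) (N : ℕ)
    (hN : maximalIdeal A ^ N ≤ (maximalIdeal R).map (algebraMap R A)) : Module.Finite R A := by
  obtain ⟨s, hs'⟩ := exists_finset_span_of_residue hs N
  have : IsHausdorff (maximalIdeal R) A := by
    refine ⟨fun x hx => IsHausdorff.haus' (I := maximalIdeal A) x fun n => ?_⟩
    have := hx n
    rw [SModEq.zero, Ideal.smul_top_eq_map] at this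
    rw [SModEq.zero, smul_eq_mul, Ideal.mul_top]
    have h2 : x ∈ (maximalIdeal R ^ n).map (algebraMap R A) := this
    rw [Ideal.map_pow] at h2
    exact Ideal.pow_right_mono hm n h2
  have : IsAdicComplete (maximalIdeal R) (s → R) := isAdicComplete_of_finite _
  let f : (s → R) →ₗ[R] A := Fintype.linearCombination R (fun i : s => (i : A))
  have hf : Function.Surjective f := by
    refine surjective_of_mkQ_comp_surjective (I := maximalIdeal R) fun a => ?_
    obtain ⟨a, rfl⟩ := Submodule.mkQ_surjective _ a
    obtain ⟨x, hx, hx'⟩ := hs' a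
    have : x ∈ LinearMap.range f := by
      rw [Fintype.range_linearCombination]; simpa using hx
    obtain ⟨c, rfl⟩ := this
    refine ⟨c, ?_⟩
    rw [LinearMap.comp_apply, Submodule.mkQ_apply, Submodule.mkQ_apply, Eq.comm,
      Submodule.Quotient.eq, Ideal.smul_top_eq_map]
    exact hN hx'
  exact Module.Finite.of_surjective f hf

/-- A local ring with few generators of its maximal ideal over which a domain is finite. -/
theorem isRegularLocalRing_of_finite_domain {R A : Type u} [CommRing R] [IsLocalRing R]
    [IsNoetherianRing R] [CommRing A] [IsDomain A] [Algebra R A] [Module.Finite R A]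
    (s : Finset R) (hs : Ideal.span (s : Set R) = maximalIdeal R)
    (h : (s.card : WithBot ℕ∞) ≤ ringKrullDim A) :
    IsRegularLocalRing R ∧ Function.Injective (algebraMap R A) := by
  let K := RingHom.ker (algebraMap R A)
  have hK : K.IsPrime := RingHom.ker_isPrime _
  let _ : Algebra (R ⧸ K) A := (RingHom.kerLift (algebraMap R A)).toAlgebra
  have : IsScalarTower R (R ⧸ K) A := .of_algebraMap_eq fun r => rfl
  have : Algebra.IsIntegral (R ⧸ K) A := by
    have := Module.Finite.of_restrictScalars_finite R (R ⧸ K) A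
    infer_instance
  have : FaithfulSMul (R ⧸ K) A :=
    (faithfulSMul_iff_algebraMap_injective _ _).2 (RingHom.kerLift_injective _)
  have hd : ringKrullDim A ≤ ringKrullDim (R ⧸ K) :=
    Order.krullDim_le_of_strictMono (PrimeSpectrum.comap (algebraMap (R ⧸ K) A)) fun P Q h =>
      Ideal.IsIntegral.comap_lt_comap h
  have h1 : ringKrullDim (R ⧸ K) ≤ ringKrullDim R := ringKrullDim_quotient_le K
  have hR := isRegularLocalRing_of_span s hs (h.trans (hd.trans h1))
  refine ⟨hR, (RingHom.injective_iff_ker_eq_bot _).2 ?_⟩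
  have := isDomain_of_isRegularLocalRing R
  by_contra hne
  obtain ⟨x, hx, hx0⟩ := Submodule.exists_mem_ne_zero_of_ne_bot hne
  have h2 : ringKrullDim (R ⧸ K) + 1 ≤ ringKrullDim R := by
    refine le_trans ?_ (ringKrullDim_quotient_succ_le_of_nonZeroDivisor
      (mem_nonZeroDivisors_of_ne_zero hx0))
    gcongr
    exact ringKrullDim_le_of_surjective (Ideal.Quotient.factor
      ((Ideal.span_singleton_le_iff_mem _).2 hx)) (Ideal.Quotient.factor_surjective _)
  have h3 : ringKrullDim R ≤ s.card := by
    refine (ringKrullDim_le_spanFinrank_maximalIdeal R).trans ?_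
    rw [← hs]
    have := Submodule.spanFinrank_span_le_ncard_of_finite (R := R) s.finite_toSet
    rw [Set.ncard_coe_finset] at this
    exact_mod_cast this
  obtain ⟨n, hn⟩ := exists_ringKrullDim_eq_nat R
  rw [hn] at h2 h3
  have h4 : (s.card : WithBot ℕ∞) ≤ ringKrullDim (R ⧸ K) := h.trans hd
  have h5 : (s.card : WithBot ℕ∞) + 1 ≤ n := le_trans (by gcongr) h2
  have h6 : s.card + 1 ≤ n := by exact_mod_cast h5
  have h7 : n ≤ s.card := by exact_mod_cast h3
  omega

theorem exists_parameters (A : Type u) [CommRing A] [IsLocalRing A] [IsNoetherianRing A] :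
    ∃ (d N : ℕ) (y : Fin d → A), (d : WithBot ℕ∞) = ringKrullDim A ∧
      (∀ i, y i ∈ maximalIdeal A) ∧ maximalIdeal A ^ N ≤ Ideal.span (Set.range y) := by
  obtain ⟨s, hs, hc⟩ := (maximalIdeal A).exists_finset_card_eq_height_of_isNoetherianRing
  have h1 : (Ideal.span (s : Set A)).radical = maximalIdeal A := by
    rw [Ideal.radical_eq_sInf]
    refine le_antisymm (sInf_le ⟨hs.1.2, inferInstance⟩) (le_sInf fun J hJ => ?_)
    exact hs.2 ⟨hJ.2, hJ.1⟩ (le_maximalIdeal hJ.2.ne_top)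
  obtain ⟨N, hN⟩ := Ideal.exists_pow_le_of_le_radical_of_fg h1.ge
    ((isNoetherianRing_iff_ideal_fg A).1 inferInstance _)
  have hr : Set.range (fun i => (s.equivFin.symm i : A)) = s := by
    ext x; simp only [Set.mem_range, Finset.mem_coe]
    exact ⟨by rintro ⟨i, rfl⟩; exact (s.equivFin.symm i).2, fun hx => ⟨s.equivFin ⟨x, hx⟩, by simp⟩⟩
  refine ⟨s.card, N, fun i => s.equivFin.symm i, ?_, fun i => ?_, hr ▸ hN⟩
  · rw [← IsLocalRing.maximalIdeal_height_eq_ringKrullDim, ← hc]; rfl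
  · exact hs.1.2 (Ideal.subset_span (s.equivFin.symm i).2)

theorem exists_parameters_of_ne_zero (A : Type u) [CommRing A] [IsLocalRing A] [IsNoetherianRing A]
    [IsDomain A] (x : A) (hx : x ∈ maximalIdeal A) (hx0 : x ≠ 0) :
    ∃ (d N : ℕ) (y : Fin d → A), ((d + 1 : ℕ) : WithBot ℕ∞) = ringKrullDim A ∧
      (∀ i, y i ∈ maximalIdeal A) ∧
      maximalIdeal A ^ N ≤ Ideal.span (insert x (Set.range y)) := by
  have : IsLocalRing (A ⧸ Ideal.span {x}) := isLocalRing_quotient (by simpa [Ideal.span_le])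
  obtain ⟨d, N, y, h1, h2, h3⟩ := exists_parameters (A ⧸ Ideal.span {x})
  choose z hz using fun i => Ideal.Quotient.mk_surjective (y i)
  obtain rfl : (fun i => Ideal.Quotient.mk _ (z i)) = y := funext hz
  have hcm : (maximalIdeal (A ⧸ Ideal.span {x})).comap (Ideal.Quotient.mk (Ideal.span {x})) =
      maximalIdeal A := by
    rw [← map_maximalIdeal_quotient, Ideal.comap_map_of_surjective _ Ideal.Quotient.mk_surjective,
      sup_eq_left, ← RingHom.ker_eq_comap_bot, Ideal.mk_ker]
    simpa [Ideal.span_le]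
  refine ⟨d, N, z, ?_, fun i => ?_, ?_⟩
  · rw [Nat.cast_add, Nat.cast_one, h1]
    exact ringKrullDim_quotient_span_singleton_succ_eq_ringKrullDim
      (isSMulRegular_of_isDomain hx0) hx
  · rw [← hcm]; exact h2 i
  · rw [← map_maximalIdeal_quotient, ← Ideal.map_pow, Ideal.map_le_iff_le_comap] at h3
    refine h3.trans ?_
    have : Ideal.span (Set.range fun i => Ideal.Quotient.mk (Ideal.span {x}) (z i)) =
        (Ideal.span (Set.range z)).map (Ideal.Quotient.mk (Ideal.span {x})) := by
      rw [Ideal.map_span, ← Set.range_comp]; rfl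
    rw [this, Ideal.comap_map_of_surjective _ Ideal.Quotient.mk_surjective,
      ← RingHom.ker_eq_comap_bot, Ideal.mk_ker, Ideal.span_insert, sup_comm]

theorem mvPowerSeries_maximalIdeal {L : Type u} [CommRing L] [IsLocalRing L] (t : L)
    (ht : maximalIdeal L = Ideal.span {t}) (σ : Type u) [Finite σ] :
    maximalIdeal (MvPowerSeries σ L) = Ideal.span (insert (MvPowerSeries.C t)
      (Set.range MvPowerSeries.X)) := by
  refine le_antisymm (fun f hf => ?_) ?_
  · obtain ⟨d, hd⟩ := mvPowerSeries_dense 1 f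
    have hX : (MvPolynomial.idealOfVars σ L ^ 1).map (algebraMap _ (MvPowerSeries σ L)) ≤
        Ideal.span (Set.range MvPowerSeries.X) := by
      rw [pow_one, MvPolynomial.idealOfVars, Ideal.map_span, ← Set.range_comp]
      refine Ideal.span_mono ?_
      rintro _ ⟨i, rfl⟩
      exact ⟨i, (MvPolynomial.coe_X i).symm⟩
    have hX' : Ideal.span (Set.range (MvPowerSeries.X : σ → MvPowerSeries σ L)) ≤
        RingHom.ker MvPowerSeries.constantCoeff := by
      rw [Ideal.span_le]; rintro _ ⟨i, rfl⟩
      exact MvPowerSeries.constantCoeff_X i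
    have h1 : f - MvPowerSeries.C (MvPowerSeries.constantCoeff f) ∈
        Ideal.span (Set.range (MvPowerSeries.X : σ → MvPowerSeries σ L)) := by
      have h2 : d - MvPolynomial.C (MvPolynomial.constantCoeff d) ∈ MvPolynomial.idealOfVars σ L := by
        rw [← pow_one (MvPolynomial.idealOfVars σ L), MvPolynomial.mem_pow_idealOfVars_iff']
        intro x hx
        obtain rfl : x = 0 := (Finsupp.degree_eq_zero_iff x).1 (by simpa using hx)
        simp [MvPolynomial.constantCoeff_eq]
      have h3 := hX (by
        rw [pow_one]
        exact Ideal.mem_map_of_mem (algebraMap _ (MvPowerSeries σ L)) h2)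
      have h4 := add_mem (hX hd) h3
      have h5 := hX' h4
      rw [map_sub] at h4
      have e : algebraMap (MvPolynomial σ L) (MvPowerSeries σ L)
          (MvPolynomial.C (MvPolynomial.constantCoeff d)) =
          MvPowerSeries.C (MvPolynomial.constantCoeff d) := MvPolynomial.coe_C _
      rw [sub_add_sub_cancel, e] at h4
      rw [RingHom.mem_ker, map_sub, sub_add_sub_cancel, e, map_sub,
        MvPowerSeries.constantCoeff_C, sub_eq_zero] at h5
      rwa [h5]
    have h2 : MvPowerSeries.constantCoeff f ∈ maximalIdeal L := by
      rw [mem_maximalIdeal, mem_nonunits_iff] at hf ⊢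
      rwa [MvPowerSeries.isUnit_iff_constantCoeff] at hf
    rw [ht, Ideal.mem_span_singleton] at h2
    obtain ⟨c, hc⟩ := h2
    rw [Ideal.span_insert, ← sub_add_cancel f (MvPowerSeries.C (MvPowerSeries.constantCoeff f))]
    refine add_mem (Submodule.mem_sup_right h1) (Submodule.mem_sup_left ?_)
    rw [hc, map_mul]
    exact Ideal.mul_mem_right _ _ (Ideal.mem_span_singleton_self _)
  · rw [Ideal.span_le]
    rintro _ (rfl | ⟨i, rfl⟩)
    · rw [SetLike.mem_coe, mem_maximalIdeal, mem_nonunits_iff,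
        MvPowerSeries.isUnit_iff_constantCoeff, MvPowerSeries.constantCoeff_C, ← mem_nonunits_iff,
        ← mem_maximalIdeal, ht]
      exact Ideal.mem_span_singleton_self t
    · rw [SetLike.mem_coe, mem_maximalIdeal, mem_nonunits_iff,
        MvPowerSeries.isUnit_iff_constantCoeff, MvPowerSeries.constantCoeff_X]
      exact not_isUnit_zero

theorem isNoetherianRing_mvPowerSeries {L : Type u} [CommRing L] [IsNoetherianRing L]
    (σ : Type u) [Finite σ] : IsNoetherianRing (MvPowerSeries σ L) :=
  have := isNoetherianRing_adicCompletion (MvPolynomial.idealOfVars σ L)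
  isNoetherianRing_of_ringEquiv _ (MvPowerSeries.toAdicCompletionAlgEquiv σ L).toRingEquiv.symm

end Normalization

section Normalization
open TensorProduct IsLocalRing

theorem exists_residueField_section (A : Type u) [CommRing A] [IsLocalRing A]
    [IsAdicComplete (maximalIdeal A) A] [CharZero (ResidueField A)] :
    ∃ ψ : ResidueField A →+* A, ∀ a, residue A (ψ a) = a := by
  have hu (n : nonZeroDivisors ℤ) : IsUnit (Int.castRingHom A n) := by
    by_contra h
    have h1 : ((n : ℤ) : A) ∈ maximalIdeal A := h
    rw [← residue_eq_zero_iff, map_intCast, Int.cast_eq_zero] at h1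
    exact nonZeroDivisors.coe_ne_zero n h1
  let _ : Algebra ℚ A := (IsLocalization.lift (S := ℚ) hu).toAlgebra
  let _ : Algebra ℚ (ResidueField A) := ((residue A).comp (algebraMap ℚ A)).toAlgebra
  have : Algebra.FormallySmooth ℚ (ResidueField A) := by
    obtain ⟨s, hs⟩ := exists_isTranscendenceBasis ℚ (ResidueField A)
    have h1 := hs.isAlgebraic_field
    have : Algebra.IsSeparable
        (IntermediateField.adjoin ℚ (Set.range ((↑) : s → ResidueField A))) (ResidueField A) :=
      inferInstance
    exact .of_algebraicIndependent_of_isSeparable hs.1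
  let f : ResidueField A →ₐ[ℚ] A ⧸ maximalIdeal A :=
    { RingHom.id (ResidueField A) with commutes' := fun r => rfl }
  obtain ⟨g, hg⟩ := Algebra.FormallySmooth.exists_mkₐ_comp_eq_of_isAdicComplete f
  exact ⟨g, fun a => DFunLike.congr_fun hg a⟩

variable {A : Type u} [CommRing A] [IsLocalRing A] [IsNoetherianRing A] [IsDomain A]
  [IsAdicComplete (maximalIdeal A) A]

theorem exists_normalization_of_section {K : Type u} [Field K] (ψ : K →+* A)
    (hψ : ∀ a : A, ∃ c, a - ψ c ∈ maximalIdeal A) :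
    ∃ (σ : Type u) (_ : Finite σ) (φ : MvPowerSeries σ K →+* A),
      IsRegularLocalRing (MvPowerSeries σ K) ∧ φ.Finite ∧ Function.Injective φ := by
  classical
  obtain ⟨d, N, y, hd, hy, hN⟩ := exists_parameters A
  obtain ⟨Φ, h1, h2⟩ := exists_mvPowerSeries_lift (maximalIdeal A) ψ
    (fun i : ULift.{u} (Fin d) => y i.down) (fun i => hy i.down)
  have hmax : maximalIdeal (MvPowerSeries (ULift.{u} (Fin d)) K) =
      Ideal.span (Set.range MvPowerSeries.X) := by
    rw [mvPowerSeries_maximalIdeal 0 (by rw [maximalIdeal_eq_bot, Ideal.span_singleton_eq_bot.2 rfl]), map_zero,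
      Ideal.span_insert_zero]
  have := isNoetherianRing_mvPowerSeries (L := K) (ULift.{u} (Fin d))
  have : IsAdicComplete (maximalIdeal (MvPowerSeries (ULift.{u} (Fin d)) K))
      (MvPowerSeries (ULift.{u} (Fin d)) K) := by
    rw [hmax]; infer_instance
  algebraize [Φ]
  have hmap : (maximalIdeal (MvPowerSeries (ULift.{u} (Fin d)) K)).map Φ =
      Ideal.span (Set.range y) := by
    rw [hmax, Ideal.map_span, ← Set.range_comp]
    congr 1
    ext x
    constructor
    · rintro ⟨i, rfl⟩; exact ⟨i.down, (h2 i).symm⟩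
    · rintro ⟨i, rfl⟩; exact ⟨⟨i⟩, h2 ⟨i⟩⟩
  have hfin : Module.Finite (MvPowerSeries (ULift.{u} (Fin d)) K) A := by
    refine finite_of_isAdicComplete ?_ (fun a => ?_) N ?_
    · rw [RingHom.algebraMap_toAlgebra, hmap, Ideal.span_le]
      rintro _ ⟨i, rfl⟩; exact hy i
    · obtain ⟨c, hc⟩ := hψ a
      exact ⟨MvPowerSeries.C c, by rw [RingHom.algebraMap_toAlgebra, h1]; exact hc⟩
    · rwa [RingHom.algebraMap_toAlgebra, hmap]
  obtain ⟨h3, h4⟩ := isRegularLocalRing_of_finite_domain (A := A)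
    (Finset.univ.image (MvPowerSeries.X : ULift.{u} (Fin d) → MvPowerSeries _ K))
    (by rw [hmax]; simp) (by
      rw [← hd]
      refine Nat.cast_le.2 (Finset.card_image_le.trans ?_)
      simp)
  exact ⟨ULift.{u} (Fin d), inferInstance, Φ, h3, hfin, h4⟩

theorem exists_normalization_of_isCompl {D E : Type u} [CommRing D] [IsLocalRing D]
    [CommRing E] [IsLocalRing E] [Algebra D E] (hE : IsCompl D E)
    (Φ : D →+* A) (s : Finset D)
    (hs : Ideal.span (s : Set D) = maximalIdeal D)
    (hd : (s.card : WithBot ℕ∞) ≤ ringKrullDim A)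
    (hle : (maximalIdeal D).map Φ ≤ maximalIdeal A) (N : ℕ)
    (hN : maximalIdeal A ^ N ≤ (maximalIdeal D).map Φ)
    (hres : ∀ a : A, ∃ r, a - Φ r ∈ maximalIdeal A) :
    ∃ φ : E →+* A, IsRegularLocalRing E ∧ φ.Finite ∧ Function.Injective φ := by
  classical
  have := hE.flat
  have := hE.noeth
  have := hE.complete
  have := isLocalHom_of_map_max hE.map_max
  obtain ⟨φ, hφ⟩ := exists_lift_of_dense (maximalIdeal D) (dense_of_map_max hE.map_max hE.surj)
    (fun n => comap_map_of_flat _) (maximalIdeal A) Φ (fun n => by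
      refine (Ideal.pow_le_pow_right (Nat.le_succ n)).trans ?_
      rw [← Ideal.map_le_iff_le_comap, Ideal.map_pow]
      exact Ideal.pow_right_mono hle n)
  have hmap : (maximalIdeal E).map φ = (maximalIdeal D).map Φ := by
    rw [← hE.map_max, Ideal.map_map, hφ]
  algebraize [φ]
  have hfin : Module.Finite E A := by
    refine finite_of_isAdicComplete ?_ (fun a => ?_) N ?_
    · rwa [RingHom.algebraMap_toAlgebra, hmap]
    · obtain ⟨c, hc⟩ := hres a
      exact ⟨algebraMap D E c, by rwa [RingHom.algebraMap_toAlgebra, ← RingHom.comp_apply, hφ]⟩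
    · rwa [RingHom.algebraMap_toAlgebra, hmap]
  obtain ⟨h3, h4⟩ := isRegularLocalRing_of_finite_domain (A := A) (s.image (algebraMap D E))
    (by rw [Finset.coe_image, ← Ideal.map_span, hs, hE.map_max])
    ((Nat.cast_le.2 Finset.card_image_le).trans hd)
  exact ⟨φ, h3, hfin, h4⟩

theorem exists_normalization_of_dvr {L : Type u} [CommRing L] [IsLocalRing L] [IsNoetherianRing L]
    (ψ : L →+* A) (t : L) (ht : maximalIdeal L = Ideal.span {t}) (htA : ψ t ∈ maximalIdeal A)
    (ht0 : ψ t ≠ 0) (hψ : ∀ a : A, ∃ c, a - ψ c ∈ maximalIdeal A) :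
    ∃ (R : Type u) (_ : CommRing R) (φ : R →+* A),
      IsRegularLocalRing R ∧ φ.Finite ∧ Function.Injective φ := by
  classical
  obtain ⟨d, N, y, hd, hy, hN⟩ := exists_parameters_of_ne_zero A (ψ t) htA ht0
  obtain ⟨Φ, h1, h2⟩ := exists_mvPowerSeries_lift (maximalIdeal A) ψ
    (fun i : ULift.{u} (Fin d) => y i.down) (fun i => hy i.down)
  have := isNoetherianRing_mvPowerSeries (L := L) (ULift.{u} (Fin d))
  have hmax := mvPowerSeries_maximalIdeal t ht (ULift.{u} (Fin d))
  set s : Finset (MvPowerSeries (ULift.{u} (Fin d)) L) :=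
    insert (MvPowerSeries.C t) (Finset.univ.image MvPowerSeries.X) with hs
  have hsc : s.card ≤ d + 1 := by
    refine (Finset.card_insert_le _ _).trans (Nat.succ_le_succ (Finset.card_image_le.trans ?_))
    simp
  have hspan : Ideal.span (s : Set (MvPowerSeries (ULift.{u} (Fin d)) L)) = maximalIdeal _ := by
    rw [hmax, hs]; simp
  clear_value s
  have hmap : (maximalIdeal (MvPowerSeries (ULift.{u} (Fin d)) L)).map Φ =
      Ideal.span (insert (ψ t) (Set.range y)) := by
    rw [hmax, Ideal.map_span, Set.image_insert_eq, h1, ← Set.range_comp]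
    congr 2
    ext x
    constructor
    · rintro ⟨i, rfl⟩; exact ⟨i.down, (h2 i).symm⟩
    · rintro ⟨i, rfl⟩; exact ⟨⟨i⟩, h2 ⟨i⟩⟩
  have hle : (maximalIdeal (MvPowerSeries (ULift.{u} (Fin d)) L)).map Φ ≤ maximalIdeal A := by
    rw [hmap, Ideal.span_le, Set.insert_subset_iff]
    refine ⟨htA, ?_⟩
    rintro _ ⟨i, rfl⟩; exact hy i
  have hres (a : A) : ∃ r, a - Φ r ∈ maximalIdeal A := by
    obtain ⟨c, hc⟩ := hψ a
    exact ⟨MvPowerSeries.C c, by rwa [h1]⟩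
  rw [← hmap] at hN
  obtain ⟨φ, h⟩ := exists_normalization_of_isCompl (IsCompl.adicCompletion _) Φ s hspan
    ((Nat.cast_le.2 hsc).trans hd.le) hle N hN hres
  exact ⟨_, inferInstance, φ, h⟩

omit [IsAdicComplete (maximalIdeal A) A] in
theorem isNoetherianRing_of_maximalIdeal_eq_span {L : Type u} [CommRing L] [IsLocalRing L]
    (ψ : L →+* A) (hψ : Function.Injective ψ) (t : L) (ht : maximalIdeal L = Ideal.span {t})
    (htA : ψ t ∈ maximalIdeal A) : IsNoetherianRing L := by
  refine IsNoetherianRing.of_prime fun Q hQ => ?_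
  by_cases h : t ∈ Q
  · have : Q = maximalIdeal L := le_antisymm (le_maximalIdeal hQ.ne_top)
      (ht ▸ (Ideal.span_singleton_le_iff_mem _).2 h)
    rw [this, ht]
    exact Submodule.fg_span_singleton t
  · have key (n : ℕ) : ∀ x ∈ Q, ψ x ∈ maximalIdeal A ^ n := by
      induction n with
      | zero => simp
      | succ n ih =>
        intro x hx
        obtain ⟨c, rfl⟩ := Ideal.mem_span_singleton.1 (ht ▸ le_maximalIdeal hQ.ne_top hx)
        rw [map_mul, pow_succ']
        exact Ideal.mul_mem_mul htA (ih c ((hQ.mem_or_mem hx).resolve_left h))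
    have : Q = ⊥ := (Submodule.eq_bot_iff _).2 fun x hx => by
      rw [← map_eq_zero_iff ψ hψ]
      have h1 := Ideal.iInf_pow_eq_bot_of_isDomain (maximalIdeal A) (maximalIdeal.isMaximal A).ne_top
      rw [← Submodule.mem_bot A, ← h1]
      exact (Submodule.mem_iInf _).2 fun n => key n x hx
    rw [this]
    exact Submodule.fg_bot

/-- A complete local Noetherian domain is finite over a regular local domain. -/
theorem exists_normalization (A : Type u) [CommRing A] [IsLocalRing A] [IsNoetherianRing A]
    [IsDomain A] [IsAdicComplete (maximalIdeal A) A] :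
    ∃ (R : Type u) (_ : CommRing R) (φ : R →+* A),
      IsRegularLocalRing R ∧ φ.Finite ∧ Function.Injective φ ∧
      (CharZero R ∨ ∃ p : ℕ, p.Prime ∧ CharP R p ∧ Nonempty (PDer p R)) := by
  obtain ⟨p, hp⟩ := CharP.exists (ResidueField A)
  rcases CharP.char_is_prime_or_zero (ResidueField A) p with hpp | rfl
  · have : Fact p.Prime := ⟨hpp⟩
    obtain ⟨C, hC1, hC2⟩ := exists_coefficient_subring p A
    rcases eq_or_ne (p : A) 0 with h0 | h0
    · have hbij : Function.Bijective ((residue A).comp C.subtype) := by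
        refine ⟨(injective_iff_map_eq_zero _).2 fun c hc => ?_, fun x => ?_⟩
        · obtain ⟨d, -, hd⟩ := hC2 c c.2 ((residue_eq_zero_iff _).1 hc)
          exact Subtype.ext (by rw [hd, h0, zero_mul]; rfl)
        · obtain ⟨a, rfl⟩ := residue_surjective x
          obtain ⟨c, hc, h⟩ := hC1 a
          refine ⟨⟨c, hc⟩, ?_⟩
          rw [← residue_eq_zero_iff, map_sub, sub_eq_zero] at h
          exact h.symm
      let e := RingEquiv.ofBijective _ hbij
      obtain ⟨σ, _, φ, h1, h2, h3⟩ := exists_normalization_of_section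
        (C.subtype.comp e.symm.toRingHom) (fun a => ⟨residue A a, by
          rw [← residue_eq_zero_iff, map_sub, sub_eq_zero]
          exact (e.apply_symm_apply (residue A a)).symm⟩)
      obtain ⟨d, -⟩ := exists_pder_of_field (ResidueField A) p
      have : CharP (MvPowerSeries σ (ResidueField A)) p :=
        charP_of_injective_ringHom (f := MvPowerSeries.C (σ := σ) (R := ResidueField A))
          MvPowerSeries.C_injective p
      exact ⟨_, inferInstance, φ, h1, h2, h3, Or.inr ⟨p, hpp, this, ⟨d.mvPowerSeries σ⟩⟩⟩
    · have hpm : (p : A) ∈ maximalIdeal A := natCast_mem_maximalIdeal p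
      let P : Ideal C := (maximalIdeal A).comap C.subtype
      have hu (c : P.primeCompl) : IsUnit (C.subtype c) := by
        have := c.2
        by_contra h
        exact this h
      let ψ : Localization.AtPrime P →+* A := IsLocalization.lift (M := P.primeCompl) hu
      have hψC (c : C) : ψ (algebraMap C _ c) = c := IsLocalization.lift_eq hu c
      have hψ : Function.Injective ψ := by
        rw [IsLocalization.lift_injective_iff]
        intro x y
        rw [(IsLocalization.injective (Localization.AtPrime P)
          P.primeCompl_le_nonZeroDivisors).eq_iff]
        exact Subtype.val_injective.eq_iff.symm
      have hmax : maximalIdeal (Localization.AtPrime P) = Ideal.span {(p : Localization.AtPrime P)} := by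
        rw [← IsLocalization.AtPrime.map_eq_maximalIdeal P (Localization.AtPrime P)]
        refine le_antisymm (Ideal.map_le_iff_le_comap.2 fun c hc => ?_) ?_
        · obtain ⟨d, hd, h⟩ := hC2 c c.2 hc
          obtain rfl : c = p * ⟨d, hd⟩ := Subtype.ext (by simpa using h)
          rw [Ideal.mem_comap, map_mul, map_natCast]
          exact Ideal.mul_mem_right _ _ (Ideal.mem_span_singleton_self _)
        · rw [Ideal.span_singleton_le_iff_mem, ← map_natCast (algebraMap C _)]
          exact Ideal.mem_map_of_mem _ (by simpa [P] using hpm)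
      have := isNoetherianRing_of_maximalIdeal_eq_span ψ hψ _ hmax (by rwa [map_natCast])
      obtain ⟨R, _, φ, h1, h2, h3⟩ := exists_normalization_of_dvr ψ _ hmax (by rwa [map_natCast])
        (by rwa [map_natCast]) (fun a => by
          obtain ⟨c, hc, h⟩ := hC1 a
          exact ⟨algebraMap C _ ⟨c, hc⟩, by rwa [hψC]⟩)
      refine ⟨R, _, φ, h1, h2, h3, Or.inl ?_⟩
      have hA : CharZero A := by
        obtain ⟨q, hq⟩ := CharP.exists A
        rcases CharP.char_is_prime_or_zero A q with hqp | rfl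
        · have h4 : (q : ResidueField A) = 0 := by
            rw [← map_natCast (residue A), CharP.cast_eq_zero, map_zero]
          rw [CharP.cast_eq_zero_iff _ p, (Nat.prime_dvd_prime_iff_eq hpp hqp)] at h4
          subst h4
          exact absurd (CharP.cast_eq_zero A p) h0
        · exact CharP.charP_to_charZero A
      exact ⟨fun m n h => Nat.cast_injective (R := A) (by simpa using congrArg φ h)⟩
  · have := CharP.charP_to_charZero (ResidueField A)
    obtain ⟨ψ, hψ⟩ := exists_residueField_section A
    obtain ⟨σ, _, φ, h1, h2, h3⟩ := exists_normalization_of_section ψ (fun a => ⟨residue A a, by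
      rw [← residue_eq_zero_iff, map_sub, hψ, sub_self]⟩)
    exact ⟨_, inferInstance, φ, h1, h2, h3, Or.inl (charZero_of_injective_ringHom
      (f := MvPowerSeries.C (σ := σ) (R := ResidueField A)) MvPowerSeries.C_injective)⟩

end Normalization

section CompleteFiniteType
open TensorProduct IsLocalRing

theorem exists_finite_isTranscendenceBasis (R B : Type u) [CommRing R] [IsDomain R] [CommRing B]
    [IsDomain B] [Algebra R B] [FaithfulSMul R B] [Algebra.FiniteType R B] :
    ∃ t : Set B, t.Finite ∧ IsTranscendenceBasis R ((↑) : t → B) := by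
  obtain ⟨s, hs⟩ := Algebra.FiniteType.out (R := R) (A := B)
  have : Algebra.IsAlgebraic (Algebra.adjoin R (s : Set B)) B :=
    ⟨fun x => isAlgebraic_algebraMap (⟨x, hs ▸ trivial⟩ : Algebra.adjoin R (s : Set B))⟩
  obtain ⟨t, ht, h⟩ := exists_isTranscendenceBasis_subset (R := R) (s : Set B)
  exact ⟨t, s.finite_toSet.subset ht, h⟩

theorem isGenReg_of_isRegularRing {R B : Type u} [CommRing R] [IsDomain R] [IsRegularRing R]
    [CommRing B] [IsDomain B] [Algebra R B] [FaithfulSMul R B] [Algebra.FiniteType R B]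
    (h : CharZero R ∨ ∃ p, p.Prime ∧ CharP R p ∧ Nonempty (PDer p R))
    (q : Ideal B) [q.IsPrime] : IsGenReg (Localization.AtPrime q) := by
  obtain ⟨t, ht, hb⟩ := exists_finite_isTranscendenceBasis R B
  have : Finite t := ht
  let φ : MvPolynomial t R →ₐ[R] B := MvPolynomial.aeval ((↑) : t → B)
  have hφ : Function.Injective φ := hb.1
  let _ : Algebra (MvPolynomial t R) B := φ.toRingHom.toAlgebra
  have hst : IsScalarTower R (MvPolynomial t R) B :=
    IsScalarTower.of_algebraMap_eq fun x => (φ.commutes x).symm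
  have : FaithfulSMul (MvPolynomial t R) B := (faithfulSMul_iff_algebraMap_injective _ _).2 hφ
  have : Algebra.FiniteType (MvPolynomial t R) B :=
    Algebra.FiniteType.of_restrictScalars_finiteType R (MvPolynomial t R) B
  have halg : Algebra.IsAlgebraic (MvPolynomial t R) B := by
    have := hb.isAlgebraic
    exact Algebra.IsAlgebraic.of_ringHom_of_comp_eq hb.1.aevalEquiv.toRingEquiv (RingHom.id B)
      (RingEquiv.surjective _) Function.injective_id
      (RingHom.ext fun x => hb.1.algebraMap_aevalEquiv x)
  rcases h with h | ⟨p, hp, hp', ⟨d⟩⟩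
  · exact isGenReg_of_charZero (A := MvPolynomial t R) q
  · have : Fact p.Prime := ⟨hp⟩
    exact isGenReg_of_pder (A := MvPolynomial t R) (d.mvPolynomial t) q

theorem isGenReg_of_isAdicComplete {A B : Type u} [CommRing A] [IsLocalRing A] [IsNoetherianRing A]
    [IsAdicComplete (maximalIdeal A) A] [CommRing B] [IsDomain B] [Algebra A B]
    [Algebra.FiniteType A B] (q : Ideal B) [q.IsPrime] : IsGenReg (Localization.AtPrime q) := by
  let I := RingHom.ker (algebraMap A B)
  have hI : I ≤ maximalIdeal A := le_maximalIdeal (RingHom.ker_ne_top _)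
  have := isLocalRing_quotient hI
  have h1 : IsAdicComplete (maximalIdeal A) (A ⧸ I) := isAdicComplete_of_finite _
  have h2 : IsAdicComplete (maximalIdeal (A ⧸ I)) (A ⧸ I) := by
    rw [← map_maximalIdeal_quotient]
    exact (IsAdicComplete.map_algebraMap_iff (maximalIdeal A) _).2 h1
  have : I.IsPrime := RingHom.ker_isPrime _
  obtain ⟨R, _, φ, hR, hf, hi, h⟩ := exists_normalization (A ⧸ I)
  have := isDomain_of_isRegularLocalRing R
  let ψ : A ⧸ I →+* B := RingHom.kerLift (algebraMap A B)
  have hψ : Function.Injective ψ := RingHom.kerLift_injective _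
  have hψf : ψ.FiniteType := by
    have h3 : (ψ.comp (Ideal.Quotient.mk I)).FiniteType := by
      have : ψ.comp (Ideal.Quotient.mk I) = algebraMap A B := by ext; rfl
      rw [this]
      exact RingHom.finiteType_algebraMap.2 inferInstance
    exact RingHom.FiniteType.of_comp_finiteType h3
  let _ : Algebra R B := (ψ.comp φ).toAlgebra
  have : FaithfulSMul R B := (faithfulSMul_iff_algebraMap_injective _ _).2 (hψ.comp hi)
  have : Algebra.FiniteType R B := RingHom.FiniteType.comp hψf hf.finiteType
  exact isGenReg_of_isRegularRing (R := R) h q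

end CompleteFiniteType

section FGFields
open TensorProduct IsLocalRing

theorem isRegularRing_of_formallyUnramified (A B : Type u) [CommRing A] [CommRing B] [Algebra A B]
    [IsRegularRing A] [Module.Flat A B] [Algebra.EssFiniteType A B]
    [Algebra.FormallyUnramified A B] : IsRegularRing B := by
  have := Algebra.EssFiniteType.isNoetherianRing A B
  rw [isRegularRing_iff]
  intro Q _
  let p := Q.under A
  let := Localization.AtPrime.algebraOfLiesOver p Q
  have : IsRegularLocalRing (Localization.AtPrime p) := isRegularRing_iff.1 ‹_› p
  have : Algebra.FormallyUnramified A (Localization.AtPrime Q) :=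
    Algebra.FormallyUnramified.comp A B _
  have : Algebra.FormallyUnramified (Localization.AtPrime p) (Localization.AtPrime Q) :=
    Algebra.FormallyUnramified.of_restrictScalars A _ _
  have : Algebra.EssFiniteType A (Localization.AtPrime Q) := Algebra.EssFiniteType.comp A B _
  have : Algebra.EssFiniteType (Localization.AtPrime p) (Localization.AtPrime Q) :=
    Algebra.EssFiniteType.of_comp A _ _
  refine isRegularLocalRing_of_flat_of_fibre (Localization.AtPrime p) _ ?_
  rw [Algebra.FormallyUnramified.map_maximalIdeal]
  have := isLocalRing_quotient (le_refl (maximalIdeal (Localization.AtPrime Q)))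
  have h : maximalIdeal (Localization.AtPrime Q ⧸ maximalIdeal (Localization.AtPrime Q)) = ⊥ := by
    rw [← map_maximalIdeal_quotient, Ideal.map_quotient_self]
  exact isRegularLocalRing_of_maximalIdeal_eq_bot h

theorem isRegularRing_of_faithfullyFlat (A B : Type u) [CommRing A] [CommRing B] [Algebra A B]
    [IsNoetherianRing A] [IsRegularRing B] [Module.FaithfullyFlat A B] : IsRegularRing A := by
  rw [isRegularRing_iff]
  intro p _
  obtain ⟨⟨Q, _⟩, hQ⟩ := PrimeSpectrum.comap_surjective_of_faithfullyFlat (A := A) (B := B) ⟨p, ‹_›⟩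
  have hQ : Q.comap (algebraMap A B) = p := congrArg PrimeSpectrum.asIdeal hQ
  have : Q.LiesOver p := ⟨hQ.symm⟩
  let := Localization.AtPrime.algebraOfLiesOver p Q
  have : IsRegularLocalRing (Localization.AtPrime Q) := isRegularRing_iff.1 ‹_› Q
  exact isRegularLocalRing_of_flat _ (Localization.AtPrime Q)

/-- Regularity is preserved by base change along separably generated field extensions. -/
theorem isRegularRing_tensor_of_separable {k M L F ι : Type u} [Field k] [Field M] [Field L]
    [Algebra k M] [Algebra k L] [Algebra M L] [IsScalarTower k M L] [Finite ι]
    [Algebra (MvPolynomial ι k) M] [IsScalarTower k (MvPolynomial ι k) M]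
    [IsFractionRing (MvPolynomial ι k) M] [Algebra.IsSeparable M L] [Algebra.EssFiniteType k L]
    [CommRing F] [Algebra k F] [IsRegularRing F] : IsRegularRing (L ⊗[k] F) := by
  let R := MvPolynomial ι k
  let : Algebra R L := ((algebraMap M L).comp (algebraMap R M)).toAlgebra
  have : IsScalarTower R M L := IsScalarTower.of_algebraMap_eq fun x => rfl
  have : IsScalarTower k R L := IsScalarTower.of_algebraMap_eq fun x => by
    rw [IsScalarTower.algebraMap_apply k M L, IsScalarTower.algebraMap_apply k R M]; rfl
  have : Algebra.FormallyUnramified M L := Algebra.FormallyUnramified.of_isSeparable M L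
  have : Algebra.FormallyUnramified R M :=
    Algebra.FormallyUnramified.of_isLocalization (nonZeroDivisors R)
  have : Algebra.FormallyUnramified R L := Algebra.FormallyUnramified.comp R M L
  have : Algebra.EssFiniteType R L := Algebra.EssFiniteType.of_comp k R L
  have : Module.Flat R M := IsLocalization.flat (R := R) M (nonZeroDivisors R)
  have : Module.Flat R L := Module.Flat.trans R M L
  have : IsRegularRing (F ⊗[k] R) :=
    IsRegularRing.of_ringEquiv (MvPolynomial.algebraTensorAlgEquiv (σ := ι) k F).symm.toRingEquiv
  let B := R ⊗[k] F
  have : IsRegularRing B := IsRegularRing.of_ringEquiv (Algebra.TensorProduct.comm k F R).toRingEquiv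
  have h : IsRegularRing (B ⊗[R] L) := isRegularRing_of_formallyUnramified B _
  have h1 : IsRegularRing (L ⊗[R] B) :=
    IsRegularRing.of_ringEquiv (R := B ⊗[R] L) (Algebra.TensorProduct.comm R B L).toRingEquiv
  exact IsRegularRing.of_ringEquiv
    (Algebra.TensorProduct.cancelBaseChange k R R L F).toRingEquiv

theorem isSeparable_of_coeff {E Ω : Type*} [Field E] [Field Ω] [Algebra E Ω] {x : Ω}
    (g : Polynomial Ω) (hg : g.Separable) (hc : ∀ n, g.coeff n ∈ Set.range (algebraMap E Ω))
    (h : g.eval x = 0) : IsSeparable E x := by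
  obtain ⟨f, rfl⟩ := (Polynomial.mem_lifts _).1 ((Polynomial.lifts_iff_coeff_lifts g).2 hc)
  rw [Polynomial.separable_map] at hg
  refine hg.of_dvd (minpoly.dvd _ _ ?_)
  rwa [← Polynomial.eval_map_algebraMap]

/-- A separable element over `P(t)` is separable over `k(U)(t)` for a finite subset `U` of `P`. -/
theorem exists_finset_isSeparable {k Ω : Type u} [Field k] [Field Ω] [Algebra k Ω]
    (P : IntermediateField k Ω) (t : Set Ω) (x : Ω) (hx : IsSeparable (IntermediateField.adjoin P t) x) :
    ∃ U : Finset Ω, (U : Set Ω) ⊆ P ∧ ∀ E : IntermediateField k Ω, (U : Set Ω) ⊆ E →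
      IsSeparable (IntermediateField.adjoin E t) x := by
  classical
  have h1 (y : Ω) (hy : y ∈ IntermediateField.adjoin P t) : ∃ U : Finset Ω, (U : Set Ω) ⊆ P ∧
      ∀ E : IntermediateField k Ω, (U : Set Ω) ⊆ E → y ∈ IntermediateField.adjoin E t := by
    have hy' : y ∈ IntermediateField.adjoin k ((P : Set Ω) ∪ t) := by
      rw [← IntermediateField.restrictScalars_adjoin]; exact hy
    obtain ⟨T, hT, hyT⟩ := IntermediateField.exists_finset_of_mem_adjoin hy'
    refine ⟨T.filter (· ∈ P), fun z hz => (Finset.mem_filter.1 hz).2, fun E hE => ?_⟩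
    have : y ∈ (IntermediateField.adjoin E t).restrictScalars k := by
      rw [IntermediateField.restrictScalars_adjoin]
      refine IntermediateField.adjoin.mono k _ _ (fun z hz => ?_) hyT
      by_cases hzP : z ∈ P
      · exact Or.inl (hE (Finset.mem_filter.2 ⟨hz, hzP⟩))
      · exact Or.inr ((hT hz).resolve_left hzP)
    exact this
  choose! U hU hUE using h1
  let g := minpoly (IntermediateField.adjoin P t) x
  let c (n : ℕ) : Ω := g.coeff n
  have hc (n : ℕ) : c n ∈ IntermediateField.adjoin P t := (g.coeff n).2
  refine ⟨g.support.biUnion fun n => U (c n), ?_, fun E hE => ?_⟩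
  · rw [Finset.coe_biUnion]
    exact Set.iUnion₂_subset fun n _ => hU _ (hc n)
  have hcE (n : ℕ) : c n ∈ IntermediateField.adjoin E t := by
    by_cases hn : n ∈ g.support
    · refine hUE _ (hc n) E (subset_trans ?_ hE)
      exact_mod_cast Finset.subset_biUnion_of_mem (fun n => U (c n)) hn
    · have : c n = 0 := by simp [c, Polynomial.notMem_support_iff.1 hn]
      rw [this]; exact zero_mem _
  refine isSeparable_of_coeff (g.map (algebraMap _ Ω)) ?_ (fun n => ?_) ?_
  · rw [Polynomial.separable_map]
    exact hx
  · rw [Polynomial.coeff_map]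
    exact ⟨⟨c n, hcE n⟩, rfl⟩
  · rw [Polynomial.eval_map_algebraMap, minpoly.aeval]

theorem isRegularRing_tensor_of_extension (k F L L' : Type u) [Field k] [CommRing F] [Algebra k F]
    [IsNoetherianRing F] [Field L] [Algebra k L] [Algebra.EssFiniteType k L] [Field L']
    [Algebra k L'] [Algebra L L'] [IsScalarTower k L L'] (h : IsRegularRing (L' ⊗[k] F)) :
    IsRegularRing (L ⊗[k] F) := by
  have : IsNoetherianRing (F ⊗[k] L) := Algebra.EssFiniteType.isNoetherianRing F _
  have : IsNoetherianRing (L ⊗[k] F) :=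
    isNoetherianRing_of_ringEquiv (F ⊗[k] L) (Algebra.TensorProduct.comm k F L).toRingEquiv
  have : IsRegularRing (L' ⊗[L] (L ⊗[k] F)) := IsRegularRing.of_ringEquiv (R := L' ⊗[k] F)
    (Algebra.TensorProduct.cancelBaseChange k L L L' F).symm.toRingEquiv
  have h1 : IsRegularRing ((L ⊗[k] F) ⊗[L] L') :=
    IsRegularRing.of_ringEquiv (R := L' ⊗[L] (L ⊗[k] F))
    (Algebra.TensorProduct.comm L L' (L ⊗[k] F)).toRingEquiv
  exact isRegularRing_of_faithfullyFlat _ ((L ⊗[k] F) ⊗[L] L')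

theorem isRegularRing_tensor_of_tower (k F E M L L' ι : Type u) [Field k] [CommRing F] [Algebra k F]
    [IsNoetherianRing F] [Field E] [Algebra k E] [Field L] [Algebra k L] [Algebra.EssFiniteType k L]
    [Field M] [Field L'] [Algebra E M] [Algebra E L'] [Algebra M L'] [IsScalarTower E M L'] [Finite ι]
    [Algebra (MvPolynomial ι E) M] [IsScalarTower E (MvPolynomial ι E) M]
    [IsFractionRing (MvPolynomial ι E) M] [Algebra.IsSeparable M L'] [Algebra.EssFiniteType E L']
    [Algebra k L'] [IsScalarTower k E L']
    [Algebra L L'] [IsScalarTower k L L'] (h : IsRegularRing (E ⊗[k] F)) :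
    IsRegularRing (L ⊗[k] F) := by
  have h1 : IsRegularRing (L' ⊗[E] (E ⊗[k] F)) :=
    isRegularRing_tensor_of_separable (M := M) (ι := ι)
  have h2 : IsRegularRing (L' ⊗[k] F) := IsRegularRing.of_ringEquiv (R := L' ⊗[E] (E ⊗[k] F))
    (Algebra.TensorProduct.cancelBaseChange k E E L' F).toRingEquiv
  exact isRegularRing_tensor_of_extension k F L L' h2

set_option maxHeartbeats 1000000 in
theorem isRegularRing_tensor_of_essFiniteType (k F : Type u) [Field k] [CommRing F] [Algebra k F]
    [IsNoetherianRing F]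
    (h : ∀ (K : Type u) [Field K] [Algebra k K], Module.Finite k K → IsRegularRing (K ⊗[k] F))
    (L : Type u) [Field L] [Algebra k L] [Algebra.EssFiniteType k L] : IsRegularRing (L ⊗[k] F) := by
  classical
  let Ω := AlgebraicClosure L
  let P : IntermediateField k Ω := algebraicClosure k Ω
  have : IsAlgClosed P := IsAlgClosure.isAlgClosed k
  obtain ⟨S, hS⟩ := IntermediateField.fg_top k L
  let S' : Finset Ω := S.image (algebraMap L Ω)
  let K := IntermediateField.adjoin P (S' : Set Ω)
  have : Algebra.EssFiniteType P K := 
    IntermediateField.essFiniteType_iff.2 (IntermediateField.fg_adjoin_finset _)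
  obtain ⟨s, hs, hsep⟩ := exists_isTranscendenceBasis_and_isSeparable_of_perfectField (k := P) (K := K)
  let t : s → Ω := fun i => ((i : K) : Ω)
  have ht : AlgebraicIndependent P t := hs.1.map' (f := K.val) K.val.injective
  have hts (x) (hx : x ∈ S') : IsSeparable (IntermediateField.adjoin P (Set.range t)) x := by
    have h0 : x ∈ K := IntermediateField.subset_adjoin _ _ hx
    have h1 : IsSeparable (IntermediateField.adjoin P (s : Set K)) (⟨x, h0⟩ : K) :=
      hsep.isSeparable _ _
    let g := minpoly (IntermediateField.adjoin P (s : Set K)) (⟨x, h0⟩ : K)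
    refine isSeparable_of_coeff ((g.map (algebraMap _ K)).map (algebraMap K Ω)) ?_ (fun n => ?_) ?_
    · rw [Polynomial.separable_map, Polynomial.separable_map]
      exact h1
    · rw [Polynomial.coeff_map, Polynomial.coeff_map]
      have h2 : K.val (g.coeff n : K) ∈ (IntermediateField.adjoin P (s : Set K)).map K.val :=
        ⟨_, (g.coeff n).2, rfl⟩
      rw [IntermediateField.adjoin_map] at h2
      refine ⟨⟨_, IntermediateField.adjoin.mono _ _ _ ?_ h2⟩, rfl⟩
      rintro _ ⟨y, hy, rfl⟩
      exact ⟨⟨y, hy⟩, rfl⟩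
    · have h2 : (g.map (algebraMap _ K)).eval (⟨x, h0⟩ : K) = 0 := by
        rw [Polynomial.eval_map_algebraMap]; exact minpoly.aeval _ _
      have h3 := congrArg (algebraMap K Ω) h2
      rwa [map_zero, ← Polynomial.eval₂_at_apply, ← Polynomial.eval_map] at h3
  choose! U hU hUE using fun x hx => exists_finset_isSeparable P (Set.range t) x (hts x hx)
  let V := S'.biUnion U
  let E := IntermediateField.adjoin k (V : Set Ω)
  have hVP : (V : Set Ω) ⊆ P := by
    rw [Finset.coe_biUnion]
    exact Set.iUnion₂_subset fun x hx => hU x hx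
  have hEP : E ≤ P := IntermediateField.adjoin_le_iff.2 hVP
  have hE : Module.Finite k E :=
    IntermediateField.finiteDimensional_adjoin fun x hx =>
      (mem_algebraicClosure_iff'.1 (hVP hx))
  let M := IntermediateField.adjoin E (Set.range t)
  let L' := IntermediateField.adjoin M (S' : Set Ω)
  have : Algebra.IsSeparable M L' := by
    refine (IntermediateField.isSeparable_adjoin_iff_isSeparable _ _).2 fun x hx => ?_
    refine hUE x hx E (subset_trans ?_ (IntermediateField.subset_adjoin k _))
    exact_mod_cast Finset.subset_biUnion_of_mem U hx
  have htE : AlgebraicIndependent E t := by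
    exact AlgebraicIndependent.of_ringHom_of_comp_eq (R := E) (S := P)
      (IntermediateField.inclusion hEP).toRingHom (RingHom.id Ω) ht
      (IntermediateField.inclusion hEP).injective rfl
  let : Algebra (MvPolynomial s E) M := (htE.aevalEquivField.toRingHom.comp (algebraMap _ _)).toAlgebra
  have : IsScalarTower E (MvPolynomial s E) M :=
    IsScalarTower.of_algebraMap_eq fun x => by
      change _ = htE.aevalEquivField (algebraMap _ _ (MvPolynomial.C x))
      rw [← MvPolynomial.algebraMap_eq, ← IsScalarTower.algebraMap_apply, AlgEquiv.commutes]
  have : IsFractionRing (MvPolynomial s E) M := by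
    refine IsLocalization.isLocalization_of_algEquiv (S := FractionRing (MvPolynomial s E))
      (nonZeroDivisors (MvPolynomial s E))
      (AlgEquiv.ofRingEquiv (f := htE.aevalEquivField.toRingEquiv) fun x => rfl)

  have : Algebra.EssFiniteType E L' := by
    have h1 : Algebra.EssFiniteType E M := IntermediateField.essFiniteType_iff.2
      (IntermediateField.fg_def.2 ⟨_, Set.finite_range t, rfl⟩)
    have h2 : Algebra.EssFiniteType M L' :=
      IntermediateField.essFiniteType_iff.2 (IntermediateField.fg_adjoin_finset _)
    exact Algebra.EssFiniteType.comp E M L'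
  let : Algebra k L' := ((algebraMap E L').comp (algebraMap k E)).toAlgebra
  have : IsScalarTower k E L' := IsScalarTower.of_algebraMap_eq fun x => rfl
  have hLL' (x : L) : algebraMap L Ω x ∈ L' := by
    have h1 : x ∈ IntermediateField.adjoin k (S : Set L) := hS ▸ trivial
    induction h1 using IntermediateField.adjoin_induction with
    | mem x hx =>
      exact IntermediateField.subset_adjoin _ _ (Finset.mem_coe.2 (Finset.mem_image_of_mem _ hx))
    | algebraMap x => exact (algebraMap k L' x).2
    | add x y _ _ hx hy => rw [map_add]; exact add_mem hx hy
    | inv x _ hx => rw [map_inv₀]; exact inv_mem hx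
    | mul x y _ _ hx hy => rw [map_mul]; exact mul_mem hx hy
  let : Algebra L L' := ((algebraMap L Ω).codRestrict L'.toSubring hLL').toAlgebra
  have : IsScalarTower k L L' := IsScalarTower.of_algebraMap_eq fun x => Subtype.ext rfl
  exact isRegularRing_tensor_of_tower k F E M L L' s (h E hE)

end FGFields

section Fibres
open TensorProduct IsLocalRing

theorem isLocalizationAtPrime_quotient {R : Type u} [CommRing R] (I : Ideal R) (P : Ideal (R ⧸ I))
    [P.IsPrime] (Q : Ideal R) [Q.IsPrime] (hQ : Q = P.comap (Ideal.Quotient.mk I)) (S : Type u)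
    [CommRing S] [Algebra R S] [IsLocalization.AtPrime S Q] :
    IsLocalization.AtPrime (S ⧸ I.map (algebraMap R S)) P := by
  have : Algebra.algebraMapSubmonoid (R ⧸ I) Q.primeCompl = P.primeCompl := by
    subst hQ
    ext x
    obtain ⟨x, rfl⟩ := Ideal.Quotient.mk_surjective x
    constructor
    · rintro ⟨y, hy, hyx⟩
      change Ideal.Quotient.mk I y = _ at hyx
      rw [← hyx]
      exact hy
    · intro hx
      exact ⟨x, hx, rfl⟩
  rw [IsLocalization.AtPrime, ← this]
  infer_instance

theorem isRegularLocalRing_localization_of_fibre {G E : Type u} [CommRing G] [CommRing E]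
    [Algebra G E] [Module.Flat G E] [IsNoetherianRing E] (r : Ideal E) [r.IsPrime]
    (r0 : Ideal G) [r0.IsPrime] (h0 : r.comap (algebraMap G E) = r0)
    (h1 : IsRegularLocalRing (Localization.AtPrime r0))
    (P : Ideal (E ⧸ r0.map (algebraMap G E))) [P.IsPrime]
    (hP : r = P.comap (Ideal.Quotient.mk _)) (h2 : IsRegularLocalRing (Localization.AtPrime P)) :
    IsRegularLocalRing (Localization.AtPrime r) := by
  have : r.LiesOver r0 := ⟨h0.symm⟩
  let := Localization.AtPrime.algebraOfLiesOver r0 r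
  refine isRegularLocalRing_of_flat_of_fibre (Localization.AtPrime r0) _ ?_
  have h3 : (maximalIdeal (Localization.AtPrime r0)).map
      (algebraMap (Localization.AtPrime r0) (Localization.AtPrime r)) =
      (r0.map (algebraMap G E)).map (algebraMap E (Localization.AtPrime r)) := by
    rw [← Localization.AtPrime.map_eq_maximalIdeal, Ideal.map_map, Ideal.map_map,
      ← IsScalarTower.algebraMap_eq, ← IsScalarTower.algebraMap_eq]
  rw [h3]
  have := isLocalizationAtPrime_quotient _ P r hP (Localization.AtPrime r)
  exact IsRegularLocalRing.of_ringEquiv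
    (IsLocalization.algEquiv P.primeCompl (Localization.AtPrime P)
      (Localization.AtPrime r ⧸ (r0.map (algebraMap G E)).map
        (algebraMap E (Localization.AtPrime r)))).toRingEquiv

theorem IsCompl.isRegularLocalRing_localization {G E : Type u} [CommRing G] [CommRing E]
    [IsLocalRing G] [IsLocalRing E] [IsNoetherianRing G] [Algebra G E] (h : IsCompl G E)
    (r : Ideal E) [r.IsPrime] (r0 : Ideal G) [r0.IsPrime] (h0 : r.comap (algebraMap G E) = r0)
    (h1 : IsRegularLocalRing (Localization.AtPrime r0)) [IsLocalRing (G ⧸ r0)]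
    (h2 : IsGenReg (G ⧸ r0)) : IsRegularLocalRing (Localization.AtPrime r) := by
  have := h.flat; have := h.noeth
  have hle : r0.map (algebraMap G E) ≤ r := Ideal.map_le_iff_le_comap.2 h0.ge
  have : IsLocalRing (E ⧸ r0.map (algebraMap G E)) :=
    isLocalRing_quotient (hle.trans (le_maximalIdeal ‹r.IsPrime›.ne_top))
  have hker : RingHom.ker (Ideal.Quotient.mk (r0.map (algebraMap G E))) ≤ r := by
    rwa [Ideal.mk_ker]
  have hp : (r.map (Ideal.Quotient.mk (r0.map (algebraMap G E)))).IsPrime :=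
    Ideal.map_isPrime_of_surjective Ideal.Quotient.mk_surjective hker
  have hr : r = (r.map (Ideal.Quotient.mk (r0.map (algebraMap G E)))).comap
      (Ideal.Quotient.mk _) := by
    rw [Ideal.comap_map_of_surjective' _ Ideal.Quotient.mk_surjective, sup_eq_left.2 hker]
  refine isRegularLocalRing_localization_of_fibre r r0 h0 h1 _ hr ?_
  refine (isGenReg_iff (h.quotient r0)).1 h2 _ ?_
  rw [eq_bot_iff]
  intro x hx
  obtain ⟨x, rfl⟩ := Ideal.Quotient.mk_surjective x
  have h3 : algebraMap G E x ∈ r := by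
    rw [hr]; exact hx
  rw [Ideal.mem_bot, Ideal.Quotient.eq_zero_iff_mem, ← h0]
  exact h3

theorem IsGenReg.quotient_localization {E : Type u} [CommRing E] [IsNoetherianRing E]
    (r q : Ideal E) [r.IsPrime] [q.IsPrime] (hrq : r ≤ q)
    (h : ∀ P : Ideal (E ⧸ r), ∀ [P.IsPrime], IsGenReg (Localization.AtPrime P))
    (r0 : Ideal (Localization.AtPrime q)) (hr0 : r0 = r.map (algebraMap E _))
    [IsLocalRing (Localization.AtPrime q ⧸ r0)] :
    IsGenReg (Localization.AtPrime q ⧸ r0) := by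
  subst hr0
  have hker : RingHom.ker (Ideal.Quotient.mk r) ≤ q := by rwa [Ideal.mk_ker]
  have hp : (q.map (Ideal.Quotient.mk r)).IsPrime :=
    Ideal.map_isPrime_of_surjective Ideal.Quotient.mk_surjective hker
  have hr : q = (q.map (Ideal.Quotient.mk r)).comap (Ideal.Quotient.mk _) := by
    rw [Ideal.comap_map_of_surjective' _ Ideal.Quotient.mk_surjective, sup_eq_left.2 hker]
  have := isLocalizationAtPrime_quotient _ _ q hr (Localization.AtPrime q)
  exact IsGenReg.of_ringEquiv
    (IsLocalization.algEquiv (q.map (Ideal.Quotient.mk r)).primeCompl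
      (Localization.AtPrime (q.map (Ideal.Quotient.mk r)))
      (Localization.AtPrime q ⧸ r.map (algebraMap E (Localization.AtPrime q)))).toRingEquiv (h _)

end Fibres

section Fibres
open TensorProduct IsLocalRing

variable {A Â B : Type u} [CommRing A] [IsLocalRing A] [CommRing Â] [IsLocalRing Â]
  [Algebra A Â] [CommRing B] [Algebra A B]

theorem IsCompl.exists_sub_mem_map (h : IsCompl A Â) (q : Ideal B)
    (hq : maximalIdeal A ≤ q.comap (algebraMap A B)) (e : B ⊗[A] Â) :
    ∃ b : B, e - algebraMap B (B ⊗[A] Â) b ∈ q.map (algebraMap B (B ⊗[A] Â)) := by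
  induction e with
  | zero => exact ⟨0, by simp⟩
  | add x y hx hy =>
    obtain ⟨b, hb⟩ := hx
    obtain ⟨c, hc⟩ := hy
    refine ⟨b + c, ?_⟩
    have := add_mem hb hc
    rw [map_add]; convert this using 1; ring
  | tmul b x =>
    obtain ⟨a, ha⟩ := h.surj x
    refine ⟨b * algebraMap A B a, ?_⟩
    have h1 : b ⊗ₜ[A] x - algebraMap B (B ⊗[A] Â) (b * algebraMap A B a) =
        algebraMap B (B ⊗[A] Â) b *
          Algebra.TensorProduct.includeRight (x - algebraMap A Â a) := by
      have h2 : (b * algebraMap A B a) ⊗ₜ[A] (1 : Â) = b ⊗ₜ[A] algebraMap A Â a := by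
        rw [mul_comm, ← Algebra.smul_def, smul_tmul, Algebra.smul_def, mul_one]
      rw [Algebra.TensorProduct.algebraMap_apply, Algebra.TensorProduct.algebraMap_apply,
        Algebra.algebraMap_self_apply, Algebra.algebraMap_self_apply, h2, map_sub, mul_sub]
      simp [h2]
    rw [h1]
    refine Ideal.mul_mem_left _ _ ?_
    have h3 : (maximalIdeal Â).map
        (Algebra.TensorProduct.includeRight : Â →ₐ[A] B ⊗[A] Â) ≤
        q.map (algebraMap B (B ⊗[A] Â)) := by
      rw [← h.map_max, Ideal.map_le_iff_le_comap, Ideal.map_le_iff_le_comap]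
      intro a ha
      have h4 := Ideal.mem_map_of_mem (algebraMap B (B ⊗[A] Â)) (hq ha)
      rw [← IsScalarTower.algebraMap_apply] at h4
      rw [Ideal.mem_comap, Ideal.mem_comap, AlgHom.commutes]
      exact h4
    exact h3 (Ideal.mem_map_of_mem _ ha)

theorem IsCompl.comap_map_tensor [IsNoetherianRing A] (h : IsCompl A Â) (q : Ideal B) :
    (q.map (algebraMap B (B ⊗[A] Â))).comap (algebraMap B (B ⊗[A] Â)) = q := by
  have := h.flat
  have := isLocalHom_of_map_max h.map_max
  have := Module.FaithfullyFlat.of_flat_of_isLocalHom (A := A) (B := Â)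
  exact Ideal.comap_map_eq_self_of_faithfullyFlat q

theorem IsCompl.bijective_quotient_tensor [IsNoetherianRing A] (h : IsCompl A Â) (q : Ideal B)
    (hq : maximalIdeal A ≤ q.comap (algebraMap A B)) :
    Function.Bijective (Ideal.quotientMap (q.map (algebraMap B (B ⊗[A] Â)))
      (algebraMap B (B ⊗[A] Â)) Ideal.le_comap_map) := by
  constructor
  · exact Ideal.quotientMap_injective' (h.comap_map_tensor q).le
  · intro x
    obtain ⟨e, rfl⟩ := Ideal.Quotient.mk_surjective x
    obtain ⟨b, hb⟩ := h.exists_sub_mem_map q hq e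
    exact ⟨Ideal.Quotient.mk _ b, ((Ideal.Quotient.mk_eq_mk_iff_sub_mem _ _).2 hb).symm⟩

theorem IsCompl.isPrime_map_tensor [IsNoetherianRing A] (h : IsCompl A Â) (q : Ideal B) [q.IsPrime]
    (hq : maximalIdeal A ≤ q.comap (algebraMap A B)) :
    (q.map (algebraMap B (B ⊗[A] Â))).IsPrime := by
  have e := RingEquiv.ofBijective _ (h.bijective_quotient_tensor q hq)
  rw [← Ideal.Quotient.isDomain_iff_prime]
  exact e.toMulEquiv.symm.isDomain (B ⧸ q)

theorem IsCompl.isMaximal_map_tensor [IsNoetherianRing A] (h : IsCompl A Â) (q : Ideal B)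
    [q.IsMaximal] (hq : maximalIdeal A ≤ q.comap (algebraMap A B)) :
    (q.map (algebraMap B (B ⊗[A] Â))).IsMaximal := by
  have e := RingEquiv.ofBijective _ (h.bijective_quotient_tensor q hq)
  rw [Ideal.Quotient.maximal_ideal_iff_isField_quotient]
  exact e.symm.toMulEquiv.isField ((Ideal.Quotient.maximal_ideal_iff_isField_quotient q).1 ‹_›)

section Local
variable {E : Type u} [CommRing E] [Algebra B E] (q : Ideal B) [q.IsPrime] (Q : Ideal E) [Q.IsPrime]
  [Q.LiesOver q] (hQ : q.map (algebraMap B E) = Q)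
  (hs : ∀ e : E, ∃ b : B, e - algebraMap B E b ∈ Q)

include hQ in
theorem map_max_localization [Algebra (Localization.AtPrime q) (Localization.AtPrime Q)]
    [Localization.AtPrime.IsLiesOverAlgebra q Q] :
    (maximalIdeal (Localization.AtPrime q)).map
      (algebraMap (Localization.AtPrime q) (Localization.AtPrime Q)) =
      maximalIdeal (Localization.AtPrime Q) := by
  rw [← Localization.AtPrime.map_eq_maximalIdeal, Ideal.map_map,
    ← IsScalarTower.algebraMap_eq, IsScalarTower.algebraMap_eq B E, ← Ideal.map_map, hQ,
    Localization.AtPrime.map_eq_maximalIdeal]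

include hs in
theorem surj_localization [Algebra (Localization.AtPrime q) (Localization.AtPrime Q)]
    [Localization.AtPrime.IsLiesOverAlgebra q Q] (x : Localization.AtPrime Q) :
    ∃ d : Localization.AtPrime q,
      x - algebraMap (Localization.AtPrime q) (Localization.AtPrime Q) d ∈ maximalIdeal _ := by
  obtain ⟨⟨e, s⟩, hx⟩ := IsLocalization.surj Q.primeCompl x
  obtain ⟨b, hb⟩ := hs e
  obtain ⟨c, hc⟩ := hs s
  have hcQ : algebraMap B E c ∉ Q := fun h => s.2 (by simpa using add_mem hc h)
  have hcq : c ∉ q := fun h => hcQ (by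
    have := Ideal.over_def Q q ▸ h
    exact this)
  refine ⟨IsLocalization.mk' _ b (⟨c, hcq⟩ : q.primeCompl), ?_⟩
  set d := IsLocalization.mk' (Localization.AtPrime q) b (⟨c, hcq⟩ : q.primeCompl)
  have hd : d * algebraMap B _ c = algebraMap B _ b := 
    IsLocalization.mk'_spec (Localization.AtPrime q) b (⟨c, hcq⟩ : q.primeCompl)
  have hd' := congrArg (algebraMap (Localization.AtPrime q) (Localization.AtPrime Q)) hd
  rw [map_mul, ← IsScalarTower.algebraMap_apply, ← IsScalarTower.algebraMap_apply,
    IsScalarTower.algebraMap_apply B E (Localization.AtPrime Q) c,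
    IsScalarTower.algebraMap_apply B E (Localization.AtPrime Q) b] at hd'
  have hu : algebraMap E (Localization.AtPrime Q) (s * algebraMap B E c) ∉ maximalIdeal _ := by
    rw [IsLocalization.AtPrime.to_map_mem_maximal_iff _ Q]
    exact fun h => (‹Q.IsPrime›.mem_or_mem h).elim s.2 hcQ
  refine ((maximalIdeal.isMaximal _).isPrime.mem_or_mem ?_).resolve_right hu
  have : (x - algebraMap _ _ d) * algebraMap E (Localization.AtPrime Q) (s * algebraMap B E c) =
      algebraMap E _ (e * algebraMap B E c - s * algebraMap B E b) := by
    simp only [map_mul, map_sub] at hx hd' ⊢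
    rw [← hx, ← hd']; ring
  rw [this, IsLocalization.AtPrime.to_map_mem_maximal_iff _ Q]
  have h1 : e * algebraMap B E c - s * algebraMap B E b =
      (e - algebraMap B E b) * algebraMap B E c - (s - algebraMap B E c) * algebraMap B E b := by
    ring
  rw [h1]
  exact sub_mem (Ideal.mul_mem_right _ _ hb) (Ideal.mul_mem_right _ _ hc)

include hQ hs in
theorem isCompl_localization [Module.Flat B E] [IsNoetherianRing E]
    [Algebra (Localization.AtPrime q) (Localization.AtPrime Q)]
    [Localization.AtPrime.IsLiesOverAlgebra q Q] {Ĝ : Type u} [CommRing Ĝ] [IsLocalRing Ĝ]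
    [Algebra (Localization.AtPrime Q) Ĝ] [Algebra (Localization.AtPrime q) Ĝ]
    [IsScalarTower (Localization.AtPrime q) (Localization.AtPrime Q) Ĝ]
    (h : IsCompl (Localization.AtPrime Q) Ĝ) : IsCompl (Localization.AtPrime q) Ĝ :=
  h.of_comp (map_max_localization q Q hQ) (surj_localization q Q hs)
end Local

end Fibres

section Fibres
open TensorProduct IsLocalRing

/-- The fibres of `A → E` are geometrically regular. -/
def GeomRegFibres (A E : Type u) [CommRing A] [CommRing E] [Algebra A E] : Prop :=
  ∀ (p : Ideal A) [p.IsPrime] (K : Type u) [Field K] [Algebra p.ResidueField K],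
    Module.Finite p.ResidueField K →
      IsRegularRing (K ⊗[p.ResidueField] (p.ResidueField ⊗[A] E))

theorem isNoetherianRing_tensor_of_essFiniteType (A F E : Type u) [CommRing A] [CommRing E]
    [CommRing F] [Algebra A E] [Algebra A F] [IsNoetherianRing E] [Algebra.EssFiniteType A F] :
    IsNoetherianRing (F ⊗[A] E) :=
  have := Algebra.EssFiniteType.isNoetherianRing E (E ⊗[A] F)
  isNoetherianRing_of_ringEquiv (E ⊗[A] F) (Algebra.TensorProduct.comm A E F).toRingEquiv

theorem GeomRegFibres.isRegularRing_field {A E : Type u} [CommRing A] [CommRing E] [Algebra A E]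
    [IsNoetherianRing E] (h : GeomRegFibres A E) (L : Type u) [Field L] [Algebra A L]
    [Algebra.EssFiniteType A L] : IsRegularRing (L ⊗[A] E) := by
  let p := RingHom.ker (algebraMap A L)
  have hp : p.IsPrime := RingHom.ker_isPrime _
  let f : p.ResidueField →+* L := Ideal.ResidueField.lift p (algebraMap A L) le_rfl fun x hx => by
    exact (isUnit_iff_ne_zero.2 hx : IsUnit (algebraMap A L x))
  let := f.toAlgebra
  have : IsScalarTower A p.ResidueField L := IsScalarTower.of_algebraMap_eq fun x =>
    (Ideal.ResidueField.lift_algebraMap _ _ _ _ _).symm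
  have : Algebra.EssFiniteType p.ResidueField L := .of_comp A _ _
  have := isNoetherianRing_tensor_of_essFiniteType A p.ResidueField E
  have h1 := isRegularRing_tensor_of_essFiniteType p.ResidueField (p.ResidueField ⊗[A] E)
    (fun K _ _ hK => h p K hK) L
  exact IsRegularRing.of_ringEquiv (R := L ⊗[p.ResidueField] (p.ResidueField ⊗[A] E))
    (Algebra.TensorProduct.cancelBaseChange A p.ResidueField p.ResidueField L E).toRingEquiv

theorem isRegularLocalRing_of_isLocalization {T T' : Type u} [CommRing T] [CommRing T'] [Algebra T T']
    (M : Submonoid T) [IsLocalization M T'] [IsRegularRing T'] (r : Ideal T) [r.IsPrime]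
    (h : Disjoint (M : Set T) r) : IsRegularLocalRing (Localization.AtPrime r) := by
  have hp : (r.map (algebraMap T T')).IsPrime :=
    IsLocalization.isPrime_of_isPrime_disjoint M T' r ‹_› h
  have hc : (r.map (algebraMap T T')).comap (algebraMap T T') = r :=
    IsLocalization.under_map_of_isPrime_disjoint M T' ‹_› h
  have h1 := IsLocalization.isLocalization_isLocalization_atPrime_isLocalization M
    (Localization.AtPrime (r.map (algebraMap T T'))) (r.map (algebraMap T T'))
  simp only [hc] at h1
  have : IsRegularLocalRing (Localization.AtPrime (r.map (algebraMap T T'))) :=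
    isRegularRing_iff.1 ‹_› _
  exact IsRegularLocalRing.of_ringEquiv
    (IsLocalization.algEquiv r.primeCompl (Localization.AtPrime (r.map (algebraMap T T')))
      (Localization.AtPrime r)).toRingEquiv

theorem disjoint_algebraMapSubmonoid {B T : Type*} [CommRing B] [IsDomain B] [CommRing T]
    [Algebra B T] {r : Ideal T} (hr : r.comap (algebraMap B T) = ⊥) :
    Disjoint (Algebra.algebraMapSubmonoid T (nonZeroDivisors B) : Set T) r := by
  rw [Set.disjoint_left]
  rintro _ ⟨b, hb, rfl⟩ h
  have : b ∈ r.comap (algebraMap B T) := h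
  rw [hr, Ideal.mem_bot] at this
  exact nonZeroDivisors.ne_zero hb this

/-- Over the generic point of `B`, the base change of a morphism with geometrically regular
fibres is regular. -/
theorem GeomRegFibres.isRegularLocalRing {A E : Type u} [CommRing A] [CommRing E] [Algebra A E]
    [IsNoetherianRing E] (h : GeomRegFibres A E) (B : Type u) [CommRing B] [IsDomain B]
    [Algebra A B] [Algebra.EssFiniteType A B] (r : Ideal (B ⊗[A] E)) [r.IsPrime]
    (hr : r.comap (algebraMap B (B ⊗[A] E)) = ⊥) :
    IsRegularLocalRing (Localization.AtPrime r) := by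
  let L := FractionRing B
  have : Algebra.EssFiniteType B L := .of_isLocalization _ (nonZeroDivisors B)
  have : Algebra.EssFiniteType A L := .comp A B L
  have h1 := h.isRegularRing_field L
  have h2 : IsRegularRing (L ⊗[B] (B ⊗[A] E)) := IsRegularRing.of_ringEquiv (R := L ⊗[A] E)
    (Algebra.TensorProduct.cancelBaseChange A B B L E).symm.toRingEquiv
  have h3 : IsRegularRing ((B ⊗[A] E) ⊗[B] L) := IsRegularRing.of_ringEquiv
    (R := L ⊗[B] (B ⊗[A] E)) (Algebra.TensorProduct.comm B _ _).toRingEquiv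
  exact isRegularLocalRing_of_isLocalization (T' := (B ⊗[A] E) ⊗[B] L)
    (Algebra.algebraMapSubmonoid (B ⊗[A] E) (nonZeroDivisors B)) r (disjoint_algebraMapSubmonoid hr)

end Fibres

section Fibres
open TensorProduct IsLocalRing

theorem finiteType_includeRight (A B E : Type u) [CommRing A] [CommRing B] [CommRing E] [Algebra A B]
    [Algebra A E] [Algebra.FiniteType A B] :
    (Algebra.TensorProduct.includeRight : E →ₐ[A] B ⊗[A] E).toRingHom.FiniteType := by
  have h : (algebraMap E (E ⊗[A] B)).FiniteType :=
    RingHom.finiteType_algebraMap.2 inferInstance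
  have h1 := (RingHom.FiniteType.of_surjective
    (Algebra.TensorProduct.comm A E B).toRingEquiv.toRingHom
    (Algebra.TensorProduct.comm A E B).surjective).comp h
  convert h1 using 1
  ext x
  simp [Algebra.TensorProduct.algebraMap_apply]

theorem isGenReg_quotient_tensor {A Â B : Type u} [CommRing A] [CommRing Â] [IsLocalRing Â]
    [IsNoetherianRing Â] [IsAdicComplete (maximalIdeal Â) Â] [Algebra A Â] [CommRing B] [Algebra A B]
    [Algebra.FiniteType A B] (r : Ideal (B ⊗[A] Â)) [r.IsPrime] (P : Ideal ((B ⊗[A] Â) ⧸ r))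
    [P.IsPrime] : IsGenReg (Localization.AtPrime P) := by
  let f : Â →+* (B ⊗[A] Â) ⧸ r := (Ideal.Quotient.mk r).comp
    (Algebra.TensorProduct.includeRight : Â →ₐ[A] B ⊗[A] Â).toRingHom
  have hf : f.FiniteType := (RingHom.FiniteType.of_surjective _
    Ideal.Quotient.mk_surjective).comp (finiteType_includeRight A B Â)
  let := f.toAlgebra
  have : Algebra.FiniteType Â ((B ⊗[A] Â) ⧸ r) := hf
  exact isGenReg_of_isAdicComplete (A := Â) P

theorem isGenReg_of_isCompl_localization {B E D Ĝ : Type u} [CommRing B] [CommRing E] [Algebra B E]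
    [IsNoetherianRing E]
    (h1 : ∀ (r : Ideal E) [r.IsPrime], r.comap (algebraMap B E) = ⊥ →
      IsRegularLocalRing (Localization.AtPrime r))
    (h2 : ∀ (r : Ideal E) [r.IsPrime] (P : Ideal (E ⧸ r)) [P.IsPrime],
      IsGenReg (Localization.AtPrime P))
    (Q : Ideal E) [Q.IsPrime] [CommRing D] [Algebra B D] [CommRing Ĝ] [IsLocalRing Ĝ]
    [Algebra D Ĝ] [Algebra (Localization.AtPrime Q) Ĝ]
    (hinj : Function.Injective (algebraMap B D))
    (htower : (algebraMap D Ĝ).comp (algebraMap B D) =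
      (algebraMap (Localization.AtPrime Q) Ĝ).comp (algebraMap B (Localization.AtPrime Q)))
    (h : IsCompl (Localization.AtPrime Q) Ĝ) : GenReg D Ĝ := by
  intro r hr h0
  let r0 := r.comap (algebraMap (Localization.AtPrime Q) Ĝ)
  let r1 := r0.comap (algebraMap E (Localization.AtPrime Q))
  have hr1 : r1.comap (algebraMap B E) = ⊥ := by
    rw [Ideal.comap_comap, ← IsScalarTower.algebraMap_eq, Ideal.comap_comap, ← htower,
      ← Ideal.comap_comap, h0]
    exact (RingHom.injective_iff_ker_eq_bot _).1 hinj
  have hloc : IsLocalRing (Localization.AtPrime Q ⧸ r0) :=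
    isLocalRing_quotient (le_maximalIdeal (Ideal.IsPrime.ne_top inferInstance))
  have hr0 : r0 = r1.map (algebraMap E (Localization.AtPrime Q)) :=
    (IsLocalization.map_under Q.primeCompl (Localization.AtPrime Q) r0).symm
  refine h.isRegularLocalRing_localization r r0 rfl ?_ ?_
  · have := h1 r1 hr1
    exact IsRegularLocalRing.of_ringEquiv
      (IsLocalization.localizationLocalizationAtPrimeIsoLocalization Q.primeCompl r0).toRingEquiv
  · refine IsGenReg.quotient_localization r1 Q ?_ (fun P _ => h2 r1 P) r0 hr0
    intro x hx
    rw [← IsLocalization.AtPrime.to_map_mem_maximal_iff (Localization.AtPrime Q) Q]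
    exact (le_maximalIdeal (Ideal.IsPrime.ne_top (inferInstance : r0.IsPrime))) hx

theorem isGenReg_of_finiteType {A Â : Type u} [CommRing A] [IsLocalRing A] [IsNoetherianRing A]
    [CommRing Â] [IsLocalRing Â] [Algebra A Â] (hc : IsCompl A Â) (h : GeomRegFibres A Â)
    (B : Type u) [CommRing B] [IsDomain B] [Algebra A B] [Algebra.FiniteType A B] (q : Ideal B)
    [q.IsPrime] (hq : maximalIdeal A ≤ q.comap (algebraMap A B)) :
    IsGenReg (Localization.AtPrime q) := by
  have := hc.noeth; have := hc.complete; have := hc.flat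
  have : IsNoetherianRing B := Algebra.FiniteType.isNoetherianRing A B
  have : IsNoetherianRing (B ⊗[A] Â) := isNoetherianRing_tensor_of_essFiniteType A B Â
  have hp := hc.isPrime_map_tensor q hq
  have : (q.map (algebraMap B (B ⊗[A] Â))).LiesOver q := ⟨(hc.comap_map_tensor q).symm⟩
  generalize hQ : q.map (algebraMap B (B ⊗[A] Â)) = Q at *
  let := Localization.AtPrime.algebraOfLiesOver q Q
  let Ĝ := AdicCompletion (maximalIdeal (Localization.AtPrime Q)) (Localization.AtPrime Q)
  have hG : IsCompl (Localization.AtPrime Q) Ĝ := IsCompl.adicCompletion _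
  have hD : IsCompl (Localization.AtPrime q) Ĝ := isCompl_localization q Q hQ
    (fun e => hQ ▸ hc.exists_sub_mem_map q hq e) hG
  rw [isGenReg_iff hD]
  refine isGenReg_of_isCompl_localization (B := B)
    (fun r _ hr => h.isRegularLocalRing B r hr)
    (fun r _ P _ => isGenReg_quotient_tensor r P) Q
    (IsLocalization.injective _ q.primeCompl_le_nonZeroDivisors) ?_ hG
  rw [IsScalarTower.algebraMap_eq B (Localization.AtPrime q) (Localization.AtPrime Q),
    IsScalarTower.algebraMap_eq (Localization.AtPrime q) (Localization.AtPrime Q) Ĝ,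
    RingHom.comp_assoc]

end Fibres

section Fibres
open TensorProduct IsLocalRing

theorem isGenReg_of_essFiniteType {A Â : Type u} [CommRing A] [IsLocalRing A] [IsNoetherianRing A]
    [CommRing Â] [IsLocalRing Â] [Algebra A Â] (hc : IsCompl A Â) (h : GeomRegFibres A Â)
    (B : Type u) [CommRing B] [IsDomain B] [Algebra A B] [Algebra.EssFiniteType A B] (q : Ideal B)
    [q.IsPrime] (hq : maximalIdeal A ≤ q.comap (algebraMap A B)) :
    IsGenReg (Localization.AtPrime q) := by
  let B0 := Algebra.EssFiniteType.subalgebra A B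
  have : IsNoetherianRing B0 := Algebra.FiniteType.isNoetherianRing A B0
  let q0 := q.comap (algebraMap B0 B)
  have h0 : IsGenReg (Localization.AtPrime q0) := by
    refine isGenReg_of_finiteType hc h B0 q0 ?_
    rwa [Ideal.comap_comap, ← IsScalarTower.algebraMap_eq]
  have h1 := IsLocalization.isLocalization_isLocalization_atPrime_isLocalization
    (Algebra.EssFiniteType.submonoid A B) (Localization.AtPrime q) q
  exact h0.of_ringEquiv
    (IsLocalization.algEquiv q0.primeCompl (Localization.AtPrime q0)
      (Localization.AtPrime q)).toRingEquiv

theorem isRegularLocalRing_of_genReg_localization {C E D Ĝ : Type u} [CommRing C] [CommRing E]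
    [Algebra C E] [IsNoetherianRing E] (n : Ideal C) [n.IsPrime] (N : Ideal E) [N.IsPrime]
    [CommRing D] [Algebra C D] [IsLocalization.AtPrime D n] [CommRing Ĝ] [IsLocalRing Ĝ]
    [Algebra D Ĝ] [Algebra (Localization.AtPrime N) Ĝ]
    (htower : (algebraMap D Ĝ).comp (algebraMap C D) =
      (algebraMap (Localization.AtPrime N) Ĝ).comp (algebraMap C (Localization.AtPrime N)))
    (h : IsCompl (Localization.AtPrime N) Ĝ) (hG : GenReg D Ĝ) (r : Ideal E) [r.IsPrime]
    (hrN : r ≤ N) (hr : r.comap (algebraMap C E) = ⊥) :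
    IsRegularLocalRing (Localization.AtPrime r) := by
  have := h.flat; have := h.noeth
  have := isLocalHom_of_map_max h.map_max
  have := Module.FaithfullyFlat.of_flat_of_isLocalHom (A := Localization.AtPrime N) (B := Ĝ)
  have hd : Disjoint (N.primeCompl : Set E) r :=
    Set.disjoint_left.2 fun x hx hx' => hx (hrN hx')
  have hp : (r.map (algebraMap E (Localization.AtPrime N))).IsPrime :=
    IsLocalization.isPrime_of_isPrime_disjoint N.primeCompl _ r ‹_› hd
  have hcm : (r.map (algebraMap E (Localization.AtPrime N))).comap (algebraMap E _) = r :=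
    IsLocalization.under_map_of_isPrime_disjoint N.primeCompl _ ‹_› hd
  generalize r.map (algebraMap E (Localization.AtPrime N)) = R at *
  obtain ⟨⟨r', hr'⟩, h1⟩ := PrimeSpectrum.comap_surjective_of_faithfullyFlat (B := Ĝ) ⟨R, hp⟩
  have h2 : r'.comap (algebraMap (Localization.AtPrime N) Ĝ) = R :=
    congrArg PrimeSpectrum.asIdeal h1
  have h3 : r'.comap (algebraMap D Ĝ) = ⊥ := by
    rw [← IsLocalization.map_under n.primeCompl D (r'.comap (algebraMap D Ĝ)), Ideal.under,
      Ideal.comap_comap, htower, ← Ideal.comap_comap, h2,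
      IsScalarTower.algebraMap_eq C E (Localization.AtPrime N), ← Ideal.comap_comap, hcm, hr, Ideal.map_bot]
  have h4 := hG r' h3
  have : r'.LiesOver R := ⟨h2.symm⟩
  let := Localization.AtPrime.algebraOfLiesOver R r'
  have h5 := isRegularLocalRing_of_flat (Localization.AtPrime R) (Localization.AtPrime r')
  have h6 := IsLocalization.isLocalization_isLocalization_atPrime_isLocalization N.primeCompl
    (Localization.AtPrime R) R
  simp only [hcm] at h6
  exact IsRegularLocalRing.of_ringEquiv
    (IsLocalization.algEquiv r.primeCompl (Localization.AtPrime R)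
      (Localization.AtPrime r)).toRingEquiv

theorem isIntegral_includeRight (A B E : Type u) [CommRing A] [CommRing B] [CommRing E] [Algebra A B]
    [Algebra A E] [Algebra.IsIntegral A B] :
    (Algebra.TensorProduct.includeRight : E →ₐ[A] B ⊗[A] E).toRingHom.IsIntegral := by
  have h : (algebraMap E (E ⊗[A] B)).IsIntegral :=
    algebraMap_isIntegral_iff.2 inferInstance
  have h1 := RingHom.IsIntegral.trans _ (Algebra.TensorProduct.comm A E B).toRingEquiv.toRingHom h
    (RingHom.isIntegral_of_surjective _ (Algebra.TensorProduct.comm A E B).surjective)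
  have h2 : (Algebra.TensorProduct.includeRight : E →ₐ[A] B ⊗[A] E).toRingHom =
      (Algebra.TensorProduct.comm A E B).toRingEquiv.toRingHom.comp
        (algebraMap E (E ⊗[A] B)) := by
    ext x
    simp [Algebra.TensorProduct.algebraMap_apply]
  rw [h2]
  exact h1

/-- A finite algebra over a local ring, base changed to the completion. -/
theorem IsCompl.exists_map_eq_of_isMaximal {C Ĉ : Type u} [CommRing C] [IsLocalRing C]
    [IsNoetherianRing C] [CommRing Ĉ] [IsLocalRing Ĉ] [Algebra C Ĉ] (hc : IsCompl C Ĉ) {B : Type u}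
    [CommRing B] [Algebra C B] [Algebra.IsIntegral C B] (N : Ideal (B ⊗[C] Ĉ)) [N.IsMaximal] :
    ∃ n : Ideal B, n.IsMaximal ∧ maximalIdeal C ≤ n.comap (algebraMap C B) ∧
      n.map (algebraMap B (B ⊗[C] Ĉ)) = N := by
  have h1 := Ideal.isMaximal_comap_of_isIntegral_of_isMaximal' _ (isIntegral_includeRight C B Ĉ) N
  have h2 := IsLocalRing.eq_maximalIdeal h1
  have h3 : (N.comap (algebraMap B (B ⊗[C] Ĉ))).comap (algebraMap C B) = maximalIdeal C := by
    have := isLocalHom_of_map_max hc.map_max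
    rw [Ideal.comap_comap, ← IsScalarTower.algebraMap_eq,
      ← IsLocalRing.maximalIdeal_comap (algebraMap C Ĉ), ← h2, Ideal.comap_comap]
    congr 1
    exact (Algebra.TensorProduct.includeRight : Ĉ →ₐ[C] B ⊗[C] Ĉ).comp_algebraMap.symm
  have h4 : (N.comap (algebraMap B (B ⊗[C] Ĉ))).IsMaximal := by
    refine Ideal.isMaximal_of_isIntegral_of_isMaximal_comap (R := C) _ ?_
    rw [h3]; infer_instance
  refine ⟨_, h4, h3.ge, ?_⟩
  exact (hc.isMaximal_map_tensor _ h3.ge).eq_of_le (Ideal.IsPrime.ne_top inferInstance)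
    Ideal.map_comap_le

end Fibres

section Fibres
open TensorProduct IsLocalRing

theorem exists_subalgebra_isFractionRing (R k K : Type u) [CommRing R] [IsDomain R] [Field k]
    [Algebra R k] [IsFractionRing R k] [Field K] [Algebra k K] [Algebra R K] [IsScalarTower R k K]
    [Module.Finite k K] : ∃ S : Subalgebra R K, Module.Finite R S ∧ IsFractionRing S K := by
  classical
  obtain ⟨s, hs⟩ := Module.Finite.fg_top (R := k) (M := K)
  obtain ⟨y, hy, h_int⟩ := exists_integral_multiples R k (L := K) s
  have hinj : Function.Injective (algebraMap R K) := by
    rw [IsScalarTower.algebraMap_eq R k K]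
    exact (algebraMap k K).injective.comp (IsFractionRing.injective R k)
  let t := s.image (y • ·)
  let S := Algebra.adjoin R (t : Set K)
  have hS : Module.Finite R S := Module.Finite.iff_fg.2 <| fg_adjoin_of_finite t.finite_toSet <| by
    intro x hx
    obtain ⟨z, hz, rfl⟩ := Finset.mem_image.1 (Finset.mem_coe.1 hx)
    exact h_int z hz
  refine ⟨S, hS, IsFractionRing.of_field _ _ fun z => ?_⟩
  have key : ∃ b : R, b ≠ 0 ∧ b • z ∈ S := by
    have hz : z ∈ Submodule.span k (s : Set K) := hs ▸ Submodule.mem_top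
    induction hz using Submodule.span_induction with
    | mem x hx => exact ⟨y, hy, Algebra.subset_adjoin (Finset.mem_coe.2 (Finset.mem_image_of_mem _ hx))⟩
    | zero => exact ⟨1, one_ne_zero, by simp⟩
    | add x z _ _ hx hz =>
      obtain ⟨b, hb, hb'⟩ := hx
      obtain ⟨c, hc, hc'⟩ := hz
      refine ⟨b * c, mul_ne_zero hb hc, ?_⟩
      rw [smul_add]
      refine add_mem ?_ ?_
      · rw [mul_comm, mul_smul]; exact Subalgebra.smul_mem _ hb' _
      · rw [mul_smul]; exact Subalgebra.smul_mem _ hc' _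
    | smul c x _ hx =>
      obtain ⟨b, hb, hb'⟩ := hx
      obtain ⟨u, v, hv, rfl⟩ := IsFractionRing.div_surjective R c
      have hv0 := nonZeroDivisors.ne_zero hv
      refine ⟨v * b, mul_ne_zero hv0 hb, ?_⟩
      have : (v * b) • (algebraMap R k u / algebraMap R k v) • x = u • b • x := by
        have : algebraMap R K v ≠ 0 := fun h => hv0 (hinj (by rw [h, map_zero]))
        simp only [Algebra.smul_def, map_div₀, map_mul, ← IsScalarTower.algebraMap_apply]
        field_simp
      rw [this]
      exact Subalgebra.smul_mem _ hb' _
  obtain ⟨b, hb, hb'⟩ := key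
  refine ⟨⟨b • z, hb'⟩, algebraMap R S b, ?_⟩
  have : algebraMap R K b ≠ 0 := fun h => hb (hinj (by rw [h, map_zero]))
  rw [← IsScalarTower.algebraMap_apply]
  change z = (b • z) / _
  rw [Algebra.smul_def]
  field_simp

theorem exists_finite_isFractionRing {C : Type u} [CommRing C] (p : Ideal C) [p.IsPrime] (K : Type u)
    [Field K] [Algebra p.ResidueField K] [Algebra C K] [IsScalarTower C p.ResidueField K]
    [Module.Finite p.ResidueField K] : ∃ S : Subalgebra C K, Module.Finite C S ∧
      IsFractionRing S K := by
  let : Algebra (C ⧸ p) K := ((algebraMap p.ResidueField K).comp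
    (algebraMap (C ⧸ p) p.ResidueField)).toAlgebra
  have h1 : IsScalarTower (C ⧸ p) p.ResidueField K := IsScalarTower.of_algebraMap_eq fun x => rfl
  have h2 : IsScalarTower C (C ⧸ p) K := IsScalarTower.of_algebraMap_eq fun x => by
    rw [IsScalarTower.algebraMap_apply (C ⧸ p) p.ResidueField K,
      ← IsScalarTower.algebraMap_apply C (C ⧸ p) p.ResidueField,
      ← IsScalarTower.algebraMap_apply C p.ResidueField K]
  obtain ⟨S, hS, hS'⟩ := exists_subalgebra_isFractionRing (C ⧸ p) p.ResidueField K
  have : Module.Finite C S := Module.Finite.trans (C ⧸ p) S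
  exact ⟨S.restrictScalars C, this, hS'⟩

theorem isRegularLocalRing_tensor_of_finite {A Â : Type u} [CommRing A] [IsLocalRing A]
    [IsNoetherianRing A] [CommRing Â] [IsLocalRing Â] [Algebra A Â] (hc : IsCompl A Â)
    (h : GeomRegFibres A Â) {C Ĉ : Type u} [CommRing C] [IsLocalRing C] [Algebra A C]
    [Algebra.EssFiniteType A C] [IsLocalHom (algebraMap A C)] [CommRing Ĉ] [IsLocalRing Ĉ]
    [Algebra C Ĉ] (hC : IsCompl C Ĉ) {B : Type u} [CommRing B] [IsDomain B] [Algebra C B]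
    [Module.Finite C B] (r : Ideal (B ⊗[C] Ĉ)) [r.IsPrime]
    (hr : r.comap (algebraMap B (B ⊗[C] Ĉ)) = ⊥) :
    IsRegularLocalRing (Localization.AtPrime r) := by
  have := hC.noeth; have := hC.flat
  have : IsNoetherianRing C := Algebra.EssFiniteType.isNoetherianRing A C
  have : IsNoetherianRing B := Algebra.FiniteType.isNoetherianRing C B
  have : IsNoetherianRing (B ⊗[C] Ĉ) := isNoetherianRing_tensor_of_essFiniteType C B Ĉ
  let : Algebra A B := ((algebraMap C B).comp (algebraMap A C)).toAlgebra
  have : IsScalarTower A C B := IsScalarTower.of_algebraMap_eq fun x => rfl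
  have : Algebra.EssFiniteType A B := .comp A C B
  obtain ⟨N, hN, hrN⟩ := r.exists_le_maximal (Ideal.IsPrime.ne_top inferInstance)
  obtain ⟨n, hn, hCn, hnN⟩ := hC.exists_map_eq_of_isMaximal N
  have hq : maximalIdeal A ≤ n.comap (algebraMap A B) := by
    rw [IsScalarTower.algebraMap_eq A C B, ← Ideal.comap_comap,
      ← IsLocalRing.maximalIdeal_comap (algebraMap A C)]
    exact Ideal.comap_mono hCn
  have : N.LiesOver n := ⟨by rw [← hnN]; exact (hC.comap_map_tensor n).symm⟩
  let := Localization.AtPrime.algebraOfLiesOver n N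
  let Ĝ := AdicCompletion (maximalIdeal (Localization.AtPrime N)) (Localization.AtPrime N)
  have hG : IsCompl (Localization.AtPrime N) Ĝ := IsCompl.adicCompletion _
  have hD : IsCompl (Localization.AtPrime n) Ĝ := isCompl_localization n N hnN
    (fun e => hnN ▸ hC.exists_sub_mem_map n hCn e) hG
  have hgen := (isGenReg_iff hD).1 (isGenReg_of_essFiniteType hc h B n hq)
  refine isRegularLocalRing_of_genReg_localization n N (D := Localization.AtPrime n) (Ĝ := Ĝ) ?_ hG
    hgen r hrN hr
  rw [IsScalarTower.algebraMap_eq B (Localization.AtPrime n) (Localization.AtPrime N),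
    IsScalarTower.algebraMap_eq (Localization.AtPrime n) (Localization.AtPrime N) Ĝ,
    RingHom.comp_assoc]

theorem isRegularRing_of_isLocalization_generic {B E K T : Type u} [CommRing B] [CommRing E]
    [Algebra B E] [IsNoetherianRing E] (M : Submonoid E) [CommRing T] [Algebra E T]
    [IsLocalization M T] [Field K] [Algebra B K] (hinj : Function.Injective (algebraMap B K))
    (g : K →+* T) (hg : g.comp (algebraMap B K) = (algebraMap E T).comp (algebraMap B E))
    (h : ∀ (r : Ideal E) [r.IsPrime], r.comap (algebraMap B E) = ⊥ →
      IsRegularLocalRing (Localization.AtPrime r)) : IsRegularRing T := by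
  have : IsNoetherianRing T := IsLocalization.isNoetherianRing M T inferInstance
  rw [isRegularRing_iff]
  intro R hR
  have h3 : (R.comap (algebraMap E T)).comap (algebraMap B E) = ⊥ := by
    rw [Ideal.comap_comap, ← hg, ← Ideal.comap_comap, Ideal.eq_bot_of_prime (R.comap g)]
    exact (RingHom.injective_iff_ker_eq_bot _).1 hinj
  have h5 := h _ h3
  have h6 := IsLocalization.isLocalization_isLocalization_atPrime_isLocalization M
    (Localization.AtPrime R) R
  exact IsRegularLocalRing.of_ringEquiv
    (IsLocalization.algEquiv (R.comap (algebraMap E T)).primeCompl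
      (Localization.AtPrime (R.comap (algebraMap E T))) (Localization.AtPrime R)).toRingEquiv

/-- Grothendieck: geometric regularity of the formal fibres passes to local algebras essentially of
finite type. -/
theorem GeomRegFibres.of_essFiniteType {A Â : Type u} [CommRing A] [IsLocalRing A]
    [IsNoetherianRing A] [CommRing Â] [IsLocalRing Â] [Algebra A Â] (hc : IsCompl A Â)
    (h : GeomRegFibres A Â) {C Ĉ : Type u} [CommRing C] [IsLocalRing C] [Algebra A C]
    [Algebra.EssFiniteType A C] [IsLocalHom (algebraMap A C)] [CommRing Ĉ] [IsLocalRing Ĉ]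
    [Algebra C Ĉ] (hC : IsCompl C Ĉ) : GeomRegFibres C Ĉ := by
  intro p _ K _ _ hK
  have := hC.noeth; have := hC.flat
  let : Algebra C K := ((algebraMap p.ResidueField K).comp (algebraMap C p.ResidueField)).toAlgebra
  have : IsScalarTower C p.ResidueField K := IsScalarTower.of_algebraMap_eq fun x => rfl
  obtain ⟨B, hB, hBK⟩ := exists_finite_isFractionRing p K
  have h1 (r : Ideal (B ⊗[C] Ĉ)) [r.IsPrime] (hr : r.comap (algebraMap B (B ⊗[C] Ĉ)) = ⊥) :=
    isRegularLocalRing_tensor_of_finite hc h hC r hr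
  have : IsNoetherianRing (B ⊗[C] Ĉ) := isNoetherianRing_tensor_of_essFiniteType C B Ĉ
  let M := Algebra.algebraMapSubmonoid (B ⊗[C] Ĉ) (nonZeroDivisors B)
  have h2 : IsRegularRing ((B ⊗[C] Ĉ) ⊗[B] K) :=
    isRegularRing_of_isLocalization_generic M (IsFractionRing.injective B K)
      (Algebra.TensorProduct.includeRight : K →ₐ[B] (B ⊗[C] Ĉ) ⊗[B] K).toRingHom
      (((Algebra.TensorProduct.includeRight :
        K →ₐ[B] (B ⊗[C] Ĉ) ⊗[B] K).comp_algebraMap).trans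
          (IsScalarTower.algebraMap_eq B (B ⊗[C] Ĉ) ((B ⊗[C] Ĉ) ⊗[B] K))) h1
  have h3 : IsRegularRing (K ⊗[B] (B ⊗[C] Ĉ)) := IsRegularRing.of_ringEquiv
    (R := (B ⊗[C] Ĉ) ⊗[B] K) (Algebra.TensorProduct.comm B _ _).toRingEquiv
  have h4 : IsRegularRing (K ⊗[C] Ĉ) := IsRegularRing.of_ringEquiv (R := K ⊗[B] (B ⊗[C] Ĉ))
    (Algebra.TensorProduct.cancelBaseChange C B B K Ĉ).toRingEquiv
  exact IsRegularRing.of_ringEquiv (R := K ⊗[C] Ĉ)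
    (Algebra.TensorProduct.cancelBaseChange C p.ResidueField p.ResidueField K Ĉ).symm.toRingEquiv

end Fibres

section Bridge
open TensorProduct IsLocalRing

theorem isRegularCommRing_iff {R : Type u} [CommRing R] [IsNoetherianRing R] :
    IsRegularCommRing R ↔ IsRegularRing R := by
  rw [isRegularRing_iff]
  exact ⟨fun h P _ => (IsRegularLocalRing.iff_finrank_cotangentSpace _).2 (h P).symm,
    fun h P _ => ((IsRegularLocalRing.iff_finrank_cotangentSpace _).1 (h P)).symm⟩

theorem isGRing_iff {A : Type u} [CommRing A] [IsLocalRing A] [IsNoetherianRing A] :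
    IsGRing A ↔ GeomRegFibres A (AdicCompletion (maximalIdeal A) A) := by
  have := isNoetherianRing_adicCompletion (maximalIdeal A)
  have key (p : Ideal A) [p.IsPrime] (K : Type u) [Field K] [Algebra p.ResidueField K]
      [Module.Finite p.ResidueField K] : IsNoetherianRing
        (K ⊗[p.ResidueField] (p.ResidueField ⊗[A] AdicCompletion (maximalIdeal A) A)) := by
    have : IsNoetherianRing (p.ResidueField ⊗[A] AdicCompletion (maximalIdeal A) A) :=
      isNoetherianRing_tensor_of_essFiniteType _ _ _
    exact isNoetherianRing_tensor_of_essFiniteType _ _ _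
  constructor
  · intro h p _ K _ _ hK
    have := key p K
    exact isRegularCommRing_iff.1 (h p K hK)
  · intro h p _ K _ _ hK
    have := key p K
    exact isRegularCommRing_iff.2 (h p K hK)

theorem isGRing_of_essFiniteType {A C : Type u} [CommRing A] [IsLocalRing A] [IsNoetherianRing A]
    (h : IsGRing A) [CommRing C] [IsLocalRing C] [Algebra A C] [Algebra.EssFiniteType A C]
    [IsLocalHom (algebraMap A C)] : IsGRing C := by
  have := Algebra.EssFiniteType.isNoetherianRing A C
  have := isNoetherianRing_adicCompletion (maximalIdeal A)
  have := isNoetherianRing_adicCompletion (maximalIdeal C)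
  exact isGRing_iff.2 <| .of_essFiniteType (.adicCompletion A) (isGRing_iff.1 h) (.adicCompletion C)

open AlgebraicGeometry in
theorem isGRing_stalk_of_locallyOfFiniteType {X S : Scheme.{u}} (f : X ⟶ S)
    [LocallyOfFiniteType f] [IsLocallyNoetherian S] (x : X)
    (h : IsGRing (S.presheaf.stalk (f x))) : IsGRing (X.presheaf.stalk x) := by
  have h1 := LocallyOfFiniteType.stalkMap f x
  have h2 : IsLocalHom (f.stalkMap x).hom := inferInstance
  algebraize [(f.stalkMap x).hom]
  exact isGRing_of_essFiniteType h

end Bridge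

section Catenary

/-- A partial order is catenary if saturated chains with the same endpoints have the same
length. -/
def IsCatenaryOrder (α : Type*) [PartialOrder α] : Prop :=
  ∀ p q : RelSeries {(a, b) : α × α | a ⋖ b}, p.head = q.head → p.last = q.last →
    p.length = q.length

theorem exists_covBy_relSeries {α : Type*} [PartialOrder α] [WellFoundedLT α] [WellFoundedGT α]
    (s : LTSeries α) : ∃ t : RelSeries {(a, b) : α × α | a ⋖ b},
      t.head = s.head ∧ t.last = s.last ∧ s.length ≤ t.length := by
  obtain ⟨t, i, h, h0, h1⟩ := s.exists_relSeries_covBy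
  refine ⟨t, ?_, ?_, ?_⟩
  · exact (congrArg t h0).symm.trans (congrFun h 0)
  · exact (congrArg t h1).symm.trans (congrFun h _)
  · simpa using Fintype.card_le_of_injective i i.injective

theorem exists_covBy_relSeries_of_le {α : Type*} [PartialOrder α] [WellFoundedLT α]
    [WellFoundedGT α] {a b : α} (h : a ≤ b) :
    ∃ t : RelSeries {(a, b) : α × α | a ⋖ b}, t.head = a ∧ t.last = b := by
  rcases h.eq_or_lt with rfl | h
  · exact ⟨RelSeries.singleton _ a, by simp⟩
  · obtain ⟨t, h0, h1, -⟩ := exists_covBy_relSeries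
      ((RelSeries.singleton _ b).cons a (by simpa using h) : LTSeries α)
    exact ⟨t, by simpa using h0, by simpa using h1⟩

namespace IsCatenaryOrder

variable {α : Type*} [PartialOrder α] [WellFoundedLT α] [WellFoundedGT α]

theorem height_eq_length [OrderBot α] (h : IsCatenaryOrder α)
    (t : RelSeries {(a, b) : α × α | a ⋖ b}) (ht : t.head = ⊥) :
    Order.height t.last = t.length := by
  apply le_antisymm
  · refine Order.height_le fun p hp => ?_
    obtain ⟨p', h0, h1, hle⟩ := exists_covBy_relSeries p
    obtain ⟨q, hq0, hq1⟩ := exists_covBy_relSeries_of_le (bot_le (a := p'.head))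
    have := h (q.smash p' hq1) t (by simp [hq0, ht]) (by simp [h1, hp])
    simp only [RelSeries.smash_length] at this
    norm_cast
    omega
  · exact Order.length_le_height_last (p := (t.ofLE (fun x hx => hx.lt) : LTSeries α))

theorem height_eq_add [OrderBot α] (h : IsCatenaryOrder α) {a b : α} (hab : a ≤ b) :
    Order.height b = Order.height a + Order.height (⟨b, hab⟩ : Set.Ici a) := by
  have hci {x y : Set.Ici a} (hxy : x ⋖ y) : (x : α) ⋖ y :=
    ⟨hxy.1, fun c h1 h2 => hxy.2 (c := ⟨c, x.2.trans h1.le⟩) h1 h2⟩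
  let φ : SetRel.Hom {(x, y) : Set.Ici a × Set.Ici a | x ⋖ y} {(x, y) : α × α | x ⋖ y} := ⟨Subtype.val, fun hxy => hci hxy⟩
  have h' : IsCatenaryOrder (Set.Ici a) := fun p q h0 h1 =>
    h (p.map φ) (q.map φ) (congrArg Subtype.val h0) (congrArg Subtype.val h1)
  obtain ⟨t, ht0, ht1⟩ := exists_covBy_relSeries_of_le (bot_le (a := a))
  obtain ⟨s, hs0, hs1⟩ := exists_covBy_relSeries_of_le (bot_le (a := (⟨b, hab⟩ : Set.Ici a)))
  have e1 := h.height_eq_length t ht0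
  have e2 := h'.height_eq_length s hs0
  have hc : t.last = (s.map φ).head := by
    rw [RelSeries.head_map, hs0, ht1]; rfl
  have e3 := h.height_eq_length (t.smash (s.map φ) hc) (by simp [ht0])
  have hb : (t.smash (s.map φ) hc).last = b := by
    rw [RelSeries.last_smash, RelSeries.last_map, hs1]; rfl
  rw [hb] at e3
  rw [ht1] at e1
  rw [hs1] at e2
  rw [e3, e1, e2]
  simp

end IsCatenaryOrder

end Catenary

section CatenaryRing

theorem wellFoundedGT_primeSpectrum (R : Type*) [CommRing R] [IsNoetherianRing R] :
    WellFoundedGT (PrimeSpectrum R) :=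
  StrictMono.wellFoundedGT (f := PrimeSpectrum.asIdeal) fun _ _ h => h

theorem wellFoundedLT_primeSpectrum (R : Type*) [CommRing R] [IsNoetherianRing R] :
    WellFoundedLT (PrimeSpectrum R) :=
  StrictMono.wellFoundedLT (f := Order.height) fun x y h => Order.height_strictMono h <| by
    rw [← PrimeSpectrum.height_eq_orderHeight]
    exact Ideal.height_lt_top x.2.ne_top

theorem IsCatenarySpace.isCatenaryOrder_primeSpectrum {R : Type*} [CommRing R]
    (h : IsCatenarySpace (PrimeSpectrum R)) : IsCatenaryOrder (PrimeSpectrum R) := by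
  let e := PrimeSpectrum.pointsEquivIrreducibleCloseds R
  let φ : SetRel.Hom {(x, y) : PrimeSpectrum R × PrimeSpectrum R | x ⋖ y}
      (SetRel.inv {(x, y) : TopologicalSpace.IrreducibleCloseds (PrimeSpectrum R) ×
        TopologicalSpace.IrreducibleCloseds (PrimeSpectrum R) | x ⋖ y}) :=
    ⟨fun x => OrderDual.ofDual (e x), fun {a b} hab => by
      have h1 : e a ⋖ e b := (apply_covBy_apply_iff e).2 hab
      exact h1.ofDual⟩
  intro p q h0 h1
  let f (p : RelSeries {(x, y) : PrimeSpectrum R × PrimeSpectrum R | x ⋖ y}) :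
      LTSeries (TopologicalSpace.IrreducibleCloseds (PrimeSpectrum R)) :=
    (p.map φ).reverse.ofLE fun x hx => CovBy.lt hx
  have hf (p) : IsSaturatedChain (f p) := fun i => (p.map φ).reverse.step i
  refine h (f p) (f q) ?_ ?_ (hf p) (hf q)
  · exact (RelSeries.head_reverse (p.map φ)).trans
      ((congrArg φ h1).trans (RelSeries.head_reverse (q.map φ)).symm)
  · exact (RelSeries.last_reverse (p.map φ)).trans
      ((congrArg φ h0).trans (RelSeries.last_reverse (q.map φ)).symm)

theorem height_comap_of_isCatenaryOrder {R B : Type*} [CommRing R] [IsDomain R]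
    [IsNoetherianRing R] [CommRing B] [IsDomain B] (h : IsCatenaryOrder (PrimeSpectrum R))
    (φ : R →+* B) (hφ : Function.Surjective φ) (P : Ideal B) [hP : P.IsPrime] :
    (P.comap φ).height = (RingHom.ker φ).height + P.height := by
  have := wellFoundedGT_primeSpectrum R
  have := wellFoundedLT_primeSpectrum R
  let Q : PrimeSpectrum R := ⟨RingHom.ker φ, RingHom.ker_isPrime φ⟩
  let e : PrimeSpectrum B ≃o Set.Ici Q :=
    { toFun := fun p => ⟨PrimeSpectrum.comap φ p, Ideal.comap_mono bot_le⟩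
      invFun := fun p => ⟨p.1.asIdeal.map φ, Ideal.map_isPrime_of_surjective hφ p.2⟩
      left_inv := fun p => PrimeSpectrum.ext (Ideal.map_comap_of_surjective φ hφ _)
      right_inv := fun p => Subtype.ext <| PrimeSpectrum.ext <| by
        have := p.2
        change (p.1.asIdeal.map φ).comap φ = _
        rw [Ideal.comap_map_of_surjective φ hφ]
        exact sup_eq_left.2 p.2
      map_rel_iff' := fun {a b} => Ideal.comap_le_comap_iff_of_surjective φ hφ _ _ }
  have h1 := h.height_eq_add (e ⟨P, hP⟩).2
  rw [← PrimeSpectrum.height_eq_orderHeight, ← PrimeSpectrum.height_eq_orderHeight] at h1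
  refine h1.trans ?_
  congr 1
  have := Order.height_orderIso e ⟨P, hP⟩
  rw [← PrimeSpectrum.height_eq_orderHeight] at this
  exact this

theorem height_mvPolynomial_of_isMaximal {A : Type*} [CommRing A] [IsNoetherianRing A]
    [IsJacobsonRing A] (n : ℕ) (P : Ideal (MvPolynomial (Fin n) A)) [P.IsMaximal] :
    (P.comap MvPolynomial.C).IsMaximal ∧ P.height = (P.comap MvPolynomial.C).height + n := by
  induction n with
  | zero =>
    let e := (MvPolynomial.isEmptyRingEquiv A (Fin 0)).symm
    have he : P.comap MvPolynomial.C = P.comap e := rfl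
    rw [he, RingEquiv.height_comap]
    exact ⟨Ideal.comap_isMaximal_of_equiv e, by simp⟩
  | succ n ih =>
    let e := (MvPolynomial.finSuccEquiv A n).symm
    let P1 : Ideal (Polynomial (MvPolynomial (Fin n) A)) := P.comap e
    have hP1 : P1.IsMaximal := Ideal.comap_isMaximal_of_equiv e
    have h1 : P1.height = P.height := RingEquiv.height_comap e.toRingEquiv P
    let P2 : Ideal (MvPolynomial (Fin n) A) := P1.comap Polynomial.C
    have hP2 : P2.IsMaximal := Polynomial.isMaximal_comap_C_of_isJacobsonRing P1
    have : P1.LiesOver P2 := ⟨rfl⟩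
    have h2 := Polynomial.height_eq_height_add_one P2 P1
    have h3 : P2.comap MvPolynomial.C = P.comap MvPolynomial.C := by
      change (((P.comap e).comap Polynomial.C).comap MvPolynomial.C) = _
      ext x
      simp only [Ideal.mem_comap]
      congr! 1
      apply (MvPolynomial.finSuccEquiv A n).injective
      simp [e, MvPolynomial.finSuccEquiv_apply]
    obtain ⟨h4, h5⟩ := ih P2
    rw [← h3, ← h1, h2, h5]
    exact ⟨h4, by push_cast; ring⟩

theorem height_add_height_ker_eq {A B : Type*} [CommRing A] [IsDomain A] [IsNoetherianRing A]
    [IsJacobsonRing A] [CommRing B] [IsDomain B] [Algebra A B] (n : ℕ)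
    (h : IsCatenaryOrder (PrimeSpectrum (MvPolynomial (Fin n) A)))
    (φ : MvPolynomial (Fin n) A →ₐ[A] B) (hφ : Function.Surjective φ) (P : Ideal B) [P.IsMaximal] :
    (P.comap (algebraMap A B)).IsMaximal ∧
      (RingHom.ker φ.toRingHom).height + P.height = (P.comap (algebraMap A B)).height + n := by
  have : (P.comap φ.toRingHom).IsMaximal := Ideal.comap_isMaximal_of_surjective φ.toRingHom hφ
  have h1 := height_mvPolynomial_of_isMaximal n (P.comap φ.toRingHom)
  rw [height_comap_of_isCatenaryOrder h φ.toRingHom hφ P] at h1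
  have h2 : (P.comap φ.toRingHom).comap MvPolynomial.C = P.comap (algebraMap A B) := by
    rw [Ideal.comap_comap]
    congr 1
    exact φ.comp_algebraMap
  rwa [h2] at h1

end CatenaryRing

section Reduced
open AlgebraicGeometry CategoryTheory

theorem isReduced_subscheme_vanishingIdeal {X : Scheme.{u}} (T : TopologicalSpace.Closeds X) :
    AlgebraicGeometry.IsReduced (Scheme.IdealSheafData.vanishingIdeal T).subscheme := by
  let I := Scheme.IdealSheafData.vanishingIdeal T
  have (x : I.subscheme) : _root_.IsReduced (I.subscheme.presheaf.stalk x) := by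
    obtain ⟨y, hy⟩ := I.subschemeCover.covers x
    let U := I.subschemeCover.idx x
    have h1 : _root_.IsReduced (Γ(X, U.1) ⧸ I.ideal U) := by
      rw [← Ideal.isRadical_iff_quotient_reduced]
      exact PrimeSpectrum.isRadical_vanishingIdeal _
    have h2 : AlgebraicGeometry.IsReduced (Spec (.of (Γ(X, U.1) ⧸ I.ideal U))) := inferInstance
    have h3 : AlgebraicGeometry.IsReduced (Spec (I.subschemeCover.X U)) := h2
    have h4 : _root_.IsReduced ((Spec (I.subschemeCover.X U)).presheaf.stalk y) := inferInstance
    rw [← hy]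
    exact isReduced_of_injective
      (asIso (Scheme.Hom.stalkMap (I.subschemeCover.f U) y)).commRingCatIsoToRingEquiv
      (RingEquiv.injective _)
  exact isReduced_of_isReduced_stalk _

theorem exists_isIntegral_isClosedImmersion {X : Scheme.{u}} {T : Set X} (hT : IsIrreducible T)
    (hT' : IsClosed T) : ∃ (Z : Scheme.{u}) (i : Z ⟶ X), IsIntegral Z ∧ IsClosedImmersion i ∧
      Set.range i = T := by
  let I := Scheme.IdealSheafData.vanishingIdeal ⟨T, hT'⟩
  have h : Set.range I.subschemeι = T := by
    rw [Scheme.IdealSheafData.range_subschemeι, Scheme.IdealSheafData.coe_support_vanishingIdeal]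
    rfl
  have := isReduced_subscheme_vanishingIdeal (X := X) ⟨T, hT'⟩
  have : IrreducibleSpace I.subscheme := by
    have := Subtype.irreducibleSpace (h ▸ hT)
    let e := I.subschemeι.isEmbedding.toHomeomorph.symm
    rw [irreducibleSpace_def]
    change IsIrreducible Set.univ
    rw [← e.range_eq_univ, ← Set.image_univ]
    exact (IrreducibleSpace.isIrreducible_univ _).image _ e.continuous.continuousOn
  exact ⟨I.subscheme, I.subschemeι, isIntegral_of_irreducibleSpace_of_isReduced _, inferInstance, h⟩

end Reduced

section Equicodim
open AlgebraicGeometry CategoryTheory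

theorem codimAbove_eq_coheight {Y : Type*} [TopologicalSpace Y]
    (Z : TopologicalSpace.IrreducibleCloseds Y) : codimAbove Z = Order.coheight Z := by
  rw [Order.coheight_eq_iSup_head_eq, codimAbove, iSup_subtype]

theorem isEquicodim_iff_coheight {α Y : Type*} [TopologicalSpace Y] [Preorder α]
    (e : α ≃o TopologicalSpace.IrreducibleCloseds Y) :
    IsEquicodim Y ↔ ∀ a b : α, IsMin a → IsMin b → Order.coheight a = Order.coheight b := by
  simp only [IsEquicodim, codimAbove_eq_coheight]
  refine ⟨fun h a b ha hb => ?_, fun h s t hs ht => ?_⟩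
  · rw [← Order.coheight_orderIso e, ← Order.coheight_orderIso e]
    exact h _ _ (e.isMin_apply.2 ha) (e.isMin_apply.2 hb)
  · rw [← Order.coheight_orderIso e.symm, ← Order.coheight_orderIso e.symm]
    exact h _ _ (e.symm.isMin_apply.2 hs) (e.symm.isMin_apply.2 ht)

/-- The order isomorphism on irreducible closed subsets induced by a homeomorphism. -/
def irreducibleClosedsCongr {Y Z : Type*} [TopologicalSpace Y] [TopologicalSpace Z] (e : Y ≃ₜ Z) :
    TopologicalSpace.IrreducibleCloseds Y ≃o TopologicalSpace.IrreducibleCloseds Z :=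
  OrderIso.ofHomInv
    (⟨_, TopologicalSpace.IrreducibleCloseds.map_mono e.continuous⟩ : _ →o _)
    (⟨_, TopologicalSpace.IrreducibleCloseds.map_mono e.symm.continuous⟩ : _ →o _)
    (by
      ext s : 2
      apply TopologicalSpace.IrreducibleCloseds.ext
      simp [e.image_closure, ← Set.image_comp, s.isClosed.closure_eq])
    (by
      ext s : 2
      apply TopologicalSpace.IrreducibleCloseds.ext
      simp [e.symm.image_closure, ← Set.image_comp, s.isClosed.closure_eq])

/-- The points of a scheme correspond to the irreducible closed subsets of the range of any
immersion out of it. -/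
noncomputable def rangeIrreducibleClosedsOrderIso {Z X : Scheme.{u}} (i : Z ⟶ X)
    [IsClosedImmersion i] : Z ≃o TopologicalSpace.IrreducibleCloseds (Set.range i) :=
  irreducibleSetEquivPoints.symm.trans
    (irreducibleClosedsCongr i.isClosedEmbedding.isEmbedding.toHomeomorph)

theorem topologicalKrullDim_range {Z X : Scheme.{u}} (i : Z ⟶ X) [IsClosedImmersion i] :
    topologicalKrullDim (Set.range i) = Order.krullDim Z :=
  (Order.krullDim_eq_of_orderIso (rangeIrreducibleClosedsOrderIso i)).symm

theorem isMin_iff_isClosed {Z : Scheme.{u}} (z : Z) : IsMin z ↔ IsClosed {z} := by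
  rw [← closure_subset_iff_isClosed]
  refine ⟨fun h y hy => ?_, fun h y hy => ?_⟩
  · have h1 : z ⤳ y := specializes_iff_mem_closure.2 hy
    exact (Scheme.le_iff_specializes.1 (h (Scheme.le_iff_specializes.2 h1))).antisymm h1 |>.eq
  · have h1 : y ∈ ({z} : Set Z) := h (specializes_iff_mem_closure.1 (Scheme.le_iff_specializes.1 hy))
    exact (Set.mem_singleton_iff.1 h1).ge

theorem isEquicodim_range_iff {Z X : Scheme.{u}} (i : Z ⟶ X) [IsClosedImmersion i] :
    IsEquicodim (Set.range i) ↔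
      ∀ a b : Z, IsClosed {a} → IsClosed {b} → Order.coheight a = Order.coheight b := by
  simp_rw [isEquicodim_iff_coheight (rangeIrreducibleClosedsOrderIso i), isMin_iff_isClosed]

end Equicodim

section LocalDimension
open AlgebraicGeometry CategoryTheory

theorem UniversallyCatenary.of_locallyOfFiniteType {X S : Scheme.{u}} (f : X ⟶ S)
    [LocallyOfFiniteType f] (h : UniversallyCatenary S) : UniversallyCatenary X :=
  fun Y g _ => h Y (g ≫ f) inferInstance

theorem exists_forall_height_add_eq {A B : CommRingCat.{u}} [IsDomain A] [IsNoetherianRing A]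
    [IsJacobsonRing A] [IsDomain B] (φ : A ⟶ B) (hφ : φ.hom.FiniteType)
    (h : UniversallyCatenary (Spec A)) : ∃ m n : ℕ, ∀ P : Ideal B, P.IsMaximal →
      (P.comap φ.hom).IsMaximal ∧ m + P.height = (P.comap φ.hom).height + n := by
  algebraize [φ.hom]
  obtain ⟨n, ψ, hψ⟩ := Algebra.FiniteType.iff_quotient_mvPolynomial''.1 hφ
  have h1 : LocallyOfFiniteType
      (Spec.map (CommRingCat.ofHom (MvPolynomial.C : A →+* MvPolynomial (Fin n) A))) := by
    rw [HasRingHomProperty.Spec_iff (P := @LocallyOfFiniteType)]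
    rw [CommRingCat.hom_ofHom, ← MvPolynomial.algebraMap_eq, RingHom.finiteType_algebraMap]
    infer_instance
  have h2 : IsCatenarySpace (PrimeSpectrum (MvPolynomial (Fin n) A)) := h _ _ h1
  have h3 := IsCatenarySpace.isCatenaryOrder_primeSpectrum h2
  have h4 : (RingHom.ker ψ.toRingHom).height ≠ ⊤ :=
    (Ideal.height_lt_top (RingHom.ker_ne_top _)).ne
  obtain ⟨m, hm⟩ := ENat.ne_top_iff_exists.1 h4
  refine ⟨m, n, fun P hP => ?_⟩
  obtain ⟨h5, h6⟩ := height_add_height_ker_eq n h3 ψ hψ P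
  exact ⟨h5, by rw [hm]; exact h6⟩

theorem exists_forall_coheight_add_eq {X S : Scheme.{u}} [IsIntegral X] [IsIntegral S]
    [JacobsonSpace S] [IsLocallyNoetherian S] (f : X ⟶ S) [LocallyOfFiniteType f]
    (h : UniversallyCatenary S) {A B : CommRingCat.{u}} [Nonempty (Spec B)] (i : Spec B ⟶ X)
    (j : Spec A ⟶ S) [IsOpenImmersion i] [IsOpenImmersion j] (φ : A ⟶ B)
    (w : i ≫ f = Spec.map φ ≫ j) : ∃ m n : ℕ, ∀ z : Spec B, IsClosed {i z} →
      IsClosed {f (i z)} ∧ m + Order.coheight (i z) = Order.coheight (f (i z)) + n := by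
  have : JacobsonSpace X := LocallyOfFiniteType.jacobsonSpace f
  have : LocallyOfFiniteType (Spec.map φ) := by
    have : LocallyOfFiniteType (Spec.map φ ≫ j) := w ▸ inferInstance
    exact locallyOfFiniteType_of_comp _ j
  have hφ : φ.hom.FiniteType := HasRingHomProperty.Spec_iff.1 this
  have : Nonempty (Spec A) := .map (Spec.map φ) inferInstance
  have : IsDomain A := (affine_isIntegral_iff A).1 (isIntegral_of_isOpenImmersion j)
  have : IsDomain B := (affine_isIntegral_iff B).1 (isIntegral_of_isOpenImmersion i)
  have : IsJacobsonRing A := PrimeSpectrum.isJacobsonRing_iff_jacobsonSpace.2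
    (JacobsonSpace.of_isOpenEmbedding j.isOpenEmbedding)
  have : IsLocallyNoetherian (Spec A) := isLocallyNoetherian_of_isOpenImmersion j
  have : IsNoetherianRing A := isLocallyNoetherian_Spec.1 this
  obtain ⟨m, n, hmn⟩ := exists_forall_height_add_eq φ hφ (UniversallyCatenary.of_locallyOfFiniteType j h)
  refine ⟨m, n, fun z hz => ?_⟩
  have h1 : z ∈ closedPoints (Spec B) := by
    rw [← i.isOpenEmbedding.preimage_closedPoints]
    exact hz
  have h2 : z.asIdeal.IsMaximal := (PrimeSpectrum.isClosed_singleton_iff_isMaximal z).1 h1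
  obtain ⟨h3, h4⟩ := hmn _ h2
  have h5 : f (i z) = j (Spec.map φ z) := by
    rw [← Scheme.Hom.comp_apply, w, Scheme.Hom.comp_apply]
  have h6 : IsClosed {Spec.map φ z} := (PrimeSpectrum.isClosed_singleton_iff_isMaximal _).2 h3
  rw [h5]
  constructor
  · rw [← mem_closedPoints_iff, ← Set.mem_preimage, j.isOpenEmbedding.preimage_closedPoints]
    exact h6
  · rw [coheight_eq_of_isOpenImmersion, coheight_eq_of_isOpenImmersion,
      ← idealHeight_eq_coheight, ← idealHeight_eq_coheight]
    exact h4

end LocalDimension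

section GlobalDimension
open AlgebraicGeometry CategoryTheory

theorem exists_opens_forall_coheight_add_eq {X S : Scheme.{u}} [IsIntegral X] [IsIntegral S]
    [JacobsonSpace S] [IsLocallyNoetherian S] (f : X ⟶ S) [LocallyOfFiniteType f]
    (h : UniversallyCatenary S) (x : X) : ∃ U : X.Opens, x ∈ U ∧ ∃ m n : ℕ, ∀ y ∈ U, IsClosed {y} →
      IsClosed {f y} ∧ m + Order.coheight y = Order.coheight (f y) + n := by
  obtain ⟨V, hV, hxV, -⟩ := exists_isAffineOpen_mem_and_subset
    (TopologicalSpace.Opens.mem_top (f x))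
  obtain ⟨U, hU, hxU, hUV⟩ := exists_isAffineOpen_mem_and_subset (x := x) (U := f ⁻¹ᵁ V) hxV
  obtain ⟨z, hz⟩ : x ∈ Set.range hU.fromSpec := by rwa [hU.range_fromSpec]
  have : Nonempty (Spec Γ(X, U)) := ⟨z⟩
  obtain ⟨m, n, hmn⟩ := exists_forall_coheight_add_eq f h hU.fromSpec hV.fromSpec
    (f.appLE V U hUV) (hV.SpecMap_appLE_fromSpec f hU hUV).symm
  refine ⟨U, hxU, m, n, fun y hy hy' => ?_⟩
  obtain ⟨z, rfl⟩ : y ∈ Set.range hU.fromSpec := by rwa [hU.range_fromSpec]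
  exact hmn z hy'

theorem krullDim_ne_top_and_coheight_eq {X S : Scheme.{u}} [IsIntegral X] [IsIntegral S]
    [JacobsonSpace S] [IsLocallyNoetherian S] (f : X ⟶ S) [LocallyOfFiniteType f]
    (h : UniversallyCatenary S) (hS : Order.krullDim S ≠ ⊤)
    (hS' : ∀ s t : S, IsClosed {s} → IsClosed {t} → Order.coheight s = Order.coheight t) :
    Order.krullDim X ≠ ⊤ ∧
      ∀ x y : X, IsClosed {x} → IsClosed {y} → Order.coheight x = Order.coheight y := by
  have : JacobsonSpace X := LocallyOfFiniteType.jacobsonSpace f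
  have hS'' (s : S) : Order.coheight s ≠ ⊤ := fun hs => by
    have := Order.coheight_le_krullDim s
    rw [hs] at this
    exact hS (top_le_iff.1 this)
  have hX (x : X) (hx : IsClosed {x}) : Order.coheight x ≠ ⊤ := fun hx' => by
    obtain ⟨U, hxU, m, n, hmn⟩ := exists_opens_forall_coheight_add_eq f h x
    have h1 := (hmn x hxU hx).2
    rw [hx', add_top] at h1
    exact (WithTop.add_ne_top.2 ⟨hS'' _, ENat.natCast_ne_top n⟩) h1.symm
  have hX' (x y : X) (hx : IsClosed {x}) (hy : IsClosed {y}) :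
      Order.coheight x = Order.coheight y := by
    obtain ⟨U, hxU, m, n, hmn⟩ := exists_opens_forall_coheight_add_eq f h x
    obtain ⟨V, hyV, k, l, hkl⟩ := exists_opens_forall_coheight_add_eq f h y
    obtain ⟨z, ⟨hzU, hzV⟩, hz⟩ := nonempty_inter_closedPoints
      (nonempty_preirreducible_inter U.2 V.2 ⟨x, hxU⟩ ⟨y, hyV⟩) (U.2.inter V.2).isLocallyClosed
    have hz : IsClosed {z} := hz
    trans Order.coheight z
    · have h1 := hmn x hxU hx
      have h2 := hmn z hzU hz
      refine ENat.add_right_injective_of_ne_top (ENat.natCast_ne_top m) ?_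
      simp only [h1.2, h2.2, hS' _ _ h1.1 h2.1]
    · have h1 := hkl y hyV hy
      have h2 := hkl z hzV hz
      refine ENat.add_right_injective_of_ne_top (ENat.natCast_ne_top k) ?_
      simp only [h1.2, h2.2, hS' _ _ h1.1 h2.1]
  have hX'' (x : X) : ∃ y ≤ x, IsClosed {y} := by
    obtain ⟨y, hy, hy'⟩ := nonempty_inter_closedPoints (Z := closure {x})
      ⟨x, subset_closure rfl⟩ isClosed_closure.isLocallyClosed
    exact ⟨y, Scheme.le_iff_specializes.2 (specializes_iff_mem_closure.2 hy), hy'⟩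
  refine ⟨?_, hX'⟩
  obtain ⟨x₀⟩ : Nonempty X := inferInstance
  obtain ⟨y, -, hy⟩ := hX'' x₀
  rw [Order.krullDim_eq_iSup_coheight_of_nonempty]
  have h1 : ⨆ x : X, Order.coheight x ≤ Order.coheight y := iSup_le fun x => by
    obtain ⟨z, hzx, hz⟩ := hX'' x
    exact (Order.coheight_anti hzx).trans (hX' z y hz hy).le
  exact fun h2 => (h1.trans_lt (hX y hy).lt_top).ne (WithBot.coe_eq_top.1 h2)

theorem exists_comp_eq_of_range_subset {Z X Y : Scheme.{u}} [AlgebraicGeometry.IsReduced Z]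
    (g : Z ⟶ X) (i : Y ⟶ X) [IsClosedImmersion i] (h : Set.range g ⊆ Set.range i) :
    ∃ l : Z ⟶ Y, l ≫ i = g := by
  have h1 : Surjective (Limits.pullback.fst g i) := by
    refine ⟨fun z => ?_⟩
    obtain ⟨y, hy⟩ := h ⟨z, rfl⟩
    obtain ⟨p, hp, -⟩ := Scheme.Pullback.exists_preimage_pullback z y hy.symm
    exact ⟨p, hp⟩
  have := isIso_of_isClosedImmersion_of_surjective (Limits.pullback.fst g i)
  exact ⟨inv (Limits.pullback.fst g i) ≫ Limits.pullback.snd g i, by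
    rw [Category.assoc, ← Limits.pullback.condition, IsIso.inv_hom_id_assoc]⟩

theorem finite_dimensional_and_isEquicodim {X S : Scheme.{u}} (f : X ⟶ S)
    [LocallyOfFiniteType f] [JacobsonSpace S] [IsLocallyNoetherian S] (h : UniversallyCatenary S)
    (hS : ∀ T ∈ irreducibleComponents S, topologicalKrullDim T ≠ ⊤ ∧ IsEquicodim T)
    (T : Set X) (hT : T ∈ irreducibleComponents X) :
    topologicalKrullDim T ≠ ⊤ ∧ IsEquicodim T := by
  obtain ⟨Z, i, hZ, hi, rfl⟩ := exists_isIntegral_isClosedImmersion hT.1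
    (isClosed_of_mem_irreducibleComponents T hT)
  obtain ⟨T', hT', hTT'⟩ := exists_mem_irreducibleComponents_subset_of_isIrreducible
    (f '' Set.range i) (hT.1.image f f.continuous.continuousOn)
  have hS' := hS T' hT'
  obtain ⟨S', j, hS', hj, rfl⟩ := exists_isIntegral_isClosedImmersion hT'.1
    (isClosed_of_mem_irreducibleComponents T' hT')
  obtain ⟨g, hg⟩ := exists_comp_eq_of_range_subset (i ≫ f) j (by
    rwa [Scheme.Hom.comp_base, TopCat.coe_comp, Set.range_comp])
  have : LocallyOfFiniteType g := by
    have : LocallyOfFiniteType (g ≫ j) := hg ▸ inferInstance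
    exact locallyOfFiniteType_of_comp g j
  have : JacobsonSpace S' := LocallyOfFiniteType.jacobsonSpace j
  have : IsLocallyNoetherian S' := LocallyOfFiniteType.isLocallyNoetherian j
  have h1 := hS (Set.range j) hT'
  rw [topologicalKrullDim_range, isEquicodim_range_iff] at h1 ⊢
  exact krullDim_ne_top_and_coheight_eq g (UniversallyCatenary.of_locallyOfFiniteType j h) h1.1 h1.2

end GlobalDimension

end GTransfer

theorem properties_transfer_of_locallyOfFiniteType (S X : Scheme.{u}) (f : X ⟶ S)
    [LocallyOfFiniteType f]
    (h1 : JacobsonSpace S) (h2 : UniversallyCatenary S) (h3 : IsLocallyNoetherian S)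
    (h4 : ∀ s : S, IsGRing (S.presheaf.stalk s))
    (h5 : ∀ T ∈ irreducibleComponents S,
      topologicalKrullDim ↥T ≠ ⊤ ∧ IsEquicodim ↥T) :
    JacobsonSpace X ∧ UniversallyCatenary X ∧ IsLocallyNoetherian X ∧
    (∀ x : X, IsGRing (X.presheaf.stalk x)) ∧
    (∀ T ∈ irreducibleComponents X,
      topologicalKrullDim ↥T ≠ ⊤ ∧ IsEquicodim ↥T) := by
  exact
    ⟨LocallyOfFiniteType.jacobsonSpace f, GTransfer.UniversallyCatenary.of_locallyOfFiniteType f h2,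
      LocallyOfFiniteType.isLocallyNoetherian f,
      fun x => GTransfer.isGRing_stalk_of_locallyOfFiniteType f x (h4 _),
      GTransfer.finite_dimensional_and_isEquicodim f h2 h5⟩
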